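/- Let Σ_A be a topologically mixing subshift of finite type, let μ, μ' ∈ M^e(Σ_A) be distinct CO-measures, and let U be a convex open subset of M(Σ_A) containing μ and μ'. Then there exists a continuous injective map t ∈ [0,1] ↦ θ_t ∈ U ∩ M^e(Σ_A) that is a homeomorphism onto its image, with θ_0 = μ and θ_1 = μ', such that for every t ∈ (0,1) the measure θ_t is fully supported on Σ_A (gives positive measure to every non-empty open subset) and Bernoulli (the system (Σ_A, σ, θ_t) is measure-theoretically isomorphic to a two-sided Bernoulli shift). -/

import Mathlib

open MeasureTheory Topology Filter
open scoped ENNReal NNReal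

/-- The left shift `σ`. -/
def shift {A : Type*} : (ℤ → A) → (ℤ → A) := fun x i => x (i + 1)

/-- The subshift of finite type determined by the 0-1 transition matrix `A`
(encoded as a Boolean matrix). -/
def SigmaA {t : ℕ} (A : Fin t → Fin t → Bool) : Set (ℤ → Fin t) :=
  {x | ∀ i : ℤ, A (x i) (x (i + 1)) = true}

lemma shift_mem_SigmaA {t : ℕ} {A : Fin t → Fin t → Bool} {x : ℤ → Fin t}
    (hx : x ∈ SigmaA A) : shift x ∈ SigmaA A := fun i => hx (i + 1)

/-- The left shift acting on `Σ_A`. -/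
def shiftA {t : ℕ} (A : Fin t → Fin t → Bool) : ↥(SigmaA A) → ↥(SigmaA A) :=
  fun x => ⟨shift x.val, shift_mem_SigmaA x.property⟩

/-- `Σ_A` is topologically mixing: some power of the transition matrix has all entries
nonzero, i.e. any two symbols are joined by an admissible word of length `n`. -/
def TopMixing {t : ℕ} (A : Fin t → Fin t → Bool) : Prop :=
  ∃ n : ℕ, 0 < n ∧ ∀ i j : Fin t, ∃ w : ℕ → Fin t,
    w 0 = i ∧ w n = j ∧ ∀ m < n, A (w m) (w (m + 1)) = true

section Generic
variable {X : Type*} [MeasurableSpace X]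

/-- The set of `T`-invariant Borel probability measures. -/
def InvMeas (T : X → X) : Set (ProbabilityMeasure X) :=
  {μ | MeasurePreserving T μ.toMeasure μ.toMeasure}

/-- The set of `T`-invariant ergodic Borel probability measures. -/
def ErgMeas (T : X → X) : Set (ProbabilityMeasure X) :=
  {μ | Ergodic T μ.toMeasure}

/-- A `CO`-measure: an invariant ergodic probability measure supported on the orbit of a
single periodic point. -/
def IsCOMeas (T : X → X) (μ : ProbabilityMeasure X) : Prop :=
  Ergodic T μ.toMeasure ∧
    ∃ (x : X) (n : ℕ), 0 < n ∧ T^[n] x = x ∧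
      μ.toMeasure {y | ∃ k : ℕ, y = T^[k] x} = 1

/-- Convexity for a set of probability measures. -/
def ConvexMeasSet (U : Set (ProbabilityMeasure X)) : Prop :=
  ∀ μ ∈ U, ∀ ν ∈ U, ∀ s : ℝ≥0∞, s ≤ 1 → ∀ ρ : ProbabilityMeasure X,
    ρ.toMeasure = s • μ.toMeasure + (1 - s) • ν.toMeasure → ρ ∈ U

/-- A measure is fully supported if it gives positive measure to every non-empty open set. -/
def FullSupp [TopologicalSpace X] (μ : ProbabilityMeasure X) : Prop :=
  ∀ U : Set X, IsOpen U → U.Nonempty → 0 < μ.toMeasure U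

/-- Measure-theoretic isomorphism of the measure-preserving systems `(X,T,μ)` and `(Y,S,ν)`. -/
def MeasureIso {Y : Type*} [MeasurableSpace Y] (T : X → X) (S : Y → Y)
    (μ : Measure X) (ν : Measure Y) : Prop :=
  ∃ (φ : X → Y) (ψ : Y → X), Measurable φ ∧ Measurable ψ ∧
    Measure.map φ μ = ν ∧ Measure.map ψ ν = μ ∧
    (∀ᵐ x ∂μ, ψ (φ x) = x) ∧ (∀ᵐ y ∂ν, φ (ψ y) = y) ∧
    (∀ᵐ x ∂μ, φ (T x) = S (φ x))

/-- The system `(X,T,μ)` is Bernoulli: it is measure-theoretically isomorphic to a two-sided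
Bernoulli shift. -/
def IsBernoulli (T : X → X) (μ : Measure X) : Prop :=
  ∃ (p : ℕ → ℝ≥0∞) (ν : Measure (ℤ → ℕ)), (∑' n, p n) = 1 ∧
    IsProbabilityMeasure ν ∧
    (∀ (n : ℕ) (w : Fin n → ℕ) (j : ℤ),
      ν {y | ∀ i : Fin n, y (j + (i : ℕ)) = w i} = ∏ i, p (w i)) ∧
    MeasureIso T shift μ ν

end Generic



section BernoulliMeasure
variable {E : Type*} [MeasurableSpace E] (m : Measure E) [IsProbabilityMeasure m]

/-- The two-sided product measure. -/
noncomputable def bern : Measure (ℤ → E) := Measure.infinitePi (fun _ : ℤ => m)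

instance : IsProbabilityMeasure (bern m) := by unfold bern; infer_instance

lemma measurable_shift {E : Type*} [MeasurableSpace E] : Measurable (shift : (ℤ → E) → (ℤ → E)) := by
  unfold shift; fun_prop

lemma shift_iter {E : Type*} (n : ℕ) (x : ℤ → E) (i : ℤ) : shift^[n] x i = x (i + n) := by
  induction n generalizing x with
  | zero => simp
  | succ n ih => rw [Function.iterate_succ_apply, ih]; simp only [shift]; congr 1; push_cast; ring

lemma mp_reindex (f : ℤ → ℤ) (hf : Function.Injective f) :
    MeasurePreserving (fun (y : ℤ → E) i => y (f i)) (bern m) (bern m) := by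
  refine ⟨by fun_prop, ?_⟩
  unfold bern
  exact Measure.map_infinitePi_infinitePi_of_inj (P := fun _ : ℤ => m) hf

lemma mp_shift : MeasurePreserving shift (bern m) (bern m) :=
  mp_reindex m (fun i => i + 1) (fun a b h => by simpa using h)

lemma indep_coord (S T : Set ℤ) (hST : Disjoint S T) (F H : Set (ℤ → E))
    (hF : MeasurableSet F) (hH : MeasurableSet H)
    (hFS : ∀ y y' : ℤ → E, (∀ i ∈ S, y i = y' i) → y ∈ F → y' ∈ F)
    (hHT : ∀ y y' : ℤ → E, (∀ i ∈ T, y i = y' i) → y ∈ H → y' ∈ H) :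
    bern m (F ∩ H) = bern m F * bern m H := by
  classical
  have hne : Nonempty E := nonempty_of_isProbabilityMeasure m
  obtain ⟨e0⟩ := hne
  have key : ∀ (S : Set ℤ) (F : Set (ℤ → E)), MeasurableSet F →
      (∀ y y' : ℤ → E, (∀ i ∈ S, y i = y' i) → y ∈ F → y' ∈ F) →
      MeasurableSet[⨆ i ∈ S, MeasurableSpace.comap (fun y : ℤ → E => y i) inferInstance] F := by
    intro S F hF h
    have hm : @Measurable _ _ (⨆ i ∈ S, MeasurableSpace.comap (fun y : ℤ → E => y i) inferInstance) _
        (fun y : ℤ → E => fun i : ℤ => if i ∈ S then y i else e0) := by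
      refine @measurable_pi_lambda _ _ _ (_) _ _ ?_
      intro i
      by_cases hi : i ∈ S
      · simp only [hi, if_true]
        refine Measurable.mono (comap_measurable _) ?_ le_rfl
        exact le_iSup₂_of_le i hi le_rfl
      · simp only [hi, if_false]
        exact @measurable_const _ _ _ (_) _
    have : F = (fun y : ℤ → E => fun i : ℤ => if i ∈ S then y i else e0) ⁻¹' F := by
      ext y
      constructor
      · intro hy; exact h _ _ (fun i hi => by simp [hi]) hy
      · intro hy; exact h _ _ (fun i hi => by simp [hi]) hy
    rw [this]
    exact hm hF
  have h1 : ProbabilityTheory.iIndepFun (fun (i : ℤ) (y : ℤ → E) => y i) (bern m) :=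
    ProbabilityTheory.iIndepFun_infinitePi (P := fun _ : ℤ => m) (X := fun _ ω => ω) (by fun_prop)
  have h2 := ProbabilityTheory.indep_iSup_of_disjoint
    (m := fun i : ℤ => MeasurableSpace.comap (fun y : ℤ → E => y i) inferInstance)
    (fun i => (measurable_pi_apply i).comap_le) h1 hST
  exact (ProbabilityTheory.Indep_iff _ _ _).1 h2 F H (key S F hF hFS) (key T H hH hHT)

lemma bern_eval (i : ℤ) (S : Set E) (hS : MeasurableSet S) :
    bern m {y | y i ∈ S} = m S := by
  have := (measurePreserving_eval_infinitePi (fun _ : ℤ => m) i).measure_preimage hS.nullMeasurableSet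
  exact this

lemma indep_update (k : ℤ) (F : Set (ℤ → E)) (hF : MeasurableSet F) (S : Set E)
    (hS : MeasurableSet S)
    (hFk : ∀ y y' : ℤ → E, (∀ i, i ≠ k → y i = y' i) → y ∈ F → y' ∈ F) :
    bern m (F ∩ {y | y k ∈ S}) = bern m F * m S := by
  rw [indep_coord m {k}ᶜ {k} (by simp) F {y | y k ∈ S} hF (measurable_pi_apply k hS)
    (fun y y' h => hFk y y' (fun i hi => h i hi))
    (fun y y' h => by simp [h k rfl]), bern_eval m k S hS]

lemma real_symm {α : Type*} [MeasurableSpace α] (μ : Measure α) [IsFiniteMeasure μ] (s t : Set α) :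
    |μ.real s - μ.real t| ≤ μ.real (symmDiff s t) := by
  have h1 : μ.real s ≤ μ.real t + μ.real (symmDiff s t) := by
    refine (measureReal_mono ?_).trans (measureReal_union_le _ _)
    intro x hx
    by_cases h : x ∈ t
    · exact Or.inl h
    · exact Or.inr (Or.inl ⟨hx, h⟩)
  have h2 : μ.real t ≤ μ.real s + μ.real (symmDiff s t) := by
    refine (measureReal_mono ?_).trans (measureReal_union_le _ _)
    intro x hx
    by_cases h : x ∈ s
    · exact Or.inl h
    · exact Or.inr (Or.inr ⟨hx, h⟩)
  rw [abs_le]; constructor <;> linarith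

lemma ergodic_bern : Ergodic shift (bern m) := by
  refine ⟨mp_shift m, ⟨?_⟩⟩
  intro s hs hinv
  have hiter : ∀ N : ℕ, shift^[N] ⁻¹' s = s := by
    intro N
    induction N with
    | zero => rfl
    | succ n ih => rw [Function.iterate_succ, Set.preimage_comp, ih, hinv]
  have hdense := Measure.MeasureDense.of_generateFrom_isSetAlgebra_finite (bern m)
    (𝒜 := measurableCylinders (fun _ : ℤ => E))
    (by
      refine ⟨?_, ?_, ?_⟩
      · exact empty_mem_measurableCylinders _
      · intro s hs; exact compl_mem_measurableCylinders hs
      · intro s t hs ht; exact union_mem_measurableCylinders hs ht)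
    generateFrom_measurableCylinders.symm
  set a := (bern m).real s with ha
  have key : ∀ ε : ℝ, 0 < ε → |a - a * a| ≤ 5 * ε := by
    intro ε hε
    obtain ⟨C, hC, hsC⟩ := hdense.approx s hs (measure_ne_top _ _) ε hε
    have hsC' : (bern m).real (symmDiff s C) < ε := by
      rw [measureReal_def]
      exact (ENNReal.toReal_lt_of_lt_ofReal hsC)
    have hCm := hdense.measurable C hC
    obtain ⟨I, S, hS, rfl⟩ := (mem_measurableCylinders C).1 hC
    set C : Set (ℤ → E) := cylinder (α := fun _ : ℤ => E) I S with hCdef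
    obtain ⟨b, hb⟩ : ∃ b : ℕ, ∀ i ∈ I, |i| < b := by
      refine ⟨∑ i ∈ I, i.natAbs + 1, fun i hi => ?_⟩
      have := Finset.single_le_sum (f := fun i : ℤ => i.natAbs) (fun _ _ => Nat.zero_le _) hi
      rw [Int.abs_eq_natAbs]; omega
    set N := 2 * b
    have hdep : ∀ y y' : ℤ → E, (∀ i ∈ (I : Set ℤ), y i = y' i) → y ∈ C → y' ∈ C := by
      intro y y' h hy
      rw [hCdef, mem_cylinder] at hy ⊢
      convert hy using 1
      ext i
      exact (h i i.2).symm
    have hmpN := (mp_shift m).iterate N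
    have hind := indep_coord m (I : Set ℤ) ((fun i => i + (N : ℤ)) '' (I : Set ℤ)) (by
        rw [Set.disjoint_left]
        rintro i hi ⟨j, hj, rfl⟩
        have h1 := hb _ hi
        have h2 := hb _ hj
        rw [abs_lt] at h1 h2
        simp only [N] at h1
        push_cast at h1
        omega) C (shift^[N] ⁻¹' C) hCm (hmpN.measurable hCm) hdep (by
        intro y y' h hy
        refine hdep (shift^[N] y) _ (fun i hi => ?_) hy
        rw [shift_iter, shift_iter]
        exact h _ ⟨i, hi, rfl⟩)
    rw [hmpN.measure_preimage hCm.nullMeasurableSet] at hind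
    have hind' : (bern m).real (C ∩ shift^[N] ⁻¹' C) = (bern m).real C * (bern m).real C := by
      simp [measureReal_def, hind]
    have h1 := real_symm (bern m) s C
    have h2 : |(bern m).real s - (bern m).real (C ∩ shift^[N] ⁻¹' C)| ≤ 2 * ε := by
      refine (real_symm _ _ _).trans ?_
      have h3 : (bern m).real (shift^[N] ⁻¹' (symmDiff s C)) = (bern m).real (symmDiff s C) := by
        simp only [measureReal_def]
        rw [hmpN.measure_preimage (hs.symmDiff hCm).nullMeasurableSet]
      have h4 : symmDiff s (C ∩ shift^[N] ⁻¹' C) ⊆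
          symmDiff s C ∪ shift^[N] ⁻¹' (symmDiff s C) := by
        intro x hx
        have hx' : x ∈ s ↔ shift^[N] x ∈ s := by
          conv_lhs => rw [← hiter N]
          rfl
        simp only [Set.mem_symmDiff, Set.mem_inter_iff, Set.mem_preimage, Set.mem_union] at hx ⊢
        tauto
      have := (measureReal_mono (μ := bern m) h4).trans (measureReal_union_le _ _)
      linarith
    have hc : |a - (bern m).real C| ≤ ε := h1.trans hsC'.le
    have ha0 : 0 ≤ a ∧ a ≤ 1 := ⟨measureReal_nonneg, measureReal_le_one⟩
    have hc0 : 0 ≤ (bern m).real C ∧ (bern m).real C ≤ 1 := ⟨measureReal_nonneg, measureReal_le_one⟩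
    rw [hind', abs_le] at h2
    rw [abs_le] at hc ⊢
    constructor <;> nlinarith
  have h0 : a - a * a = 0 := by
    by_contra hne
    have := key (|a - a * a| / 10) (by positivity)
    have h2 : 0 < |a - a * a| := by positivity
    linarith
  have h01 : a = 0 ∨ a = 1 := by
    have : a * (1 - a) = 0 := by linarith
    rcases mul_eq_zero.1 this with h | h
    · exact Or.inl h
    · right; linarith
  rw [eventuallyConst_set']
  rcases h01 with h | h
  · left
    rw [ae_eq_empty]
    exact (measureReal_eq_zero_iff).1 h
  · right
    rw [ae_eq_univ]
    have : bern m s = 1 := by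
      rw [← ENNReal.ofReal_one, ← h, ha, ofReal_measureReal]
    exact (prob_compl_eq_zero_iff hs).2 this

end BernoulliMeasure


/-- number of nonzero letters among the first `T`. -/
def marks (T : ℕ) (p : ℕ → Fin 3) : ℕ := ((Finset.range T).filter (fun k => p k ≠ 0)).card

/-- valid patterns of length `T`. -/
def ValidPat (D T : ℕ) (p : ℕ → Fin 3) : Prop :=
  (∀ k, T ≤ k → p k = 0) ∧ 1 ≤ marks T p ∧ D * marks T p ≤ T

lemma count_bound (N M X : ℕ) (hX : 0 < X) :
    (((Finset.univ : Finset (Fin N → Fin 3)).filter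
      (fun f => (Finset.univ.filter (fun i => f i ≠ 0)).card ≤ M)).card : ℝ)
      ≤ (X : ℝ) ^ M * (1 + 2 / X) ^ N := by
  have hX' : (0 : ℝ) < X := by exact_mod_cast hX
  have hX1 : (1 : ℝ) ≤ X := by exact_mod_cast hX
  obtain ⟨wt, hwt⟩ : ∃ wt : Fin 3 → ℝ, wt = fun a => if a ≠ 0 then (X : ℝ)⁻¹ else 1 := ⟨_, rfl⟩
  have h1 : ((1 : ℝ) + 2 / X) = ∑ a : Fin 3, wt a := by
    rw [Fin.sum_univ_three, hwt]; simp; ring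
  have h2 : ∀ f : Fin N → Fin 3, ∏ i, wt (f i)
      = (X : ℝ)⁻¹ ^ ((Finset.univ.filter (fun i => f i ≠ 0)).card) := by
    intro f
    rw [hwt, Finset.prod_ite]; simp
  have h3 : (X : ℝ) ^ M * (1 + 2 / X) ^ N = ∑ f : Fin N → Fin 3, (X : ℝ) ^ M * ∏ i, wt (f i) := by
    rw [h1, Fintype.sum_pow, Finset.mul_sum]
  rw [h3]
  have h4 : ∀ f ∈ (Finset.univ : Finset (Fin N → Fin 3)).filter
      (fun f => (Finset.univ.filter (fun i => f i ≠ 0)).card ≤ M),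
      (1 : ℝ) ≤ (X : ℝ) ^ M * ∏ i, wt (f i) := by
    intro f hf
    rw [Finset.mem_filter] at hf
    rw [h2, inv_pow, ← div_eq_mul_inv, le_div_iff₀ (by positivity), one_mul]
    exact pow_le_pow_right₀ hX1 hf.2
  have h5 := Finset.card_nsmul_le_sum _ _ _ h4
  rw [nsmul_eq_mul, mul_one] at h5
  refine h5.trans (Finset.sum_le_sum_of_subset_of_nonneg (Finset.filter_subset _ _) ?_)
  intro f _ _
  rw [h2]
  positivity

lemma exists_code (P K B : ℕ) (hP : 0 < P) (hK : 0 < K) :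
    ∃ D : ℕ, B ≤ D ∧ 0 < D ∧ ∃ code : ℕ → ℕ → (ℕ → Fin 3) → ℕ → Bool,
      ∀ r r' T T' p p', r < P → r' < P → ValidPat D T p → ValidPat D T' p' → T / K = T' / K →
        (∀ j < T / K, code r T p j = code r' T' p' j) → r = r' ∧ T = T' ∧ p = p' := by
  classical
  obtain ⟨L, hL⟩ : ∃ L : ℕ, 16 * K ≤ 2 ^ L := ⟨16 * K, (Nat.lt_two_pow_self).le⟩
  obtain ⟨m0, hm0⟩ : ∃ m0 : ℕ, (P * K) ^ 2 * 2 ≤ 2 ^ m0 := ⟨(P * K) ^ 2 * 2, (Nat.lt_two_pow_self).le⟩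
  set X := 16 * K with hXdef
  have hLpos : 0 < L + 1 := by omega
  set D := 4 * K * (L + 1) * (m0 + B + 1) with hD
  have hDB : B ≤ D := by
    have : 1 * (m0 + B + 1) ≤ D := Nat.mul_le_mul_right _ (by nlinarith)
    omega
  have hDpos : 0 < D := by positivity
  have hDK : K * m0 ≤ D := by
    have : K * (m0 + B + 1) ≤ D := Nat.mul_le_mul_right _ (by nlinarith)
    nlinarith
  refine ⟨D, hDB, hDpos, ?_⟩
  -- code for each m
  have key : ∀ m : ℕ, ∃ code : ℕ → ℕ → (ℕ → Fin 3) → (Fin m → Bool),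
      ∀ r r' T T' p p', r < P → r' < P → ValidPat D T p → ValidPat D T' p' → T / K = m → T' / K = m →
        code r T p = code r' T' p' → r = r' ∧ T = T' ∧ p = p' := by
    intro m
    by_cases hm : m < m0
    · refine ⟨fun _ _ _ _ => true, ?_⟩
      intro r r' T T' p p' _ _ hv _ hT _ _
      exfalso
      have h1 : D ≤ T := by
        have := hv.2.2; have := hv.2.1
        nlinarith
      have h2 : m0 ≤ T / K := by
        rw [Nat.le_div_iff_mul_le hK]; nlinarith
      omega
    push Not at hm
    set N := K * (m + 1) with hN
    set M := N / D with hM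
    set F := {f : Fin N → Fin 3 // (Finset.univ.filter (fun i => f i ≠ 0)).card ≤ M}
    have hcount := count_bound N M X (by positivity)
    have hcardF : (Fintype.card F : ℝ) ≤ (X : ℝ) ^ M * (1 + 2 / X) ^ N := by
      rw [Fintype.card_subtype]; exact hcount
    have hK' : (0 : ℝ) < K := by exact_mod_cast hK
    -- fourth power bound
    have hA : ((X : ℝ) ^ M) ^ 4 ≤ 2 ^ (m + 1) := by
      have h1 : (X : ℝ) ≤ 2 ^ L := by exact_mod_cast hL
      calc ((X : ℝ) ^ M) ^ 4 ≤ (((2 : ℝ) ^ L) ^ M) ^ 4 := by gcongr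
        _ = 2 ^ (L * M * 4) := by rw [pow_mul, pow_mul]
        _ ≤ 2 ^ (m + 1) := by
          apply pow_le_pow_right₀ (by norm_num)
          have h2 : D * M ≤ N := Nat.mul_div_le N D
          have h3 : 4 * K * L ≤ D := by
            rw [hD]; nlinarith [Nat.zero_le (K * L * (m0 + B)), Nat.zero_le (K * (m0+B+1))]
          have h4 : 4 * K * L * M ≤ K * (m + 1) := (Nat.mul_le_mul_right _ h3).trans h2
          have h5 : K * (L * M * 4) ≤ K * (m + 1) := by linarith
          exact Nat.le_of_mul_le_mul_left h5 hK
    have hB : (((1 : ℝ) + 2 / X) ^ N) ^ 4 ≤ 2 ^ (m + 1) := by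
      have h1 : ((1 : ℝ) + 2 / X) ^ (4 * K) ≤ 2 := by
        have h2 : (1 : ℝ) + 2 / X ≤ Real.exp (2 / X) := by
          rw [add_comm]; exact Real.add_one_le_exp _
        have h3 : ((1 : ℝ) + 2 / X) ^ (4 * K) ≤ Real.exp (2 / X) ^ (4 * K) := by gcongr
        refine h3.trans ?_
        rw [← Real.exp_nat_mul]
        have h4 : ((4 * K : ℕ) : ℝ) * (2 / X) = 1 / 2 := by
          rw [hXdef]; push_cast; field_simp; norm_num
        rw [h4]
        have h5 : Real.exp (1 / 2) ^ 2 = Real.exp 1 := by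
          rw [← Real.exp_nat_mul]; norm_num
        have h6 := Real.exp_one_lt_d9
        have h7 := Real.exp_pos (1 / 2)
        nlinarith
      calc (((1 : ℝ) + 2 / X) ^ N) ^ 4 = (((1 : ℝ) + 2 / X) ^ (4 * K)) ^ (m + 1) := by
            rw [← pow_mul, ← pow_mul]; congr 1; rw [hN]; ring
        _ ≤ 2 ^ (m + 1) := by gcongr
    have hC : (Fintype.card F : ℝ) ^ 2 ≤ 2 ^ (m + 1) := by
      have h1 : ((Fintype.card F : ℝ)) ^ 4 ≤ (2 ^ (m + 1)) ^ 2 := by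
        calc ((Fintype.card F : ℝ)) ^ 4 ≤ ((X : ℝ) ^ M * (1 + 2 / X) ^ N) ^ 4 := by gcongr
          _ = ((X : ℝ) ^ M) ^ 4 * (((1 : ℝ) + 2 / X) ^ N) ^ 4 := by rw [mul_pow]
          _ ≤ 2 ^ (m + 1) * 2 ^ (m + 1) := by gcongr
          _ = _ := by ring
      have h2 : ((Fintype.card F : ℝ) ^ 2) ^ 2 ≤ (2 ^ (m + 1)) ^ 2 := by
        rw [← pow_mul]; exact h1
      exact (pow_le_pow_iff_left₀ (by positivity) (by positivity) (by norm_num)).1 h2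
    have hC' : (Fintype.card F) ^ 2 ≤ 2 ^ (m + 1) := by exact_mod_cast hC
    have htot : Fintype.card (Fin P × Fin K × F) ≤ Fintype.card (Fin m → Bool) := by
      simp only [Fintype.card_prod, Fintype.card_fin, Fintype.card_fun, Fintype.card_bool]
      rw [← mul_assoc]
      refine (pow_le_pow_iff_left₀ (Nat.zero_le _) (Nat.zero_le _) (two_ne_zero)).1 ?_
      calc (P * K * Fintype.card F) ^ 2 = (P * K) ^ 2 * Fintype.card F ^ 2 := by ring
        _ ≤ (P * K) ^ 2 * 2 ^ (m + 1) := Nat.mul_le_mul_left _ hC'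
        _ = ((P * K) ^ 2 * 2) * 2 ^ m := by ring
        _ ≤ 2 ^ m0 * 2 ^ m := Nat.mul_le_mul_right _ hm0
        _ ≤ 2 ^ m * 2 ^ m := Nat.mul_le_mul_right _ (Nat.pow_le_pow_right (by norm_num) hm)
        _ = (2 ^ m) ^ 2 := by ring
    obtain ⟨emb⟩ := Function.Embedding.nonempty_of_card_le htot
    refine ⟨fun r T p => if h : r < P ∧ ((Finset.univ.filter (fun i : Fin N => p i ≠ 0)).card ≤ M) then
      emb (⟨r, h.1⟩, ⟨T % K, Nat.mod_lt _ hK⟩, ⟨fun i => p i, h.2⟩) else fun _ => true, ?_⟩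
    intro r r' T T' p p' hr hr' hv hv' hT hT' heq
    have hlt : ∀ T, T / K = m → T < N := by
      intro T hT
      rw [hN, mul_comm, ← Nat.div_lt_iff_lt_mul hK]; omega
    have hcard : ∀ T p, T / K = m → ValidPat D T p →
        (Finset.univ.filter (fun i : Fin N => p i ≠ 0)).card ≤ M := by
      intro T p hT hv
      have h1 : (Finset.univ.filter (fun i : Fin N => p i ≠ 0)).card ≤ marks T p := by
        unfold marks
        refine Finset.card_le_card_of_injOn (fun i => (i : ℕ)) ?_ ?_
        · intro i hi
          simp only [Finset.coe_filter, Finset.mem_univ, true_and, Set.mem_ofPred_eq] at hi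
          simp only [Finset.coe_filter, Finset.mem_range, Set.mem_ofPred_eq]
          refine ⟨?_, hi⟩
          by_contra hc
          exact hi (hv.1 _ (by omega))
        · intro a _ b _ h; exact Fin.ext h
      refine h1.trans ?_
      rw [hM, Nat.le_div_iff_mul_le hDpos]
      have := hv.2.2
      have := hlt T hT
      nlinarith
    simp only [hr, hr', hcard T p hT hv, hcard T' p' hT' hv', and_self, dif_pos] at heq
    have := emb.injective heq
    simp only [Prod.mk.injEq, Fin.mk.injEq, Subtype.mk.injEq] at this
    obtain ⟨h1, h2, h3⟩ := this
    have hTT : T = T' := by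
      rw [← Nat.div_add_mod T K, ← Nat.div_add_mod T' K, hT, hT', h2]
    refine ⟨h1, hTT, ?_⟩
    funext k
    by_cases hk : k < N
    · exact congrFun (congrArg Subtype.val h3) (⟨k, hk⟩ : Fin N)
    · rw [hv.1 k (by have := hlt T hT; omega), hv'.1 k (by have := hlt T' hT'; omega)]
  choose code hcode using key
  refine ⟨fun r T p j => if h : j < T / K then code (T / K) r T p ⟨j, h⟩ else true, ?_⟩
  intro r r' T T' p p' hr hr' hv hv' hTT h
  have aux : ∀ m, T / K = m → ∀ j (hj : j < m), code m r T p ⟨j, hj⟩ = code m r' T' p' ⟨j, hj⟩ := by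
    rintro m rfl j hj
    have := h j hj
    have hj' : j < T' / K := by omega
    simp only [hj, hj', dif_pos] at this
    have gen : ∀ m1 m2 (h : m1 = m2) j (h1 : j < m1) (h2 : j < m2),
        code m1 r' T' p' ⟨j, h1⟩ = code m2 r' T' p' ⟨j, h2⟩ := by
      rintro m1 m2 rfl j h1 h2; rfl
    rw [this]
    exact gen _ _ hTT.symm j hj' hj
  exact hcode _ r r' T T' p p' hr hr' hv hv' rfl hTT.symm (funext fun j => aux _ rfl j.1 j.2)


section Blocks
variable {t : ℕ} (A : Fin t → Fin t → Bool)

/-- `f` is an admissible path of length `n`. -/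
def PathA (n : ℕ) (f : ℕ → Fin t) : Prop := ∀ k < n, A (f k) (f (k + 1)) = true

variable {A}

lemma path_join {n m : ℕ} {f g : ℕ → Fin t} (hf : PathA A n f) (hg : PathA A m g)
    (h : f n = g 0) :
    ∃ h : ℕ → Fin t, PathA A (n + m) h ∧ (∀ k ≤ n, h k = f k) ∧ (∀ k, h (n + k) = g k) := by
  refine ⟨fun k => if k ≤ n then f k else g (k - n), ?_, ?_, ?_⟩
  · intro k hk
    by_cases h1 : k + 1 ≤ n
    · have h2 : k ≤ n := by omega
      simp only [h1, h2, if_true]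
      exact hf k (by omega)
    · by_cases h2 : k ≤ n
      · have h3 : k = n := by omega
        subst h3
        simp only [h1, le_refl, if_true, if_false]
        rw [h]
        have := hg 0 (by omega)
        simpa using this
      · simp only [h1, h2, if_false]
        have := hg (k - n) (by omega)
        rwa [show k - n + 1 = k + 1 - n by omega] at this
  · intro k hk; simp [hk]
  · intro k
    by_cases hk : k = 0
    · subst hk; simp [h]
    · have : ¬ n + k ≤ n := by omega
      simp [this]

/-- gluing property -/
def Glue (A : Fin t → Fin t → Bool) (n0 : ℕ) : Prop :=
  ∀ n, n0 ≤ n → ∀ i j : Fin t, ∃ w : ℕ → Fin t, PathA A n w ∧ w 0 = i ∧ w n = j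

lemma exists_glue (hrow : ∀ i : Fin t, ∃ j : Fin t, A i j = true) (hmix : TopMixing A) :
    ∃ n0, 0 < n0 ∧ Glue A n0 := by
  obtain ⟨n0, h0, hm⟩ := hmix
  refine ⟨n0, h0, ?_⟩
  intro n hn
  obtain ⟨q, rfl⟩ := Nat.exists_eq_add_of_le hn
  clear hn
  induction q with
  | zero =>
    intro i j
    obtain ⟨w, h1, h2, h3⟩ := hm i j
    exact ⟨w, h3, h1, h2⟩
  | succ q ih =>
    intro i j
    obtain ⟨i', hi'⟩ := hrow i
    obtain ⟨w, h1, h2, h3⟩ := ih i' j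
    refine ⟨fun k => if k = 0 then i else w (k - 1), ?_, by simp, by simpa using h3⟩
    intro k hk
    by_cases h : k = 0
    · subst h; simpa [h2] using hi'
    · have := h1 (k - 1) (by omega)
      simp only [h, if_false, Nat.add_sub_cancel]
      rw [show k - 1 + 1 = k by omega] at this
      simpa using this

lemma pre_step {n : ℕ} {i i' j : Fin t} (h : A i i' = true) {w : ℕ → Fin t}
    (h1 : PathA A n w) (h2 : w 0 = i') (h3 : w n = j) :
    ∃ f : ℕ → Fin t, PathA A (n + 1) f ∧ f 0 = i ∧ f 1 = i' ∧ f (n + 1) = j := by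
  refine ⟨fun k => if k = 0 then i else w (k - 1), ?_, by simp, by simpa using h2, by simpa using h3⟩
  intro k hk
  by_cases h' : k = 0
  · subst h'; simpa [h2] using h
  · have := h1 (k - 1) (by omega)
    simp only [h', if_false, Nat.add_sub_cancel]
    rw [show k - 1 + 1 = k by omega] at this
    simpa using this

lemma slots {n0 : ℕ} (hg : Glue A n0) (v0 : Fin t) (l : Bool → Fin t)
    (hl : ∀ b, A v0 (l b) = true) (bits : ℕ → Bool) (J : ℕ) :
    ∃ f : ℕ → Fin t, PathA A ((n0 + 1) * J) f ∧ f 0 = v0 ∧ f ((n0 + 1) * J) = v0 ∧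
      ∀ j < J, f ((n0 + 1) * j + 1) = l (bits j) := by
  induction J with
  | zero => exact ⟨fun _ => v0, by intro k hk; omega, rfl, rfl, by intro j hj; omega⟩
  | succ J ih =>
    obtain ⟨f, h1, h2, h3, h4⟩ := ih
    obtain ⟨w, w1, w2, w3⟩ := hg n0 le_rfl (l (bits J)) v0
    obtain ⟨g, g1, g2, g3, g4⟩ := pre_step (hl (bits J)) w1 w2 w3
    obtain ⟨h, k1, k2, k3⟩ := path_join h1 g1 (h3.trans g2.symm)
    refine ⟨h, ?_, ?_, ?_, ?_⟩
    · rw [Nat.mul_succ]; exact k1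
    · rw [k2 0 (Nat.zero_le _), h2]
    · rw [Nat.mul_succ, k3, g4]
    · intro j hj
      by_cases hjJ : j < J
      · have : (n0 + 1) * j + 1 ≤ (n0 + 1) * J := by
          have : (n0 + 1) * (j + 1) ≤ (n0 + 1) * J := Nat.mul_le_mul_left _ hjJ
          rw [Nat.mul_succ] at this
          omega
        rw [k2 _ this, h4 j hjJ]
      · have : j = J := by omega
        subst this
        rw [k3, g3]

lemma tail_path {n0 : ℕ} (hg : Glue A n0) (v c : Fin t) (L : ℕ) (hL : n0 ≤ L) (u : List (Fin t)) :
    ∃ f : ℕ → Fin t, PathA A L f ∧ f 0 = v ∧ f L = c ∧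
      (List.IsChain (fun a b => A a b = true) u → u.length + 2 * n0 ≤ L → 
        ∃ s, ∀ i, i < u.length → s + i ≤ L ∧ (0 < n0 → 0 < s) ∧ u[i]? = some (f (s + i))) := by
  by_cases hc : List.IsChain (fun a b => A a b = true) u ∧ u.length + 2 * n0 ≤ L ∧ u ≠ []
  · obtain ⟨h1, h2, h3⟩ := hc
    have hpos : 0 < u.length := List.length_pos_of_ne_nil h3
    set g : ℕ → Fin t := fun k => u.getD k v with hgdef
    have hg1 : PathA A (u.length - 1) g := by
      intro k hk
      have h4 : k < u.length := by omega
      have h5 : k + 1 < u.length := by omega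
      simp only [hgdef, List.getD_eq_getElem?_getD, List.getElem?_eq_getElem h4,
        List.getElem?_eq_getElem h5, Option.getD_some]
      exact List.isChain_iff_getElem.1 h1 k h5
    obtain ⟨f1, a1, a2, a3⟩ := hg n0 le_rfl v (g 0)
    obtain ⟨f2, b1, b2, b3⟩ := hg (L - n0 - (u.length - 1)) (by omega) (g (u.length - 1)) c
    obtain ⟨f3, c1, c2, c3⟩ := path_join a1 hg1 a3
    obtain ⟨f4, d1, d2, d3⟩ := path_join c1 b1 (by rw [c3, b2])
    have hLL : n0 + (u.length - 1) + (L - n0 - (u.length - 1)) = L := by omega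
    refine ⟨f4, by rwa [hLL] at d1, ?_, ?_, ?_⟩
    · rw [d2 0 (Nat.zero_le _), c2 0 (Nat.zero_le _), a2]
    · rw [← hLL, d3, b3]
    · intro _ _
      refine ⟨n0, fun i hi => ⟨by omega, fun h => h, ?_⟩⟩
      rw [d2 _ (by omega), c3, hgdef]
      simp [List.getD_eq_getElem?_getD, List.getElem?_eq_getElem hi]
  · obtain ⟨f, h1, h2, h3⟩ := hg L hL v c
    refine ⟨f, h1, h2, h3, ?_⟩
    intro k1 k2
    by_cases hu : u = []
    · subst hu; exact ⟨1, by simp⟩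
    · exact absurd ⟨k1, k2, hu⟩ hc

lemma exists_block {n0 : ℕ} (hg : Glue A n0) (hn0 : 0 < n0) (w : ℤ → Fin t) (hw : w ∈ SigmaA A)
    (r : ℕ) (β : Fin t) (hβ : A (w (r - 1)) β = true) (v0 : Fin t) (l : Bool → Fin t)
    (hl : ∀ b, A v0 (l b) = true) (bits : ℕ → Bool) (J T : ℕ)
    (hT : r + n0 + 1 + (n0 + 1) * J + n0 ≤ T) (c : Fin t) (u : List (Fin t)) :
    ∃ B : ℕ → Fin t, A (w (-1)) (B 0) = true ∧ (∀ k, k + 1 < T → A (B k) (B (k + 1)) = true) ∧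
      B (T - 1) = c ∧ (∀ k < r, B k = w k) ∧ B r = β ∧
      (∀ j < J, B (r + n0 + 1 + (n0 + 1) * j) = l (bits j)) ∧
      (List.IsChain (fun a b => A a b = true) u →
        r + n0 + 1 + (n0 + 1) * J + (u.length + 2 * n0) ≤ T →
        ∃ s, ∀ i, i < u.length → s + i < T ∧ u[i]? = some (B (s + i))) := by
  have s1 : PathA A r (fun k => w ((k : ℤ) - 1)) := by
    intro k hk
    have := hw ((k : ℤ) - 1)
    simp only
    rw [show (((k + 1 : ℕ) : ℤ) - 1) = (k : ℤ) - 1 + 1 by push_cast; ring]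
    exact this
  obtain ⟨w1, a1, a2, a3⟩ := hg n0 le_rfl β v0
  obtain ⟨f2, b1, b2, b3, b4⟩ := pre_step hβ a1 a2 a3
  obtain ⟨f3, c1, c2, c3, c4⟩ := slots hg v0 l hl bits J
  obtain ⟨f4, d1, d2, d3, d4⟩ := tail_path hg v0 c (T - (r + (n0 + 1) + (n0 + 1) * J)) (by omega) u
  obtain ⟨g1, e1, e2, e3⟩ := path_join s1 b1 b2.symm
  obtain ⟨g2, x1, x2, x3⟩ := path_join e1 c1 (by rw [e3, b4, c2])
  obtain ⟨g3, y1, y2, y3⟩ := path_join x1 d1 (by rw [x3, c3, d2])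
  have hTT : r + (n0 + 1) + (n0 + 1) * J + (T - (r + (n0 + 1) + (n0 + 1) * J)) = T := by omega
  rw [hTT] at y1
  have hlow : ∀ k ≤ r, g3 k = w ((k : ℤ) - 1) := by
    intro k hk
    rw [y2 k (by omega), x2 k (by omega), e2 k hk]
  refine ⟨fun k => g3 (k + 1), ?_, ?_, ?_, ?_, ?_, ?_, ?_⟩
  · have h0 := hlow 0 (by omega)
    have := y1 0 (by omega)
    rw [h0] at this
    simpa using this
  · intro k hk; exact y1 (k + 1) hk
  · have : g3 T = c := by rw [← hTT, y3, d3]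
    simp only
    rw [show T - 1 + 1 = T by omega, this]
  · intro k hk
    simp only
    rw [hlow (k + 1) hk]; congr 1; push_cast; ring
  · simp only
    rw [y2 _ (by omega), x2 _ (by omega), e3, b3]
  · intro j hj
    simp only
    have : (n0 + 1) * j + 1 ≤ (n0 + 1) * J := by
      have : (n0 + 1) * (j + 1) ≤ (n0 + 1) * J := Nat.mul_le_mul_left _ hj
      rw [Nat.mul_succ] at this
      omega
    rw [show r + n0 + 1 + (n0 + 1) * j + 1 = r + (n0 + 1) + ((n0 + 1) * j + 1) by omega,
      y2 _ (by omega), x3, c4 j hj]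
  · intro hu hle
    obtain ⟨s, hs⟩ := d4 hu (by omega)
    refine ⟨r + (n0 + 1) + (n0 + 1) * J + s - 1, fun i hi => ?_⟩
    obtain ⟨h1, h2, h3⟩ := hs i hi
    have h2 := h2 hn0
    refine ⟨by omega, ?_⟩
    rw [h3, ← y3]
    congr 2
    omega

/-- translate -/
def tr {E : Type*} (j : ℤ) (x : ℤ → E) : ℤ → E := fun i => x (i + j)

lemma tr_tr {E : Type*} (j k : ℤ) (x : ℤ → E) : tr j (tr k x) = tr (j + k) x := by
  funext i; simp only [tr]; congr 1; ring

lemma tr_mem {j : ℤ} {x : ℤ → Fin t} (hx : x ∈ SigmaA A) : tr j x ∈ SigmaA A := by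
  intro i
  have := hx (i + j)
  simp only [tr]
  rwa [show i + 1 + j = i + j + 1 by ring]

/-- type of a mark -/
def ty (a : Fin 3) : Bool := decide (a = 2)

theorem exists_blocks (hrow : ∀ i : Fin t, ∃ j : Fin t, A i j = true) (hmix : TopMixing A)
    (z : Bool → ℤ → Fin t) (hz : ∀ b, z b ∈ SigmaA A) (P : ℕ) (hP : 0 < P)
    (hper : ∀ b i, z b (i + P) = z b i)
    (β : Bool → Fin t) (hβ : ∀ b, A (z b 0) (β b) = true) (hβ' : ∀ b, β b ≠ z b 1) :
    ∃ D : ℕ, 0 < D ∧ ∃ Blk : (ℤ → Fin t) → ℕ → (ℕ → Fin 3) → ℕ → Fin t,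
      (∀ b j T p, ValidPat D T p → A (tr j (z b) (-1)) (Blk (tr j (z b)) T p 0) = true ∧
        (∀ k, k + 1 < T → A (Blk (tr j (z b)) T p k) (Blk (tr j (z b)) T p (k + 1)) = true) ∧
        Blk (tr j (z b)) T p (T - 1) = z (ty (p (T - 1))) 0) ∧
      (∀ b j (e e' T T' : ℕ) p p' (x : ℕ → Fin t), ValidPat D T p → ValidPat D T' p' →
        (∀ k < e, x k = tr j (z b) k) → (∀ k < T, x (e + k) = Blk (tr (e + j) (z b)) T p k) →
        (∀ k < e', x k = tr j (z b) k) → (∀ k < T', x (e' + k) = Blk (tr (e' + j) (z b)) T' p' k) →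
        e = e' ∧ T = T' ∧ p = p') ∧
      (∀ u : List (Fin t), List.IsChain (fun a b => A a b = true) u → ∃ k : ℕ, 1 ≤ k ∧
        ∀ b j p, ValidPat D (k * D) p → ∃ s, ∀ i, i < u.length →
          s + i < k * D ∧ u[i]? = some (Blk (tr j (z b)) (k * D) p (s + i))) := by
  obtain ⟨n0, hn0, hg⟩ := exists_glue hrow hmix
  set K := 4 * (n0 + 1) with hK
  obtain ⟨D, hDB, hD, code, hcode⟩ := exists_code P K (2 * (P + 4 * n0 + 4)) hP (by omega)
  -- deviation
  have hdev : ∀ w : ℤ → Fin t, ∃ (r : ℕ) (b' : Fin t), (∃ b j, w = tr j (z b)) →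
      r < P ∧ A (w (r - 1)) b' = true ∧ b' ≠ w r := by
    intro w
    by_cases h : ∃ b j, w = tr j (z b)
    · obtain ⟨b, j, rfl⟩ := h
      have hperk : ∀ (n : ℤ) i, z b (i + n * P) = z b i := by
        intro n
        induction n using Int.induction_on with
        | zero => intro i; simp
        | succ n ih => intro i; rw [show i + ((n : ℤ) + 1) * P = i + n * P + P by ring, hper, ih]
        | pred n ih => intro i; rw [← hper, show i + (-(n : ℤ) - 1) * P + P = i + -(n : ℤ) * P by ring, ih]
      have hP' : (P : ℤ) ≠ 0 := by omega
      refine ⟨((1 - j) % P).toNat, β b, fun _ => ?_⟩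
      have h1 := Int.emod_nonneg (1 - j) hP'
      have h2 := Int.emod_lt_of_pos (1 - j) (show (0 : ℤ) < P by omega)
      have h3 := Int.emod_add_mul_ediv (1 - j) P
      have h4 : (((1 - j) % P).toNat : ℤ) = (1 - j) % P := Int.toNat_of_nonneg h1
      refine ⟨by omega, ?_, ?_⟩
      · simp only [tr]
        rw [h4, show (1 - j) % P - 1 + j = 0 + (-((1 - j) / P)) * P by linarith, hperk]
        exact hβ b
      · simp only [tr]
        rw [h4, show (1 - j) % P + j = 1 + (-((1 - j) / P)) * P by linarith, hperk]
        exact hβ' b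
    · exact ⟨0, z false 0, fun h' => absurd h' h⟩
  choose r b' hr using hdev
  set l : Bool → Fin t := fun b => if b then β false else z false 1 with hl
  have hl1 : ∀ b, A (z false 0) (l b) = true := by
    intro b
    cases b
    · simpa [hl] using hz false 0
    · simpa [hl] using hβ false
  have hlinj : ∀ b c, l b = l c → b = c := by
    intro b c h
    have := hβ' false
    cases b <;> cases c <;> simp_all
  have hval : ∀ T p, ValidPat D T p → D ≤ T := by
    intro T p hv
    have := hv.2.2; have := hv.2.1
    nlinarith
  have hbud : ∀ T, D ≤ T → P + n0 + 1 + (n0 + 1) * (2 * (T / K) + 1) + n0 ≤ T := by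
    intro T hT
    have h1 : K * (T / K) ≤ T := Nat.mul_div_le T K
    have h2 : (n0 + 1) * (2 * (T / K) + 1) = K * (T / K) / 2 + (n0 + 1) := by
      rw [hK, show 4 * (n0 + 1) * (T / (4 * (n0 + 1))) = 2 * (2 * ((n0 + 1) * (T / (4 * (n0 + 1))))) by ring,
        Nat.mul_div_cancel_left _ (by norm_num)]
      ring
    omega
  set bits : ℕ → ℕ → (ℕ → Fin 3) → ℕ → Bool := fun q T p j =>
    if j < T / K then true else if j = T / K then false else code q T p (j - T / K - 1) with hbits
  set U : ℕ → List (Fin t) := fun k => (Encodable.decode (Nat.unpair k).1).getD [] with hU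
  have hblk : ∀ (w : ℤ → Fin t) (T : ℕ) (p : ℕ → Fin 3), ∃ B : ℕ → Fin t,
      (∃ b j, w = tr j (z b)) → D ≤ T →
      A (w (-1)) (B 0) = true ∧ (∀ k, k + 1 < T → A (B k) (B (k + 1)) = true) ∧
      B (T - 1) = z (ty (p (T - 1))) 0 ∧ (∀ k < r w, B k = w k) ∧ B (r w) = b' w ∧
      (∀ j < 2 * (T / K) + 1, B (r w + n0 + 1 + (n0 + 1) * j) = l (bits (r w) T p j)) ∧
      (List.IsChain (fun a b => A a b = true) (U (T / D)) →
        r w + n0 + 1 + (n0 + 1) * (2 * (T / K) + 1) + ((U (T / D)).length + 2 * n0) ≤ T →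
        ∃ s, ∀ i, i < (U (T / D)).length → s + i < T ∧ (U (T / D))[i]? = some (B (s + i))) := by
    intro w T p
    by_cases h : (∃ b j, w = tr j (z b)) ∧ D ≤ T
    · obtain ⟨h1, h2, h3⟩ := hr w h.1
      have h4 : w ∈ SigmaA A := by
        obtain ⟨⟨b, j, rfl⟩, -⟩ := h
        exact tr_mem (hz b)
      have h5 := hbud T h.2
      obtain ⟨B, hB⟩ := exists_block hg hn0 w h4 (r w) (b' w) h2 (z false 0) l hl1
        (bits (r w) T p) (2 * (T / K) + 1) T (by omega) (z (ty (p (T - 1))) 0) (U (T / D))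
      exact ⟨B, fun _ _ => hB⟩
    · exact ⟨fun _ => z false 0, fun h1 h2 => absurd ⟨h1, h2⟩ h⟩
  choose Blk hB using hblk
  refine ⟨D, hD, Blk, ?_, ?_, ?_⟩
  · intro b j T p hv
    obtain ⟨h1, h2, h3, -⟩ := hB (tr j (z b)) T p ⟨b, j, rfl⟩ (hval T p hv)
    exact ⟨h1, h2, h3⟩
  · intro b j e e' T T' p p' x hv hv' x1 x2 x1' x2'
    obtain ⟨-, -, -, h4, h5, h6, -⟩ := hB (tr (e + j) (z b)) T p ⟨b, _, rfl⟩ (hval T p hv)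
    obtain ⟨-, -, -, h4', h5', h6', -⟩ := hB (tr (e' + j) (z b)) T' p' ⟨b, _, rfl⟩ (hval T' p' hv')
    obtain ⟨r1, -, r3⟩ := hr (tr (e + j) (z b)) ⟨b, _, rfl⟩
    obtain ⟨r1', -, r3'⟩ := hr (tr (e' + j) (z b)) ⟨b, _, rfl⟩
    set q := r (tr (e + j) (z b)) with hq
    set q' := r (tr (e' + j) (z b)) with hq'
    have hT := hbud T (hval T p hv)
    have hT' := hbud T' (hval T' p' hv')
    have f1 : ∀ k < e + q, x k = tr j (z b) k := by
      intro k hk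
      by_cases hke : k < e
      · exact x1 k hke
      · have := x2 (k - e) (by omega)
        rw [show e + (k - e) = k by omega, h4 (k - e) (by omega)] at this
        rw [this]; simp only [tr]; congr 1; omega
    have f1' : ∀ k < e' + q', x k = tr j (z b) k := by
      intro k hk
      by_cases hke : k < e'
      · exact x1' k hke
      · have := x2' (k - e') (by omega)
        rw [show e' + (k - e') = k by omega, h4' (k - e') (by omega)] at this
        rw [this]; simp only [tr]; congr 1; omega
    have f2 : x (e + q) ≠ tr j (z b) (e + q : ℕ) := by
      rw [x2 q (by omega), h5]
      convert r3 using 1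
      simp only [tr]; congr 1; push_cast; ring
    have f2' : x (e' + q') ≠ tr j (z b) (e' + q' : ℕ) := by
      rw [x2' q' (by omega), h5']
      convert r3' using 1
      simp only [tr]; congr 1; push_cast; ring
    have heq : e + q = e' + q' := by
      rcases lt_trichotomy (e + q) (e' + q') with h | h | h
      · exact absurd (f1' _ h) f2
      · exact h
      · exact absurd (f1 _ h) f2'
    have hbit : ∀ j, j < 2 * (T / K) + 1 → j < 2 * (T' / K) + 1 →
        bits q T p j = bits q' T' p' j := by
      intro j h1 h2
      have e1 := h6 j h1
      have e2 := h6' j h2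
      have g1 : (n0 + 1) * j ≤ (n0 + 1) * (2 * (T / K) + 1) := Nat.mul_le_mul_left _ h1.le
      have g2 : (n0 + 1) * j ≤ (n0 + 1) * (2 * (T' / K) + 1) := Nat.mul_le_mul_left _ h2.le
      have k1 : (n0 + 1) * (j + 1) ≤ (n0 + 1) * (2 * (T / K) + 1) := Nat.mul_le_mul_left _ h1
      have k2 : (n0 + 1) * (j + 1) ≤ (n0 + 1) * (2 * (T' / K) + 1) := Nat.mul_le_mul_left _ h2
      rw [Nat.mul_succ] at k1 k2
      rw [← x2 _ (by omega)] at e1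
      rw [← x2' _ (by omega)] at e2
      rw [show e + (q + n0 + 1 + (n0 + 1) * j) = e' + (q' + n0 + 1 + (n0 + 1) * j) by omega, e2] at e1
      exact (hlinj _ _ e1).symm
    have hm : T / K = T' / K := by
      rcases lt_trichotomy (T / K) (T' / K) with h | h | h
      · have := hbit (T / K) (by omega) (by omega)
        simp [hbits, h] at this
      · exact h
      · have := hbit (T' / K) (by omega) (by omega)
        simp [hbits, h] at this
    obtain ⟨c1, c2, c3⟩ := hcode q q' T T' p p' r1 r1' hv hv' hm (by
      intro j hj
      have := hbit (T / K + 1 + j) (by omega) (by omega)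
      have n1 : ¬ (T / K + 1 + j < T / K) := by omega
      have n2 : ¬ (T / K + 1 + j = T / K) := by omega
      have n3 : ¬ (T / K + 1 + j < T' / K) := by omega
      have n4 : ¬ (T / K + 1 + j = T' / K) := by omega
      simp only [hbits, n1, n2, n3, n4, if_false] at this
      rwa [show T / K + 1 + j - T / K - 1 = j by omega, show T / K + 1 + j - T' / K - 1 = j by omega]
        at this)
    exact ⟨by omega, c2, c3⟩
  · intro u hu
    refine ⟨Nat.pair (Encodable.encode u) (4 * (P + 4 * n0 + 4 + u.length)), ?_, ?_⟩
    · have := Nat.right_le_pair (Encodable.encode u) (4 * (P + 4 * n0 + 4 + u.length))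
      omega
    · intro b j p hv
      have hkk := Nat.right_le_pair (Encodable.encode u) (4 * (P + 4 * n0 + 4 + u.length))
      set k := Nat.pair (Encodable.encode u) (4 * (P + 4 * n0 + 4 + u.length)) with hk
      have hUk : U k = u := by simp [hU, hk]
      have hkD : k * D / D = k := Nat.mul_div_cancel _ hD
      obtain ⟨-, -, -, -, -, -, h7⟩ := hB (tr j (z b)) (k * D) p ⟨b, j, rfl⟩ (hval _ _ hv)
      obtain ⟨r1, -, -⟩ := hr (tr j (z b)) ⟨b, _, rfl⟩
      rw [hkD, hUk] at h7
      refine h7 hu ?_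
      have h1 : k * 1 ≤ k * D := Nat.mul_le_mul_left _ hD
      set T := k * D with hT
      have h1 : K * (T / K) ≤ T := Nat.mul_div_le T K
      have h2 : (n0 + 1) * (2 * (T / K) + 1) = K * (T / K) / 2 + (n0 + 1) := by
        rw [hK, show 4 * (n0 + 1) * (T / (4 * (n0 + 1))) = 2 * (2 * ((n0 + 1) * (T / (4 * (n0 + 1))))) by ring,
          Nat.mul_div_cancel_left _ (by norm_num)]
        ring
      omega

end Blocks


section Counting
open Classical in
/-- number of `k < n` with `p (i + k)` -/
noncomputable def cntP (p : ℤ → Prop) (i : ℤ) (n : ℕ) : ℕ :=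
  ((Finset.range n).filter (fun k : ℕ => p (i + k))).card

lemma cntP_add (p : ℤ → Prop) (i : ℤ) (n m : ℕ) :
    cntP p i (n + m) = cntP p i n + cntP p (i + n) m := by
  classical
  induction m with
  | zero => simp [cntP]
  | succ m ih =>
    have h : ∀ (i : ℤ) (n : ℕ), cntP p i (n + 1) = cntP p i n + if p (i + n) then 1 else 0 := by
      intro i n
      unfold cntP
      rw [Finset.range_add_one, Finset.filter_insert]
      split_ifs with h
      · rw [Finset.card_insert_of_notMem (by simp)]
      · simp
    rw [← add_assoc, h, h, ih, add_assoc]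
    congr 4
    push_cast; ring_nf

lemma cntP_zero (p : ℤ → Prop) (i : ℤ) : cntP p i 0 = 0 := by simp [cntP]

lemma cntP_one_pos {p : ℤ → Prop} {i : ℤ} (h : p i) : cntP p i 1 = 1 := by
  classical
  simp [cntP, h, Finset.filter_true_of_mem]

lemma cntP_one_neg {p : ℤ → Prop} {i : ℤ} (h : ¬ p i) : cntP p i 1 = 0 := by
  classical
  simp [cntP, h]

lemma cntP_le (p : ℤ → Prop) (i : ℤ) (n : ℕ) : cntP p i n ≤ n := by
  classical
  unfold cntP
  refine (Finset.card_filter_le _ _).trans (by simp)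

lemma cntP_mono (p : ℤ → Prop) (i : ℤ) {n m : ℕ} (h : n ≤ m) : cntP p i n ≤ cntP p i m := by
  obtain ⟨d, rfl⟩ := Nat.exists_eq_add_of_le h
  rw [cntP_add]; omega

lemma cntP_congr {p q : ℤ → Prop} {i j : ℤ} {n : ℕ} (h : ∀ k : ℕ, k < n → (p (i + k) ↔ q (j + k))) :
    cntP p i n = cntP q j n := by
  classical
  unfold cntP
  congr 1
  apply Finset.filter_congr
  intro k hk
  exact h k (Finset.mem_range.1 hk)

lemma cntP_imp {p q : ℤ → Prop} {i : ℤ} {n : ℕ} (h : ∀ k : ℕ, k < n → p (i + k) → q (i + k)) :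
    cntP p i n ≤ cntP q i n := by
  classical
  unfold cntP
  apply Finset.card_le_card
  intro k hk
  rw [Finset.mem_filter] at hk ⊢
  exact ⟨hk.1, h k (Finset.mem_range.1 hk.1) hk.2⟩

lemma cntP_full {p : ℤ → Prop} {i : ℤ} {n : ℕ} (h : ∀ k : ℕ, k < n → p (i + k)) : cntP p i n = n := by
  classical
  unfold cntP
  rw [Finset.filter_true_of_mem (fun k hk => h k (Finset.mem_range.1 hk))]; simp

lemma cntP_empty {p : ℤ → Prop} {i : ℤ} {n : ℕ} (h : ∀ k : ℕ, k < n → ¬ p (i + k)) : cntP p i n = 0 := by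
  classical
  unfold cntP
  rw [Finset.filter_false_of_mem (fun k hk => h k (Finset.mem_range.1 hk))]; simp

lemma cntP_pos {p : ℤ → Prop} {i : ℤ} {n k : ℕ} (hk : k < n) (h : p (i + k)) : 1 ≤ cntP p i n := by
  classical
  unfold cntP
  rw [Nat.one_le_iff_ne_zero, Finset.card_ne_zero]
  exact ⟨k, by simp [hk, h]⟩

/-- number of marks -/
noncomputable def cnt (y : ℤ → Fin 3) (i : ℤ) (n : ℕ) : ℕ := cntP (fun k => y k ≠ 0) i n

/-- busy times of the (reversed) queue -/
def Busy (D : ℕ) (y : ℤ → Fin 3) (i : ℤ) : Prop := ∃ n : ℕ, n < D * cnt y i (n + 1)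

variable {D : ℕ}

lemma not_busy {y : ℤ → Fin 3} {i : ℤ} (h : ¬ Busy D y i) (n : ℕ) : D * cnt y i (n + 1) ≤ n := by
  by_contra hc
  exact h ⟨n, by omega⟩

lemma idle_zero (hD : 0 < D) {y : ℤ → Fin 3} {i : ℤ} (h : ¬ Busy D y i) : y i = 0 := by
  by_contra hc
  have := not_busy h 0
  rw [cnt, zero_add, cntP_one_pos (p := fun k => y k ≠ 0) hc] at this
  omega

lemma last_busy {y : ℤ → Fin 3} {b : ℤ} (h : Busy D y b) (h' : ¬ Busy D y (b + 1)) : y b ≠ 0 := by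
  intro hc
  obtain ⟨n, hn⟩ := h
  rw [cnt, add_comm n 1, cntP_add, cntP_one_neg (p := fun k => y k ≠ 0) (by simpa using hc)] at hn
  cases n with
  | zero => simp [cntP_zero] at hn
  | succ n =>
    have := not_busy h' n
    unfold cnt at this
    push_cast at hn
    rw [zero_add] at hn
    omega

lemma bcnt_le (n : ℕ) (y : ℤ → Fin 3) (i : ℤ) (hD : 0 < D) (h : ¬ Busy D y (i + n)) :
    cntP (Busy D y) i n ≤ D * cnt y i n := by
  induction n using Nat.strong_induction_on generalizing i with
  | _ n ih =>
    rcases Nat.eq_zero_or_pos n with rfl | hn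
    · simp [cntP_zero]
    by_cases hb : Busy D y i
    · obtain ⟨N, hN⟩ := hb
      by_cases hNn : N < n
      · have h1 := ih (n - (N + 1)) (by omega) (i + (N + 1 : ℕ)) (by
          rwa [show i + ((N + 1 : ℕ) : ℤ) + ((n - (N + 1) : ℕ) : ℤ) = i + n by omega])
        have h2 : n = (N + 1) + (n - (N + 1)) := by omega
        rw [h2, cntP_add _ _ (N + 1), cnt, cntP_add _ _ (N + 1), mul_add]
        have h3 := cntP_le (Busy D y) i (N + 1)
        unfold cnt at hN h1
        omega
      · have h2 : N + 1 = n + (N - n + 1) := by omega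
        rw [h2, cnt, cntP_add, mul_add] at hN
        have h3 := not_busy h (N - n)
        have h4 := cntP_le (Busy D y) i n
        unfold cnt at h3 ⊢
        omega
    · have h1 := ih (n - 1) (by omega) (i + (1 : ℕ)) (by
          rwa [show i + ((1 : ℕ) : ℤ) + ((n - 1 : ℕ) : ℤ) = i + n by omega])
      have h2 : n = 1 + (n - 1) := by omega
      rw [h2, cntP_add, cnt, cntP_add, mul_add, cntP_one_neg hb]
      unfold cnt at h1
      omega

/-- good configurations -/
def Good (P D : ℕ) (y : ℤ → Fin 3) : Prop :=
  (∀ i : ℤ, ∀ᶠ n : ℕ in atTop, 4 * P * D * cnt y i n ≤ n) ∧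
  (∀ i : ℤ, ∀ᶠ n : ℕ in atTop, 4 * P * D * cnt y (i - n) n ≤ n) ∧
  (∀ i : ℤ, ∃ j, i ≤ j ∧ y j ≠ 0) ∧ (∀ i : ℤ, ∃ j, j ≤ i ∧ y j ≠ 0)

lemma mark_busy (hD : 0 < D) {y : ℤ → Fin 3} {i : ℤ} (h : y i ≠ 0) : Busy D y i := by
  by_contra hc
  exact h (idle_zero hD hc)

variable {P : ℕ}

lemma Good.idle_above (hP : 0 < P) (hD : 0 < D) {y : ℤ → Fin 3} (hy : Good P D y) (i : ℤ) :
    ∃ j, i ≤ j ∧ ¬ Busy D y j := by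
  by_contra hc
  push Not at hc
  have h1 : ∀ M : ℕ, ∃ n, M ≤ n ∧ n ≤ D * cnt y i n := by
    intro M
    induction M with
    | zero => exact ⟨0, by simp⟩
    | succ M ih =>
      obtain ⟨n, h1, h2⟩ := ih
      obtain ⟨N, hN⟩ := hc (i + n) (by omega)
      refine ⟨n + (N + 1), by omega, ?_⟩
      rw [cnt, cntP_add, mul_add]
      unfold cnt at h2 hN
      omega
  obtain ⟨M, hM⟩ := eventually_atTop.1 (hy.1 i)
  obtain ⟨n, h2, h3⟩ := h1 (M + 1)
  have h4 := hM n (by omega)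
  have h5 : 4 * 1 * (D * cnt y i n) ≤ 4 * P * (D * cnt y i n) :=
    Nat.mul_le_mul_right _ (Nat.mul_le_mul_left _ hP)
  rw [← mul_assoc (4 * P)] at h5
  omega

lemma Good.dens (hP : 0 < P) (hD : 0 < D) {y : ℤ → Fin 3} (hy : Good P D y) (e : ℤ) (d : ℕ) 
    (he : ¬ Busy D y (e + d)) :
    ∀ᶠ n : ℕ in atTop, 4 * P * cntP (Busy D y) (e - n) n ≤ n + d := by
  have h := (tendsto_add_atTop_nat d).eventually (hy.2.1 (e + d))
  filter_upwards [h] with n hn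
  have h1 := bcnt_le (n + d) y (e - n) hD (by
    rwa [show e - n + ((n + d : ℕ) : ℤ) = e + d by push_cast; ring])
  have h2 := cntP_mono (Busy D y) (e - n) (show n ≤ n + d by omega)
  rw [show e + d - ((n + d : ℕ) : ℤ) = e - n by push_cast; ring, mul_assoc] at hn
  calc 4 * P * cntP (Busy D y) (e - n) n ≤ 4 * P * (D * cnt y (e - n) (n + d)) :=
        Nat.mul_le_mul_left _ (h2.trans h1)
    _ ≤ n + d := hn

lemma Good.idle_below (hP : 0 < P) (hD : 0 < D) {y : ℤ → Fin 3} (hy : Good P D y) (i : ℤ) :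
    ∃ j, j ≤ i ∧ ¬ Busy D y j := by
  by_contra hc
  push Not at hc
  obtain ⟨e, he, hb⟩ := hy.idle_above hP hD i
  obtain ⟨d, rfl⟩ : ∃ d : ℕ, e = i + d := ⟨(e - i).toNat, by omega⟩
  obtain ⟨M, hM⟩ := eventually_atTop.1 (hy.dens hP hD i d hb)
  have h1 := hM (M + d + 1) (by omega)
  rw [cntP_full (p := Busy D y) (fun k hk => hc _ (by omega))] at h1
  have : 4 * 1 * (M + d + 1) ≤ 4 * P * (M + d + 1) :=
    Nat.mul_le_mul_right _ (Nat.mul_le_mul_left _ hP)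
  omega

lemma common_window (hP : 0 < P) (hD : 0 < D) {y y' : ℤ → Fin 3} (hy : Good P D y)
    (hy' : Good P D y') (i : ℤ) :
    ∃ j, j ≤ i ∧ ∀ k : ℕ, k < P → ¬ Busy D y (j + k) ∧ ¬ Busy D y' (j + k) := by
  obtain ⟨e1, h1, b1⟩ := hy.idle_below hP hD i
  obtain ⟨e, h2, b2⟩ := hy'.idle_below hP hD e1
  obtain ⟨d, rfl⟩ : ∃ d : ℕ, e1 = e + d := ⟨(e1 - e).toNat, by omega⟩
  have d1 := hy.dens hP hD e d b1
  have d2 := hy'.dens hP hD e 0 (by simpa using b2)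
  obtain ⟨M, hM⟩ := eventually_atTop.1 (d1.and d2)
  by_contra hc
  push Not at hc
  have key : ∀ Q : ℕ, Q ≤ cntP (Busy D y) (e - (P * Q : ℕ)) (P * Q) +
      cntP (Busy D y') (e - (P * Q : ℕ)) (P * Q) := by
    intro Q
    induction Q with
    | zero => simp
    | succ Q ih =>
      obtain ⟨k, hk, hb⟩ := hc (e - (P * (Q + 1) : ℕ)) (by omega)
      rw [show P * (Q + 1) = P + P * Q by ring, cntP_add, cntP_add,
        show e - ((P + P * Q : ℕ) : ℤ) + P = e - (P * Q : ℕ) by push_cast; ring]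
      rw [show P * (Q + 1) = P + P * Q by ring] at hb
      by_cases hB : Busy D y (e - ((P + P * Q : ℕ) : ℤ) + k)
      · have := cntP_pos hk hB
        omega
      · have := cntP_pos hk (hb hB)
        omega
  set Q := M + d + 1 with hQ
  have hPQ : Q ≤ P * Q := Nat.le_mul_of_pos_left _ hP
  obtain ⟨k1, k2⟩ := hM (P * Q) (by omega)
  have k3 := key Q
  have k4 : 4 * P * Q ≤ 4 * P * (cntP (Busy D y) (e - (P * Q : ℕ)) (P * Q)) +
     4 * P * cntP (Busy D y') (e - (P * Q : ℕ)) (P * Q) := by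
    rw [← mul_add]; exact Nat.mul_le_mul_left _ k3
  have k5 : 4 * P * Q = 4 * (P * Q) := by ring
  omega

/-- the pattern -/
def pat (y : ℤ → Fin 3) (a : ℤ) (T : ℕ) : ℕ → Fin 3 := fun k => if k < T then y (a + k) else 0

/-- maximal busy run of length `T` beginning at `a` -/
def Run (D : ℕ) (y : ℤ → Fin 3) (a : ℤ) (T : ℕ) : Prop :=
  0 < T ∧ ¬ Busy D y (a - 1) ∧ (∀ k : ℕ, k < T → Busy D y (a + k)) ∧ ¬ Busy D y (a + T)

lemma marks_pat (y : ℤ → Fin 3) (a : ℤ) (T : ℕ) : marks T (pat y a T) = cnt y a T := by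
  classical
  unfold marks cnt cntP
  congr 1
  ext k
  rw [Finset.mem_filter, @Finset.mem_filter _ _ (_), Finset.mem_range]
  constructor
  · rintro ⟨h1, h2⟩; exact ⟨h1, by simpa [h1, pat] using h2⟩
  · rintro ⟨h1, h2⟩; exact ⟨h1, by simpa [h1, pat] using h2⟩

lemma Run.valid (hD : 0 < D) {y : ℤ → Fin 3} {a : ℤ} {T : ℕ} (h : Run D y a T) :
    ValidPat D T (pat y a T) := by
  obtain ⟨h0, h1, h2, h3⟩ := h
  refine ⟨fun k hk => by simp [pat, Nat.not_lt.2 hk], ?_, ?_⟩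
  · rw [marks_pat]
    have := last_busy (h2 (T - 1) (by omega)) (by
      rwa [show a + ((T - 1 : ℕ) : ℤ) + 1 = a + T by omega])
    exact cntP_pos (p := fun k => y k ≠ 0) (show T - 1 < T by omega) this
  · rw [marks_pat]
    have := not_busy h1 T
    rw [cnt, add_comm T 1, cntP_add, cntP_one_neg (p := fun k => y k ≠ 0) (by
      simpa using idle_zero hD h1), zero_add] at this
    rw [show a - 1 + ((1 : ℕ) : ℤ) = a by push_cast; ring] at this
    exact this

lemma first_after (p : ℤ → Prop) (i : ℤ) (h : ∃ j, i ≤ j ∧ p j) :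
    ∃ n : ℕ, p (i + n) ∧ ∀ k : ℕ, k < n → ¬ p (i + k) := by
  classical
  have : ∃ n : ℕ, p (i + n) := by
    obtain ⟨j, h1, h2⟩ := h
    exact ⟨(j - i).toNat, by rwa [show i + ((j - i).toNat : ℤ) = j by omega]⟩
  exact ⟨Nat.find this, Nat.find_spec this, fun k hk => Nat.find_min this hk⟩

lemma first_before (p : ℤ → Prop) (i : ℤ) (h : ∃ j, j ≤ i ∧ p j) :
    ∃ n : ℕ, p (i - n) ∧ ∀ k : ℕ, k < n → ¬ p (i - k) := by
  classical
  have : ∃ n : ℕ, p (i - n) := by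
    obtain ⟨j, h1, h2⟩ := h
    exact ⟨(i - j).toNat, by rwa [show i - ((i - j).toNat : ℤ) = j by omega]⟩
  exact ⟨Nat.find this, Nat.find_spec this, fun k hk => Nat.find_min this hk⟩

lemma Good.exists_run (hP : 0 < P) (hD : 0 < D) {y : ℤ → Fin 3} (hy : Good P D y) (i : ℤ)
    (hi : Busy D y i) : ∃ (a : ℤ) (T k : ℕ), Run D y a T ∧ k < T ∧ i = a + k := by
  obtain ⟨n, h1, h2⟩ := first_after (fun j => ¬ Busy D y j) i (hy.idle_above hP hD i)
  obtain ⟨m, h3, h4⟩ := first_before (fun j => ¬ Busy D y j) i (hy.idle_below hP hD i)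
  simp only [not_not] at h2 h4
  have hn : n ≠ 0 := by rintro rfl; simp at h1; exact h1 hi
  have hm : m ≠ 0 := by rintro rfl; simp at h3; exact h3 hi
  refine ⟨i - m + 1, n + m - 1, m - 1, ⟨by omega, ?_, ?_, ?_⟩, by omega, by omega⟩
  · rwa [show i - (m : ℤ) + 1 - 1 = i - m by ring]
  · intro k hk
    by_cases hkm : k < m
    · have := h4 (m - 1 - k) (by omega)
      rwa [show i - (m : ℤ) + 1 + k = i - ((m - 1 - k : ℕ) : ℤ) by omega]
    · have := h2 (k + 1 - m) (by omega)
      rwa [show i - (m : ℤ) + 1 + k = i + ((k + 1 - m : ℕ) : ℤ) by omega]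
  · rwa [show i - (m : ℤ) + 1 + ((n + m - 1 : ℕ) : ℤ) = i + n by omega]

lemma Good.next_run (hP : 0 < P) (hD : 0 < D) {y : ℤ → Fin 3} (hy : Good P D y) (i : ℤ)
    (hi : ¬ Busy D y i) : ∃ (e T : ℕ), Run D y (i + e) T ∧ ∀ k : ℕ, k < e → ¬ Busy D y (i + k) := by
  obtain ⟨n, h1, h2⟩ := first_after (Busy D y) i (by
    obtain ⟨j, hj, h⟩ := hy.2.2.1 i
    exact ⟨j, hj, mark_busy hD h⟩)
  obtain ⟨m, h3, h4⟩ := first_after (fun j => ¬ Busy D y j) (i + n) (hy.idle_above hP hD _)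
  simp only [not_not] at h4
  have hm : m ≠ 0 := by rintro rfl; simp at h3; exact h3 h1
  have hn : n ≠ 0 := by rintro rfl; simp at h1; exact hi h1
  refine ⟨n, m, ⟨by omega, ?_, h4, h3⟩, h2⟩
  have := h2 (n - 1) (by omega)
  rwa [show i + (n : ℤ) - 1 = i + ((n - 1 : ℕ) : ℤ) by omega]

lemma Good.prev_busy (hD : 0 < D) {y : ℤ → Fin 3} (hy : Good P D y) (i : ℤ) :
    ∃ n : ℕ, Busy D y (i - 1 - n) ∧ ∀ k : ℕ, k < n → ¬ Busy D y (i - 1 - k) :=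
  first_before (Busy D y) (i - 1) (by
    obtain ⟨j, hj, h⟩ := hy.2.2.2 (i - 1)
    exact ⟨j, hj, mark_busy hD h⟩)

lemma cnt_shift (y : ℤ → Fin 3) (i : ℤ) (n : ℕ) : cnt (shift y) i n = cnt y (i + 1) n := by
  unfold cnt
  apply cntP_congr
  intro k _
  simp only [shift]
  rw [show i + (k : ℤ) + 1 = i + 1 + k by ring]

lemma busy_shift (y : ℤ → Fin 3) (i : ℤ) : Busy D (shift y) i ↔ Busy D y (i + 1) := by
  unfold Busy; simp only [cnt_shift]

lemma good_shift {y : ℤ → Fin 3} (h : Good P D y) : Good P D (shift y) := by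
  obtain ⟨h1, h2, h3, h4⟩ := h
  refine ⟨fun i => ?_, fun i => ?_, fun i => ?_, fun i => ?_⟩
  · simp only [cnt_shift]; exact h1 (i + 1)
  · simp only [cnt_shift]
    have := h2 (i + 1)
    simpa only [show ∀ n : ℕ, i - (n : ℤ) + 1 = i + 1 - n from fun n => by ring] using this
  · obtain ⟨j, hj, h⟩ := h3 (i + 1)
    exact ⟨j - 1, by omega, by simpa [shift] using h⟩
  · obtain ⟨j, hj, h⟩ := h4 (i + 1)
    exact ⟨j - 1, by omega, by simpa [shift] using h⟩

/-- the run made of zeros followed by `k` ones -/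
lemma run_of_word (hD : 0 < D) {y : ℤ → Fin 3} {k : ℕ} (hk : 1 ≤ k) (h1 : y (-1) = 0)
    (h2 : ∀ i : ℕ, i < k * D - k → y i = 0) (h3 : ∀ i : ℕ, k * D - k ≤ i → i < k * D → y i = 1)
    (h4 : ¬ Busy D y ((k * D : ℕ) : ℤ)) : Run D y 0 (k * D) := by
  have hkD : k ≤ k * D := Nat.le_mul_of_pos_right _ hD
  have hc : ∀ i : ℕ, i ≤ k * D → cnt y i (k * D - i) = min k (k * D - i) := by
    intro i hi
    by_cases hik : i ≤ k * D - k
    · rw [show k * D - i = (k * D - k - i) + k by omega, cnt, cntP_add, cntP_empty, cntP_full]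
      · omega
      · intro q hq
        have := h3 (k * D - k + q) (by omega) (by omega)
        rw [show (i : ℤ) + ((k * D - k - i : ℕ) : ℤ) + q = ((k * D - k + q : ℕ) : ℤ) by omega, this]
        decide
      · intro q hq
        have := h2 (i + q) (by omega)
        push_cast at this
        simp [this]
    · rw [cnt, cntP_full]
      · omega
      · intro q hq
        have := h3 (i + q) (by omega) (by omega)
        push_cast at this
        rw [this]; decide
  refine ⟨by positivity, ?_, ?_, ?_⟩
  · rintro ⟨n, hn⟩
    rw [cnt, add_comm n 1, cntP_add, cntP_one_neg (p := fun k => y k ≠ 0) (by simpa using h1),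
      zero_add] at hn
    rw [show (0 : ℤ) - 1 + (1 : ℕ) = (0 : ℕ) by simp] at hn
    by_cases hnk : n ≤ k * D
    · have e1 := hc 0 (by omega)
      have e2 := hc n hnk
      rw [Nat.sub_zero] at e1
      have e3 : cnt y (0 : ℕ) (k * D) = cnt y (0 : ℕ) n + cnt y n (k * D - n) := by
        conv_lhs => rw [show k * D = n + (k * D - n) by omega]
        rw [cnt, cntP_add]; simp [cnt]
      rw [min_eq_left hkD] at e1
      rw [e1, e2] at e3
      unfold cnt at e3
      generalize cntP (fun k => y k ≠ 0) ((0 : ℕ) : ℤ) n = c at e3 hn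
      by_cases h5 : k ≤ k * D - n
      · rw [min_eq_left h5] at e3
        have : c = 0 := by omega
        rw [this] at hn
        omega
      · rw [min_eq_right (by omega)] at e3
        obtain ⟨q, hq⟩ : ∃ q, k * D = n + q := ⟨k * D - n, by omega⟩
        have hq' : k = c + q := by omega
        have : D * k = D * c + D * q := by rw [hq', mul_add]
        have : 1 * q ≤ D * q := Nat.mul_le_mul_right _ hD
        have : k * D = D * k := mul_comm _ _
        omega
    · rw [show n = k * D + (n - k * D - 1 + 1) by omega, cntP_add] at hn
      have e1 := hc 0 (by omega)
      unfold cnt at e1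
      rw [Nat.sub_zero] at e1
      rw [e1, min_eq_left hkD, mul_add] at hn
      have := not_busy h4 (n - k * D - 1)
      unfold cnt at this
      rw [show ((0 : ℕ) : ℤ) + ((k * D : ℕ) : ℤ) = ((k * D : ℕ) : ℤ) by simp] at hn
      have : k * D = D * k := mul_comm _ _
      omega
  · intro i hi
    refine ⟨k * D - i - 1, ?_⟩
    rw [zero_add, show k * D - i - 1 + 1 = k * D - i by omega, hc i hi.le]
    by_cases h5 : k ≤ k * D - i
    · rw [min_eq_left h5]
      have : k * D = D * k := mul_comm _ _
      omega
    · rw [min_eq_right (by omega)]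
      have : 1 * (k * D - i) ≤ D * (k * D - i) := Nat.mul_le_mul_right _ hD
      omega
  · simpa using h4

end Counting


/-- all block data -/
structure BSys {t : ℕ} (A : Fin t → Fin t → Bool) where
  z : Bool → ℤ → Fin t
  P : ℕ
  D : ℕ
  Blk : (ℤ → Fin t) → ℕ → (ℕ → Fin 3) → ℕ → Fin t
  hz : ∀ b, z b ∈ SigmaA A
  hP : 0 < P
  hD : 0 < D
  hper : ∀ b i, z b (i + P) = z b i
  adm : ∀ b j T p, ValidPat D T p → A (tr j (z b) (-1)) (Blk (tr j (z b)) T p 0) = true ∧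
        (∀ k, k + 1 < T → A (Blk (tr j (z b)) T p k) (Blk (tr j (z b)) T p (k + 1)) = true) ∧
        Blk (tr j (z b)) T p (T - 1) = z (ty (p (T - 1))) 0
  dec : ∀ b j (e e' T T' : ℕ) p p' (x : ℕ → Fin t), ValidPat D T p → ValidPat D T' p' →
        (∀ k < e, x k = tr j (z b) k) → (∀ k < T, x (e + k) = Blk (tr (e + j) (z b)) T p k) →
        (∀ k < e', x k = tr j (z b) k) → (∀ k < T', x (e' + k) = Blk (tr (e' + j) (z b)) T' p' k) →
        e = e' ∧ T = T' ∧ p = p'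
  full : ∀ u : List (Fin t), List.IsChain (fun a b => A a b = true) u → ∃ k : ℕ, 1 ≤ k ∧
        ∀ b j p, ValidPat D (k * D) p → ∃ s, ∀ i, i < u.length →
          s + i < k * D ∧ u[i]? = some (Blk (tr j (z b)) (k * D) p (s + i))

namespace BSys
variable {t : ℕ} {A : Fin t → Fin t → Bool} (S : BSys A)

/-- distance to previous busy time -/
noncomputable def pB (y : ℤ → Fin 3) (i : ℤ) : ℕ := sInf {n : ℕ | Busy S.D y (i - 1 - n)}
/-- distance to previous idle time -/
noncomputable def pI (y : ℤ → Fin 3) (i : ℤ) : ℕ := sInf {n : ℕ | ¬ Busy S.D y (i - 1 - n)}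
/-- distance to next idle time -/
noncomputable def nI (y : ℤ → Fin 3) (i : ℤ) : ℕ := sInf {n : ℕ | ¬ Busy S.D y (i + n)}
/-- context point -/
noncomputable def ctx (y : ℤ → Fin 3) (i : ℤ) : ℤ → Fin t :=
  tr (1 + (S.pB y i : ℤ)) (S.z (ty (y (i - 1 - S.pB y i))))

open Classical in
/-- the coding map -/
noncomputable def psi0 (y : ℤ → Fin 3) (i : ℤ) : Fin t :=
  if Busy S.D y i then
    S.Blk (S.ctx y (i - S.pI y i)) (S.pI y i + S.nI y i)
      (pat y (i - S.pI y i) (S.pI y i + S.nI y i)) (S.pI y i)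
  else S.ctx y i 0

lemma sInf_eq_of {p : ℕ → Prop} {n : ℕ} (h : p n) (h' : ∀ k < n, ¬ p k) : sInf {n | p n} = n := by
  apply le_antisymm
  · exact Nat.sInf_le h
  · by_contra hc
    push Not at hc
    exact h' _ hc (Nat.sInf_mem (s := {n | p n}) ⟨n, h⟩)

lemma ctx_of {y : ℤ → Fin 3} {i : ℤ} {n : ℕ} (h : Busy S.D y (i - 1 - n))
    (h' : ∀ k : ℕ, k < n → ¬ Busy S.D y (i - 1 - k)) :
    S.ctx y i = tr (1 + (n : ℤ)) (S.z (ty (y (i - 1 - n)))) := by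
  have : S.pB y i = n := sInf_eq_of (p := fun n : ℕ => Busy S.D y (i - 1 - n)) h h'
  rw [ctx, this]

lemma psi0_run {y : ℤ → Fin 3} {a : ℤ} {T : ℕ} (h : Run S.D y a T) {k : ℕ} (hk : k < T) :
    S.psi0 y (a + k) = S.Blk (S.ctx y a) T (pat y a T) k := by
  obtain ⟨h0, h1, h2, h3⟩ := h
  have e1 : S.pI y (a + k) = k := by
    apply sInf_eq_of (p := fun n : ℕ => ¬ Busy S.D y (a + k - 1 - n))
    · rwa [show a + (k : ℤ) - 1 - k = a - 1 by ring]
    · intro q hq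
      rw [not_not, show a + (k : ℤ) - 1 - q = a + ((k - 1 - q : ℕ) : ℤ) by omega]
      exact h2 _ (by omega)
  have e2 : S.nI y (a + k) = T - k := by
    apply sInf_eq_of (p := fun n : ℕ => ¬ Busy S.D y (a + k + n))
    · rwa [show a + (k : ℤ) + ((T - k : ℕ) : ℤ) = a + T by omega]
    · intro q hq
      rw [not_not, show a + (k : ℤ) + q = a + ((k + q : ℕ) : ℤ) by omega]
      exact h2 _ (by omega)
  rw [psi0, if_pos (h2 k hk), e1, e2, show a + (k : ℤ) - k = a by ring,
    show k + (T - k) = T by omega]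

lemma psi0_idle {y : ℤ → Fin 3} {i : ℤ} (h : ¬ Busy S.D y i) : S.psi0 y i = S.ctx y i 0 := by
  rw [psi0, if_neg h]

lemma ctx_busy {y : ℤ → Fin 3} {i : ℤ} (h : Busy S.D y i) :
    S.ctx y (i + 1) = tr 1 (S.z (ty (y i))) := by
  have := S.ctx_of (y := y) (i := i + 1) (n := 0) (by simpa using h) (by intro k hk; omega)
  simpa using this

lemma ctx_idle {y : ℤ → Fin 3} (hy : Good S.P S.D y) {i : ℤ} (h : ¬ Busy S.D y i) :
    S.ctx y (i + 1) = tr 1 (S.ctx y i) := by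
  obtain ⟨n, h1, h2⟩ := hy.prev_busy S.hD i
  rw [S.ctx_of h1 h2, S.ctx_of (i := i + 1) (n := n + 1), tr_tr]
  · push_cast
    rw [show i + 1 - 1 - ((n : ℤ) + 1) = i - 1 - n by ring,
      show 1 + ((n : ℤ) + 1) = 1 + (1 + n) by ring]
  · push_cast
    rwa [show i + 1 - 1 - ((n : ℤ) + 1) = i - 1 - n by ring]
  · intro k hk
    by_cases hk0 : k = 0
    · subst hk0; simpa using h
    · have := h2 (k - 1) (by omega)
      rwa [show i + 1 - 1 - (k : ℤ) = i - 1 - ((k - 1 : ℕ) : ℤ) by omega]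

lemma ctx_orb (y : ℤ → Fin 3) (i : ℤ) : ∃ b j, S.ctx y i = tr j (S.z b) := ⟨_, _, rfl⟩

lemma ctx_iter {y : ℤ → Fin 3} (hy : Good S.P S.D y) {i : ℤ} (n : ℕ)
    (h : ∀ k : ℕ, k < n → ¬ Busy S.D y (i + k)) : S.ctx y (i + n) = tr n (S.ctx y i) := by
  induction n with
  | zero => simp; funext k; simp [tr]
  | succ n ih =>
    have h1 := S.ctx_idle hy (h n (by omega))
    push_cast
    rw [← add_assoc, h1, ih (fun k hk => h k (by omega)), tr_tr, add_comm]

lemma run_end {y : ℤ → Fin 3} {a : ℤ} {T : ℕ} (h : Run S.D y a T) :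
    S.ctx y (a + T) = tr 1 (S.z (ty (pat y a T (T - 1)))) := by
  obtain ⟨h0, h1, h2, h3⟩ := h
  have := S.ctx_busy (h2 (T - 1) (by omega))
  rw [show a + ((T - 1 : ℕ) : ℤ) + 1 = a + T by omega] at this
  rw [this]
  simp [pat, h0]

lemma psi0_mem {y : ℤ → Fin 3} (hy : Good S.P S.D y) : S.psi0 y ∈ SigmaA A := by
  intro i
  by_cases hi : Busy S.D y i
  · obtain ⟨a, T, k, hr, hk, rfl⟩ := hy.exists_run S.hP S.hD i hi
    obtain ⟨b, j, hbj⟩ := S.ctx_orb y a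
    obtain ⟨a1, a2, a3⟩ := S.adm b j T _ (hr.valid S.hD)
    rw [S.psi0_run hr hk]
    by_cases hk1 : k + 1 < T
    · have := S.psi0_run hr hk1
      push_cast at this
      rw [add_assoc, this, hbj]
      exact a2 k hk1
    · have hkT : k = T - 1 := by omega
      have h1 : a + (k : ℤ) + 1 = a + T := by omega
      rw [h1, S.psi0_idle hr.2.2.2, S.run_end hr, hbj, hkT, a3]
      have := S.hz (ty (pat y a T (T - 1))) 0
      simpa [tr] using this
  · rw [S.psi0_idle hi]
    have hc := S.ctx_idle hy hi
    by_cases hi1 : Busy S.D y (i + 1)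
    · obtain ⟨a, T, k, hr, hk, hik⟩ := hy.exists_run S.hP S.hD _ hi1
      have hk0 : k = 0 := by
        by_contra hk0
        have := hr.2.2.1 (k - 1) (by omega)
        rw [show a + ((k - 1 : ℕ) : ℤ) = i by omega] at this
        exact hi this
      subst hk0
      rw [hik, S.psi0_run hr hk]
      obtain ⟨b, j, hbj⟩ := S.ctx_orb y a
      obtain ⟨a1, a2, a3⟩ := S.adm b j T _ (hr.valid S.hD)
      have h2 : S.ctx y i 0 = tr j (S.z b) (-1) := by
        rw [← hbj, show a = i + 1 by push_cast at hik; omega, hc]; simp [tr]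
      rw [h2, hbj]; exact a1
    · rw [S.psi0_idle hi1, hc]
      obtain ⟨b, j, hbj⟩ := S.ctx_orb y i
      rw [hbj]
      have := tr_mem (A := A) (j := j) (S.hz b) 0
      simpa [tr] using this

lemma psi0_shift (y : ℤ → Fin 3) : S.psi0 (shift y) = shift (S.psi0 y) := by
  funext i
  have e1 : ∀ i, S.pB (shift y) i = S.pB y (i + 1) := by
    intro i; unfold pB; congr 1; ext n
    rw [Set.mem_ofPred_eq, Set.mem_ofPred_eq, busy_shift, show i - 1 - (n : ℤ) + 1 = i + 1 - 1 - n by ring]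
  have e2 : S.pI (shift y) i = S.pI y (i + 1) := by
    unfold pI; congr 1; ext n
    rw [Set.mem_ofPred_eq, Set.mem_ofPred_eq, busy_shift, show i - 1 - (n : ℤ) + 1 = i + 1 - 1 - n by ring]
  have e3 : S.nI (shift y) i = S.nI y (i + 1) := by
    unfold nI; congr 1; ext n
    rw [Set.mem_ofPred_eq, Set.mem_ofPred_eq, busy_shift, show i + (n : ℤ) + 1 = i + 1 + n by ring]
  have e4 : ∀ i, S.ctx (shift y) i = S.ctx y (i + 1) := by
    intro i; unfold ctx; rw [e1]; simp only [shift]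
    rw [show i - 1 - (S.pB y (i + 1) : ℤ) + 1 = i + 1 - 1 - S.pB y (i + 1) by ring]
  have e5 : ∀ a T, pat (shift y) a T = pat y (a + 1) T := by
    intro a T; funext k; simp only [pat, shift]
    rw [show a + (k : ℤ) + 1 = a + 1 + k by ring]
  change S.psi0 (shift y) i = S.psi0 y (i + 1)
  unfold psi0
  rw [e2, e3, e4, e4, e5, show i - (S.pI y (i + 1) : ℤ) + 1 = i + 1 - S.pI y (i + 1) by ring]
  by_cases hb : Busy S.D y (i + 1)
  · rw [if_pos hb, if_pos ((busy_shift y i).2 hb)]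
  · rw [if_neg hb, if_neg (fun h => hb ((busy_shift y i).1 h))]

lemma per_ext {b b' : Bool} {j j' : ℤ}
    (h : ∀ k : ℕ, k < S.P → tr j (S.z b) k = tr j' (S.z b') k) : tr j (S.z b) = tr j' (S.z b') := by
  have hperk : ∀ b (n : ℤ) i, S.z b (i + n * S.P) = S.z b i := by
    intro b n
    induction n using Int.induction_on with
    | zero => intro i; simp
    | succ n ih => intro i; rw [show i + ((n : ℤ) + 1) * S.P = i + n * S.P + S.P by ring, S.hper, ih]
    | pred n ih => intro i; rw [← S.hper, show i + (-(n : ℤ) - 1) * S.P + S.P = i + -(n : ℤ) * S.P by ring, ih]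
  have hP := S.hP
  funext i
  have h1 := Int.emod_nonneg i (show (S.P : ℤ) ≠ 0 by omega)
  have h2 := Int.emod_lt_of_pos i (show (0 : ℤ) < S.P by omega)
  have h3 := Int.emod_add_mul_ediv i S.P
  have h4 := h (i % S.P).toNat (by omega)
  rw [Int.toNat_of_nonneg h1] at h4
  simp only [tr] at h4 ⊢
  have e : ∀ j : ℤ, i + j = (i % S.P + j) + (i / S.P) * S.P := by intro j; linarith
  rw [e j, e j', hperk, hperk, h4]

lemma psi0_inj {y y' : ℤ → Fin 3} (hy : Good S.P S.D y) (hy' : Good S.P S.D y')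
    (h : S.psi0 y = S.psi0 y') : y = y' := by
  -- forward step
  have step : ∀ j : ℤ, ¬ Busy S.D y j → ¬ Busy S.D y' j → S.ctx y j = S.ctx y' j →
      ∃ n : ℕ, 0 < n ∧ (∀ k : ℕ, k < n → y (j + k) = y' (j + k)) ∧ ¬ Busy S.D y (j + n) ∧
        ¬ Busy S.D y' (j + n) ∧ S.ctx y (j + n) = S.ctx y' (j + n) := by
    intro j hj hj' hc
    obtain ⟨e, T, hr, he⟩ := hy.next_run S.hP S.hD j hj
    obtain ⟨e', T', hr', he'⟩ := hy'.next_run S.hP S.hD j hj'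
    obtain ⟨b, q, hbq⟩ := S.ctx_orb y j
    have c1 := S.ctx_iter hy e he
    have c1' := S.ctx_iter hy' e' he'
    rw [hbq, tr_tr] at c1
    rw [← hc, hbq, tr_tr] at c1'
    obtain ⟨d1, d2, d3⟩ := S.dec b q e e' T T' _ _ (fun k => S.psi0 y (j + k)) (hr.valid S.hD)
      (hr'.valid S.hD) (by
        intro k hk
        rw [S.psi0_idle (he k hk), S.ctx_iter hy k (fun i hi => he i (by omega)), hbq]
        simp [tr]) (by
        intro k hk
        rw [← c1, ← S.psi0_run hr hk]; push_cast; rw [add_assoc]) (by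
        intro k hk
        rw [h, S.psi0_idle (he' k hk), S.ctx_iter hy' k (fun i hi => he' i (by omega)), ← hc, hbq]
        simp [tr]) (by
        intro k hk
        rw [← c1', ← S.psi0_run hr' hk, h]; push_cast; rw [add_assoc])
    subst d1 d2
    refine ⟨e + T, by have := hr.1; omega, ?_, ?_, ?_, ?_⟩
    · intro k hk
      by_cases hke : k < e
      · rw [idle_zero S.hD (he k hke), idle_zero S.hD (he' k hke)]
      · have := congrFun d3 (k - e)
        simp only [pat, show k - e < T by omega, if_true] at this
        rwa [show j + (e : ℤ) + ((k - e : ℕ) : ℤ) = j + k by omega] at this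
    · have := hr.2.2.2; push_cast; rwa [← add_assoc]
    · have := hr'.2.2.2; push_cast; rwa [← add_assoc]
    · push_cast
      rw [← add_assoc, S.run_end hr, S.run_end hr', d3]
  have fwd : ∀ j : ℤ, ¬ Busy S.D y j → ¬ Busy S.D y' j → S.ctx y j = S.ctx y' j →
      ∀ N : ℕ, ∃ n : ℕ, N ≤ n ∧ (∀ k : ℕ, k < n → y (j + k) = y' (j + k)) ∧ ¬ Busy S.D y (j + n) ∧
        ¬ Busy S.D y' (j + n) ∧ S.ctx y (j + n) = S.ctx y' (j + n) := by
    intro j h1 h2 h3 N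
    induction N with
    | zero => exact ⟨0, le_rfl, by intro k hk; omega, by simpa using h1, by simpa using h2, by simpa using h3⟩
    | succ N ih =>
      obtain ⟨n, a1, a2, a3, a4, a5⟩ := ih
      obtain ⟨n', b1, b2, b3, b4, b5⟩ := step _ a3 a4 a5
      refine ⟨n + n', by omega, ?_, ?_, ?_, ?_⟩
      · intro k hk
        by_cases hkn : k < n
        · exact a2 k hkn
        · have := b2 (k - n) (by omega)
          rwa [show j + (n : ℤ) + ((k - n : ℕ) : ℤ) = j + k by omega] at this
      all_goals push_cast; rwa [← add_assoc]
  funext i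
  obtain ⟨j, hj, hw⟩ := common_window S.hP S.hD hy hy' i
  have h0 := hw 0 S.hP
  simp only [Nat.cast_zero, add_zero] at h0
  have hc : S.ctx y j = S.ctx y' j := by
    have key : ∀ k : ℕ, k < S.P → S.ctx y j k = S.ctx y' j k := by
      intro k hk
      have e1 := S.psi0_idle (hw k hk).1
      have e2 := S.psi0_idle (hw k hk).2
      rw [S.ctx_iter hy k (fun i hi => (hw i (by omega)).1)] at e1
      rw [S.ctx_iter hy' k (fun i hi => (hw i (by omega)).2), ← h, e1] at e2
      simpa [tr] using e2
    exact S.per_ext key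
  obtain ⟨n, a1, a2, -⟩ := fwd j h0.1 h0.2 hc ((i - j).toNat + 1)
  have := a2 (i - j).toNat (by omega)
  rwa [show j + ((i - j).toNat : ℤ) = i by omega] at this

lemma psi0_local {y : ℤ → Fin 3} (hy : Good S.P S.D y) (i : ℤ) :
    ∃ N : ℕ, ∀ y' : ℤ → Fin 3, (∀ k : ℤ, |k - i| ≤ N → y' k = y k ∧ (Busy S.D y' k ↔ Busy S.D y k)) →
      S.psi0 y' i = S.psi0 y i := by
  by_cases hi : Busy S.D y i
  · obtain ⟨a, T, k, hr, hk, rfl⟩ := hy.exists_run S.hP S.hD i hi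
    obtain ⟨n, h1, h2⟩ := hy.prev_busy S.hD a
    refine ⟨T + n + 1, fun y' hyy => ?_⟩
    have hyy' : ∀ q : ℤ, a - 1 - n ≤ q → q ≤ a + T → y' q = y q ∧ (Busy S.D y' q ↔ Busy S.D y q) := by
      intro q h1 h2
      apply hyy
      rw [abs_le]; constructor <;> (push_cast; omega)
    have hr' : Run S.D y' a T := by
      obtain ⟨r0, r1, r2, r3⟩ := hr
      refine ⟨r0, ?_, ?_, ?_⟩
      · rwa [(hyy' _ (by omega) (by omega)).2]
      · intro q hq; rw [(hyy' _ (by omega) (by omega)).2]; exact r2 q hq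
      · rwa [(hyy' _ (by omega) (by omega)).2]
    have hp : pat y' a T = pat y a T := by
      funext q
      simp only [pat]
      split_ifs with hq
      · exact (hyy' _ (by omega) (by omega)).1
      · rfl
    have hc : S.ctx y' a = S.ctx y a := by
      rw [S.ctx_of h1 h2, S.ctx_of (n := n), (hyy' _ (by omega) (by omega)).1]
      · rwa [(hyy' _ (by omega) (by omega)).2]
      · intro q hq; rw [(hyy' _ (by omega) (by omega)).2]; exact h2 q hq
    rw [S.psi0_run hr hk, S.psi0_run hr' hk, hp, hc]
  · obtain ⟨n, h1, h2⟩ := hy.prev_busy S.hD i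
    refine ⟨n + 1, fun y' hyy => ?_⟩
    have hyy' : ∀ q : ℤ, i - 1 - n ≤ q → q ≤ i → y' q = y q ∧ (Busy S.D y' q ↔ Busy S.D y q) := by
      intro q h1 h2
      apply hyy
      rw [abs_le]; constructor <;> (push_cast; omega)
    have hi' : ¬ Busy S.D y' i := by rwa [(hyy' _ (by omega) (by omega)).2]
    have hc : S.ctx y' i = S.ctx y i := by
      rw [S.ctx_of h1 h2, S.ctx_of (n := n), (hyy' _ (by omega) (by omega)).1]
      · rwa [(hyy' _ (by omega) (by omega)).2]
      · intro q hq; rw [(hyy' _ (by omega) (by omega)).2]; exact h2 q hq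
    rw [S.psi0_idle hi, S.psi0_idle hi', hc]

end BSys


section MeasGood

lemma cnt_succ (y : ℤ → Fin 3) (i : ℤ) (n : ℕ) :
    cnt y i (n + 1) = cnt y i n + if y (i + n) ≠ 0 then 1 else 0 := by
  unfold cnt
  rw [cntP_add]
  congr 1
  split_ifs with h
  · exact cntP_one_pos (p := fun k => y k ≠ 0) h
  · exact cntP_one_neg (p := fun k => y k ≠ 0) h

lemma measurable_cnt (i : ℤ) (n : ℕ) : Measurable (fun y : ℤ → Fin 3 => cnt y i n) := by
  induction n with
  | zero => simp only [cnt, cntP_zero]; exact measurable_const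
  | succ n ih =>
    simp only [cnt_succ]
    refine ih.add ?_
    exact (measurable_of_finite (fun a : Fin 3 => if a ≠ 0 then 1 else 0)).comp (measurable_pi_apply (i + n : ℤ))

lemma measurable_busy (D : ℕ) (i : ℤ) : MeasurableSet {y : ℤ → Fin 3 | Busy D y i} := by
  have : {y : ℤ → Fin 3 | Busy D y i} = ⋃ n : ℕ, (fun y => cnt y i (n + 1)) ⁻¹' {c | n < D * c} := by
    ext y; simp [Busy]
  rw [this]
  exact MeasurableSet.iUnion fun n => measurable_cnt i (n + 1) (MeasurableSet.of_discrete)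

lemma measurable_good (P D : ℕ) : MeasurableSet {y : ℤ → Fin 3 | Good P D y} := by
  have h0 : ∀ i : ℤ, MeasurableSet {y : ℤ → Fin 3 | y i ≠ 0} := fun i =>
    (measurable_pi_apply (X := fun _ : ℤ => Fin 3) i) (MeasurableSet.of_discrete (s := {a : Fin 3 | a ≠ 0}))
  have h1 : ∀ (i : ℤ) (n : ℕ), MeasurableSet {y : ℤ → Fin 3 | 4 * P * D * cnt y i n ≤ n} := fun i n =>
    measurable_cnt i n (MeasurableSet.of_discrete (s := {c : ℕ | 4 * P * D * c ≤ n}))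
  have e : {y : ℤ → Fin 3 | Good P D y} =
      (⋂ i : ℤ, ⋃ N : ℕ, ⋂ n : ℕ, ⋂ _ : N ≤ n, {y : ℤ → Fin 3 | 4 * P * D * cnt y i n ≤ n}) ∩
      ((⋂ i : ℤ, ⋃ N : ℕ, ⋂ n : ℕ, ⋂ _ : N ≤ n, {y : ℤ → Fin 3 | 4 * P * D * cnt y (i - n) n ≤ n}) ∩
      ((⋂ i : ℤ, ⋃ j : ℤ, ⋃ _ : i ≤ j, {y : ℤ → Fin 3 | y j ≠ 0}) ∩
      (⋂ i : ℤ, ⋃ j : ℤ, ⋃ _ : j ≤ i, {y : ℤ → Fin 3 | y j ≠ 0}))) := by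
    ext y
    simp [Good, eventually_atTop]
  rw [e]
  refine .inter ?_ (.inter ?_ (.inter ?_ ?_))
  · exact .iInter fun i => .iUnion fun N => .iInter fun n => .iInter fun _ => h1 _ _
  · exact .iInter fun i => .iUnion fun N => .iInter fun n => .iInter fun _ => h1 _ _
  · exact .iInter fun i => .iUnion fun j => .iUnion fun _ => h0 j
  · exact .iInter fun i => .iUnion fun j => .iUnion fun _ => h0 j

lemma good_of_shift {P D : ℕ} {y : ℤ → Fin 3} (h : Good P D (shift y)) : Good P D y := by
  obtain ⟨h1, h2, h3, h4⟩ := h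
  have e : ∀ i n, cnt y i n = cnt (shift y) (i - 1) n := by
    intro i n; rw [cnt_shift]; congr 1; ring
  refine ⟨fun i => ?_, fun i => ?_, fun i => ?_, fun i => ?_⟩
  · simp only [e]; exact h1 (i - 1)
  · simp only [e]
    have := h2 (i - 1)
    simpa only [show ∀ n : ℕ, i - 1 - (n : ℤ) = i - n - 1 from fun n => by ring] using this
  · obtain ⟨j, hj, h⟩ := h3 (i - 1)
    exact ⟨j + 1, by omega, h⟩
  · obtain ⟨j, hj, h⟩ := h4 (i - 1)
    exact ⟨j + 1, by omega, h⟩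

lemma busy_tendsto {ι : Type*} {l : Filter ι} {P D : ℕ} (hP : 0 < P) (Y : ι → ℤ → Fin 3)
    (y w : ℤ → Fin 3)
    (hw : ∀ i : ℤ, ∀ᶠ n : ℕ in atTop, 4 * P * D * cnt w i n ≤ n)
    (hd : ∀ᶠ k in l, ∀ i, Y k i ≠ 0 → w i ≠ 0) (hd' : ∀ i, y i ≠ 0 → w i ≠ 0)
    (hc : ∀ i, ∀ᶠ k in l, Y k i = y i) (i : ℤ) :
    ∀ᶠ k in l, (Busy D (Y k) i ↔ Busy D y i) := by
  obtain ⟨N, hN⟩ := eventually_atTop.1 (hw i)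
  have h1 : ∀ v : ℤ → Fin 3, (∀ i, v i ≠ 0 → w i ≠ 0) → ∀ n, N + 1 ≤ n → D * cnt v i (n + 1) ≤ n := by
    intro v hv n hn
    have a1 : cnt v i (n + 1) ≤ cnt w i (n + 1) := cntP_imp (fun k _ h => hv _ h)
    have a2 := hN (n + 1) (by omega)
    have a3 : 4 * 1 * (D * cnt w i (n + 1)) ≤ 4 * P * (D * cnt w i (n + 1)) :=
      Nat.mul_le_mul_right _ (Nat.mul_le_mul_left _ hP)
    have a4 : D * cnt v i (n + 1) ≤ D * cnt w i (n + 1) := Nat.mul_le_mul_left _ a1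
    rw [← mul_assoc (4 * P)] at a3
    omega
  have h2 : ∀ᶠ k in l, ∀ j ∈ Finset.range (N + 2), Y k (i + j) = y (i + j) := by
    rw [Filter.eventually_all_finset]
    intro j _
    exact hc _
  filter_upwards [h2, hd] with k hk hdk
  have h3 : ∀ n, n < N + 1 → cnt (Y k) i (n + 1) = cnt y i (n + 1) := by
    intro n hn
    apply cntP_congr
    intro j hj
    rw [hk j (Finset.mem_range.2 (by omega))]
  constructor
  · rintro ⟨n, hn⟩
    refine ⟨n, ?_⟩
    by_cases hnN : n < N + 1
    · rwa [← h3 n hnN]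
    · have := h1 (Y k) hdk n (by omega); omega
  · rintro ⟨n, hn⟩
    refine ⟨n, ?_⟩
    by_cases hnN : n < N + 1
    · rwa [h3 n hnN]
    · have := h1 y hd' n (by omega); omega

end MeasGood

namespace BSys
variable {t : ℕ} {A : Fin t → Fin t → Bool} (S : BSys A)

lemma psi0_tendsto {ι : Type*} {l : Filter ι} (Y : ι → ℤ → Fin 3)
    (y w : ℤ → Fin 3)
    (hw : ∀ i : ℤ, ∀ᶠ n : ℕ in atTop, 4 * S.P * S.D * cnt w i n ≤ n)
    (hd : ∀ᶠ k in l, ∀ i, Y k i ≠ 0 → w i ≠ 0) (hd' : ∀ i, y i ≠ 0 → w i ≠ 0)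
    (hc : ∀ i, ∀ᶠ k in l, Y k i = y i) (hy : Good S.P S.D y) (i : ℤ) :
    ∀ᶠ k in l, S.psi0 (Y k) i = S.psi0 y i := by
  obtain ⟨N, hN⟩ := S.psi0_local hy i
  have h1 : ∀ᶠ k in l, ∀ j ∈ Finset.Icc (i - N) (i + N), Y k j = y j ∧ (Busy S.D (Y k) j ↔ Busy S.D y j) := by
    rw [Filter.eventually_all_finset]
    intro j _
    exact (hc _).and (busy_tendsto S.hP Y y w hw hd hd' hc j)
  filter_upwards [h1] with k hk
  apply hN
  intro j hj
  rw [abs_le] at hj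
  exact hk j (Finset.mem_Icc.2 (by omega))

lemma measurable_psi0 (i : ℤ) (a : Fin t) :
    MeasurableSet {y : ℤ → Fin 3 | Good S.P S.D y ∧ S.psi0 y i = a} := by
  classical
  let J : (N : ℕ) → (ℤ → Fin 3) → (↥(Finset.Icc (i - (N : ℤ)) (i + N)) → Fin 3 × Bool) :=
    fun N y k => (y k, decide (Busy S.D y k))
  have hJ : ∀ N, Measurable (J N) := by
    intro N
    refine measurable_pi_lambda _ fun k => ?_
    refine (measurable_pi_apply _).prodMk ?_
    exact measurable_to_bool (by
      convert measurable_busy S.D (k : ℤ) using 1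
      ext y; simp)
  have e : {y : ℤ → Fin 3 | Good S.P S.D y ∧ S.psi0 y i = a} = {y | Good S.P S.D y} ∩
      ⋃ N, J N ⁻¹' {g | ∀ y', J N y' = g → S.psi0 y' i = a} := by
    ext y
    simp only [Set.mem_inter_iff, Set.mem_iUnion, Set.mem_preimage, Set.mem_ofPred_eq]
    refine and_congr_right fun hy => ⟨?_, ?_⟩
    · rintro rfl
      obtain ⟨N, hN⟩ := S.psi0_local hy i
      refine ⟨N, fun y' h => hN y' ?_⟩
      intro k hk
      rw [abs_le] at hk
      have := congrFun h ⟨k, Finset.mem_Icc.2 (by omega)⟩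
      simp only [J, Prod.mk.injEq, decide_eq_decide] at this
      exact this
    · rintro ⟨N, hN⟩
      exact hN y rfl
  rw [e]
  refine (measurable_good _ _).inter (.iUnion fun N => hJ N ?_)
  exact (Set.toFinite _).measurableSet

open Classical in
/-- the coding map into the subshift -/
noncomputable def psi (y : ℤ → Fin 3) : ↥(SigmaA A) :=
  if h : Good S.P S.D y then ⟨S.psi0 y, S.psi0_mem h⟩ else ⟨S.z false, S.hz false⟩

lemma psi_good {y : ℤ → Fin 3} (h : Good S.P S.D y) : (S.psi y).1 = S.psi0 y := by
  simp [psi, h]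

lemma measurable_psi : Measurable S.psi := by
  have : Measurable (fun y => (S.psi y).1) := by
    refine measurable_pi_lambda _ fun i => ?_
    refine measurable_to_countable' fun a => ?_
    have e : (fun y => (S.psi y).1 i) ⁻¹' {a} = {y : ℤ → Fin 3 | Good S.P S.D y ∧ S.psi0 y i = a} ∪
        ({y | ¬ Good S.P S.D y} ∩ {y | S.z false i = a}) := by
      ext y
      by_cases h : Good S.P S.D y <;> simp [psi, h]
    rw [e]
    refine (S.measurable_psi0 i a).union (.inter (measurable_good _ _).compl (by simp))
  exact this.subtype_mk (h := fun y => (S.psi y).2)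

lemma psi_shift {y : ℤ → Fin 3} (h : Good S.P S.D y) : S.psi (shift y) = shiftA A (S.psi y) := by
  apply Subtype.ext
  rw [S.psi_good (good_shift h), psi0_shift]
  simp only [shiftA]
  rw [S.psi_good h]

lemma psi_inj {y y' : ℤ → Fin 3} (hy : Good S.P S.D y) (hy' : Good S.P S.D y')
    (h : S.psi y = S.psi y') : y = y' := by
  apply S.psi0_inj hy hy'
  rw [← S.psi_good hy, ← S.psi_good hy', h]

end BSys

section top
variable {t : ℕ} (A : Fin t → Fin t → Bool)
lemma isClosed_SigmaA : IsClosed (SigmaA A) := by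
  have : SigmaA A = ⋂ i : ℤ, {x | A (x i) (x (i + 1)) = true} := by ext; simp [SigmaA]
  rw [this]
  refine isClosed_iInter fun i => ?_
  exact (isClosed_discrete {p : Fin t × Fin t | A p.1 p.2 = true}).preimage
    (f := fun x : ℤ → Fin t => (x i, x (i + 1))) (by fun_prop)
instance : CompactSpace (↥(SigmaA A)) := isCompact_iff_compactSpace.1 (isClosed_SigmaA A).isCompact

lemma measurable_shiftA : Measurable (shiftA A) := by
  unfold shiftA
  exact (measurable_shift.comp measurable_subtype_coe).subtype_mk (h := _)

lemma continuous_shiftA : Continuous (shiftA A) := by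
  refine Continuous.subtype_mk ?_ _
  refine continuous_pi fun i => ?_
  exact (continuous_apply (i + 1)).comp continuous_subtype_val

lemma shiftA_iter (n : ℕ) (x : ↥(SigmaA A)) (i : ℤ) : ((shiftA A)^[n] x).1 i = x.1 (i + n) := by
  have : ((shiftA A)^[n] x).1 = shift^[n] x.1 := by
    induction n generalizing x with
    | zero => rfl
    | succ n ih => rw [Function.iterate_succ_apply, ih]; rfl
  rw [this, shift_iter]

/-- neighborhoods contain cylinders -/
lemma nhds_cyl {x : ↥(SigmaA A)} {V : Set ↥(SigmaA A)} (hV : V ∈ 𝓝 x) :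
    ∃ N : ℕ, ∀ x' : ↥(SigmaA A), (∀ i : ℤ, |i| ≤ N → x'.1 i = x.1 i) → x' ∈ V := by
  by_contra hc
  push Not at hc
  choose g hg hgV using hc
  have : Tendsto g atTop (𝓝 x) := by
    rw [tendsto_subtype_rng, tendsto_pi_nhds]
    intro i
    apply tendsto_nhds_of_eventually_eq
    filter_upwards [eventually_ge_atTop i.natAbs] with n hn
    exact hg n i (by rw [abs_le]; omega)
  obtain ⟨n, hn⟩ := (this.eventually hV).exists
  exact hgV n hn
end top


section Coupling

/-- colouring of a uniform variable -/
noncomputable def col (ε s : ℝ) (u : unitInterval) : Fin 3 :=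
  if ε ≤ (u : ℝ) then 0 else if (u : ℝ) < ε * s then 2 else 1

/-- coupled fields -/
noncomputable def YY (ε s : ℝ) (ω : ℤ → unitInterval) : ℤ → Fin 3 := fun i => col ε s (ω i)

/-- the driving measure -/
noncomputable def Pr : Measure (ℤ → unitInterval) := bern (volume : Measure unitInterval)

instance : IsProbabilityMeasure Pr := by unfold Pr; infer_instance

lemma measurable_col (ε s : ℝ) : Measurable (col ε s) := by
  unfold col
  refine Measurable.ite (measurableSet_le measurable_const measurable_subtype_coe) measurable_const ?_
  exact Measurable.ite (measurableSet_lt measurable_subtype_coe measurable_const) measurable_const measurable_const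

lemma measurable_YY (ε s : ℝ) : Measurable (YY ε s) := by
  refine measurable_pi_lambda _ fun i => ?_
  exact (measurable_col ε s).comp (measurable_pi_apply i)

/-- the one-site law -/
noncomputable def mm (ε s : ℝ) : Measure (Fin 3) := Measure.map (col ε s) volume

instance (ε s : ℝ) : IsProbabilityMeasure (mm ε s) :=
  Measure.isProbabilityMeasure_map (measurable_col ε s).aemeasurable

lemma map_YY (ε s : ℝ) : Measure.map (YY ε s) Pr = bern (mm ε s) := by
  unfold Pr bern mm YY
  exact Measure.infinitePi_map_pi (fun _ : ℤ => (volume : Measure unitInterval)) (fun _ => measurable_col ε s)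

lemma vol_lt {r : ℝ} (h0 : 0 ≤ r) (h1 : r ≤ 1) :
    (volume : Measure unitInterval) {u | (u : ℝ) < r} = ENNReal.ofReal r :=
  unitInterval.volume_Iio ⟨r, h0, h1⟩

lemma col_ne_zero (ε s : ℝ) (u : unitInterval) : col ε s u ≠ 0 ↔ (u : ℝ) < ε := by
  unfold col
  split_ifs with h1 h2
  · simpa using h1
  · simpa using h1
  · simpa using h1

lemma mm_ne_zero {ε s : ℝ} (h0 : 0 ≤ ε) (h1 : ε ≤ 1) : mm ε s {a | a ≠ 0} = ENNReal.ofReal ε := by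
  rw [mm, Measure.map_apply (measurable_col ε s) MeasurableSet.of_discrete, ← vol_lt h0 h1]
  congr 1
  ext u
  exact col_ne_zero ε s u

lemma mm_two {ε s : ℝ} (h0 : 0 ≤ ε) (h1 : ε ≤ 1) (hs : 0 ≤ s) (hs1 : s ≤ 1) :
    mm ε s {2} = ENNReal.ofReal (ε * s) := by
  have : ε * s ≤ ε := by nlinarith
  rw [mm, Measure.map_apply (measurable_col ε s) MeasurableSet.of_discrete,
    ← vol_lt (by positivity : 0 ≤ ε * s) (by linarith)]
  congr 1
  ext u
  simp only [Set.mem_preimage, Set.mem_singleton_iff, Set.mem_ofPred_eq, col]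
  split_ifs with h1 h2
  · simp; linarith
  · simpa using h2
  · simpa using h2

lemma slln {ε : ℝ} (h0 : 0 ≤ ε) (h1 : ε ≤ 1) (f : ℕ → ℤ) (hf : Function.Injective f) :
    ∀ᵐ ω ∂Pr, Tendsto (fun n : ℕ => (∑ k ∈ Finset.range n, if ((ω (f k) : unitInterval) : ℝ) < ε then (1 : ℝ) else 0) / n)
      atTop (𝓝 ε) := by
  let h : unitInterval → ℝ := Set.indicator {u | (u : ℝ) < ε} (fun _ => (1 : ℝ))
  have hS : MeasurableSet {u : unitInterval | (u : ℝ) < ε} := measurableSet_lt measurable_subtype_coe measurable_const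
  have hm : Measurable h := measurable_const.indicator hS
  have hev : ∀ i : ℤ, MeasurePreserving (Function.eval i) Pr (volume : Measure unitInterval) := fun i =>
    measurePreserving_eval_infinitePi (fun _ : ℤ => (volume : Measure unitInterval)) i
  have hInt : Integrable h (volume : Measure unitInterval) := (integrable_const _).indicator hS
  have key := ProbabilityTheory.strong_law_ae_real (μ := Pr) (fun k ω => h (ω (f k)))
    ((hev (f 0)).integrable_comp_of_integrable hInt) (by
      have h1 : ProbabilityTheory.iIndepFun (fun (i : ℤ) (y : ℤ → unitInterval) => h (y i)) Pr :=
        ProbabilityTheory.iIndepFun_infinitePi (P := fun _ : ℤ => (volume : Measure unitInterval)) (X := fun _ => h) (fun _ => hm)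
      intro a b hab
      exact h1.indepFun (fun e => hab (hf e))) (by
      intro i
      refine ⟨(hm.comp (measurable_pi_apply (f i))).aemeasurable, (hm.comp (measurable_pi_apply (f 0))).aemeasurable, ?_⟩
      have : ∀ j : ℤ, Measure.map (fun ω : ℤ → unitInterval => h (ω j)) Pr = Measure.map h volume := by
        intro j
        rw [← (hev j).map_eq, Measure.map_map hm (hev j).measurable]
        rfl
      exact (this _).trans (this _).symm)
  have e : ∫ ω, h (ω (f 0)) ∂Pr = ε := by
    have := integral_map (μ := Pr) (φ := Function.eval (f 0)) (hev (f 0)).measurable.aemeasurable (f := h)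
      (by rw [(hev _).map_eq]; exact hm.aestronglyMeasurable)
    rw [(hev _).map_eq] at this
    refine this.symm.trans ?_
    rw [integral_indicator_const _ hS, measureReal_def, vol_lt h0 h1]
    simp [h0]
  rw [e] at key
  filter_upwards [key] with ω hω
  convert hω using 4
  simp only [h, Set.indicator_apply, Set.mem_ofPred_eq]

/-- the threshold -/
noncomputable def eps0 (P D : ℕ) : ℝ := 1 / (8 * P * D)

/-- good driving sequences -/
def OGood (P D : ℕ) (ω : ℤ → unitInterval) : Prop :=
  (∀ i : ℤ, ∀ᶠ n : ℕ in atTop, 4 * P * D * cnt (YY (eps0 P D) 1 ω) i n ≤ n) ∧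
  (∀ i : ℤ, ∀ᶠ n : ℕ in atTop, 4 * P * D * cnt (YY (eps0 P D) 1 ω) (i - n) n ≤ n) ∧
  (∀ k : ℕ, ∀ i : ℤ, ∃ j, i ≤ j ∧ ((ω j : unitInterval) : ℝ) < 1 / ((k : ℝ) + 1)) ∧
  (∀ k : ℕ, ∀ i : ℤ, ∃ j, j ≤ i ∧ ((ω j : unitInterval) : ℝ) < 1 / ((k : ℝ) + 1)) ∧
  (∀ i, 0 < ((ω i : unitInterval) : ℝ))

variable {P D : ℕ}

lemma eps0_pos (hP : 0 < P) (hD : 0 < D) : 0 < eps0 P D := by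
  unfold eps0
  have : (0 : ℝ) < P := by exact_mod_cast hP
  have : (0 : ℝ) < D := by exact_mod_cast hD
  positivity

lemma eps0_le (hP : 0 < P) (hD : 0 < D) : eps0 P D ≤ 1 / 8 := by
  unfold eps0
  have h1 : (1 : ℝ) ≤ P := by exact_mod_cast hP
  have h2 : (1 : ℝ) ≤ D := by exact_mod_cast hD
  apply one_div_le_one_div_of_le (by norm_num)
  nlinarith

lemma YY_ne_zero (ε s : ℝ) (ω : ℤ → unitInterval) (i : ℤ) : YY ε s ω i ≠ 0 ↔ ((ω i : unitInterval) : ℝ) < ε :=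
  col_ne_zero ε s (ω i)

lemma OGood.good {ω : ℤ → unitInterval} (h : OGood P D ω) {ε s : ℝ} (h0 : 0 < ε) (h1 : ε ≤ eps0 P D) :
    Good P D (YY ε s ω) := by
  obtain ⟨a1, a2, a3, a4, a5⟩ := h
  have hc : ∀ i n, cnt (YY ε s ω) i n ≤ cnt (YY (eps0 P D) 1 ω) i n := by
    intro i n
    apply cntP_imp
    intro k _ hk
    rw [YY_ne_zero] at hk ⊢
    linarith
  obtain ⟨k, hk⟩ := exists_nat_one_div_lt h0
  refine ⟨fun i => ?_, fun i => ?_, fun i => ?_, fun i => ?_⟩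
  · filter_upwards [a1 i] with n hn
    exact (Nat.mul_le_mul_left _ (hc _ _)).trans hn
  · filter_upwards [a2 i] with n hn
    exact (Nat.mul_le_mul_left _ (hc _ _)).trans hn
  · obtain ⟨j, hj, hj'⟩ := a3 k i
    exact ⟨j, hj, (YY_ne_zero _ _ _ _).2 (hj'.trans hk)⟩
  · obtain ⟨j, hj, hj'⟩ := a4 k i
    exact ⟨j, hj, (YY_ne_zero _ _ _ _).2 (hj'.trans hk)⟩

lemma cnt_sum (y : ℤ → Fin 3) (i : ℤ) (n : ℕ) :
    cnt y i n = ∑ k ∈ Finset.range n, if y (i + k) ≠ 0 then 1 else 0 := by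
  induction n with
  | zero => simp [cnt, cntP_zero]
  | succ n ih => rw [cnt_succ, ih, Finset.sum_range_succ]

lemma ae_pos (i : ℤ) : ∀ᵐ ω ∂Pr, 0 < ((ω i : unitInterval) : ℝ) := by
  rw [ae_iff]
  have h := bern_eval (volume : Measure unitInterval) i {0} (measurableSet_singleton 0)
  rw [measure_singleton] at h
  refine le_antisymm (le_trans (measure_mono ?_) h.le) bot_le
  intro ω hω
  have h1 : ¬ (0 : ℝ) < ω i := hω
  have := (ω i).2.1
  exact Subtype.ext (le_antisymm (not_lt.1 h1) this)

lemma ae_ne (i : ℤ) (r : ℝ) : ∀ᵐ ω ∂Pr, ((ω i : unitInterval) : ℝ) ≠ r := by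
  rw [ae_iff]
  by_cases hr : r ∈ unitInterval
  · have h := bern_eval (volume : Measure unitInterval) i {⟨r, hr⟩} (measurableSet_singleton _)
    rw [measure_singleton] at h
    refine le_antisymm (le_trans (measure_mono ?_) h.le) bot_le
    intro ω hω
    have h1 : ¬ ((ω i : unitInterval) : ℝ) ≠ r := hω
    push Not at h1
    exact Subtype.ext h1
  · refine le_antisymm (le_trans (measure_mono (t := ∅) ?_) (by simp)) bot_le
    intro ω hω
    have h1 : ¬ ((ω i : unitInterval) : ℝ) ≠ r := hω
    push Not at h1
    exact hr (h1 ▸ (ω i).2)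

lemma ae_OGood (hP : 0 < P) (hD : 0 < D) : ∀ᵐ ω ∂Pr, OGood P D ω := by
  have hP' : (0 : ℝ) < P := by exact_mod_cast hP
  have hD' : (0 : ℝ) < D := by exact_mod_cast hD
  have e0 := eps0_pos hP hD
  have e1 := eps0_le hP hD
  have inj1 : ∀ i : ℤ, Function.Injective (fun k : ℕ => i + (k : ℤ)) := fun i a b h => by
    simp only at h; omega
  have inj2 : ∀ i : ℤ, Function.Injective (fun k : ℕ => i - 1 - (k : ℤ)) := fun i a b h => by
    simp only at h; omega
  have up : ∀ (c : ℕ → ℝ), Tendsto (fun n : ℕ => c n / n) atTop (𝓝 (eps0 P D)) →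
      ∀ᶠ n : ℕ in atTop, 4 * P * D * c n ≤ n := by
    intro c hc
    have : eps0 P D < 1 / (4 * P * D) := by
      unfold eps0
      apply one_div_lt_one_div_of_lt (by positivity)
      nlinarith [mul_pos hP' hD']
    filter_upwards [hc.eventually (gt_mem_nhds this), eventually_gt_atTop 0] with n h1 h2
    have h2' : (0 : ℝ) < n := by exact_mod_cast h2
    rw [div_lt_div_iff₀ h2' (by positivity)] at h1
    linarith
  have lo : ∀ (ω : ℤ → unitInterval) (k : ℕ) (f : ℕ → ℤ), Tendsto (fun n : ℕ => (∑ q ∈ Finset.range n, if ((ω (f q) : unitInterval) : ℝ) < 1 / ((k : ℝ) + 1) then (1 : ℝ) else 0) / n)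
      atTop (𝓝 (1 / ((k : ℝ) + 1))) → ∃ q, ((ω (f q) : unitInterval) : ℝ) < 1 / ((k : ℝ) + 1) := by
    intro ω k f h
    by_contra hc
    push Not at hc
    have : (fun n : ℕ => (∑ q ∈ Finset.range n, if ((ω (f q) : unitInterval) : ℝ) < 1 / ((k : ℝ) + 1) then (1 : ℝ) else 0) / n)
      = fun _ => 0 := by
      funext n
      rw [Finset.sum_eq_zero, zero_div]
      intro q _
      rw [if_neg (not_lt.2 (hc q))]
    rw [this] at h
    have := tendsto_nhds_unique h tendsto_const_nhds
    have : (0 : ℝ) < 1 / ((k : ℝ) + 1) := by positivity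
    linarith
  have b1 : ∀ᵐ ω ∂Pr, ∀ i : ℤ, Tendsto _ _ _ :=
    ae_all_iff.2 fun i : ℤ => slln e0.le (by linarith) _ (inj1 i)
  have b2 : ∀ᵐ ω ∂Pr, ∀ i : ℤ, Tendsto _ _ _ :=
    ae_all_iff.2 fun i : ℤ => slln e0.le (by linarith) _ (inj2 i)
  have kk : ∀ k : ℕ, 1 / ((k : ℝ) + 1) ≤ 1 := fun k => by
    rw [div_le_one (by positivity)]; linarith [(Nat.cast_nonneg k : (0 : ℝ) ≤ k)]
  have b3 : ∀ᵐ ω ∂Pr, ∀ k : ℕ, ∀ i : ℤ, Tendsto _ _ _ :=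
    ae_all_iff.2 fun k => ae_all_iff.2 fun i : ℤ => slln (ε := 1 / ((k : ℝ) + 1)) (by positivity) (kk k) _ (inj1 i)
  have b4 : ∀ᵐ ω ∂Pr, ∀ k : ℕ, ∀ i : ℤ, Tendsto _ _ _ :=
    ae_all_iff.2 fun k => ae_all_iff.2 fun i : ℤ => slln (ε := 1 / ((k : ℝ) + 1)) (by positivity) (kk k) _ (inj2 i)
  filter_upwards [b1, b2, b3, b4, ae_all_iff.2 ae_pos] with ω c1 c2 c3 c4 c5
  refine ⟨fun i => ?_, fun i => ?_, fun k i => ?_, fun k i => ?_, c5⟩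
  · filter_upwards [up _ (c1 i)] with n hn
    have : (cnt (YY (eps0 P D) 1 ω) i n : ℝ) = ∑ k ∈ Finset.range n, if ((ω (i + k) : unitInterval) : ℝ) < eps0 P D then (1 : ℝ) else 0 := by
      rw [cnt_sum]; push_cast
      refine Finset.sum_congr rfl fun k _ => ?_
      simp only [YY_ne_zero]
    rw [← this] at hn
    exact_mod_cast hn
  · filter_upwards [up _ (c2 i)] with n hn
    have : (cnt (YY (eps0 P D) 1 ω) (i - n) n : ℝ) = ∑ k ∈ Finset.range n, if ((ω (i - 1 - k) : unitInterval) : ℝ) < eps0 P D then (1 : ℝ) else 0 := by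
      rw [cnt_sum, ← Finset.sum_range_reflect]; push_cast
      refine Finset.sum_congr rfl fun k hk => ?_
      have hk := Finset.mem_range.1 hk
      simp only [YY_ne_zero]
      rw [show i - (n : ℤ) + ((n - 1 - k : ℕ) : ℤ) = i - 1 - k by omega]
    rw [← this] at hn
    exact_mod_cast hn
  · obtain ⟨q, hq⟩ := lo ω k _ (c3 k i)
    exact ⟨_, by omega, hq⟩
  · obtain ⟨q, hq⟩ := lo ω k _ (c4 k i)
    exact ⟨_, by omega, hq⟩

lemma ae_good (hP : 0 < P) (hD : 0 < D) {ε s : ℝ} (h0 : 0 < ε) (h1 : ε ≤ eps0 P D) :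
    ∀ᵐ y ∂(bern (mm ε s)), Good P D y := by
  rw [← map_YY, ae_map_iff (measurable_YY ε s).aemeasurable (measurable_good P D)]
  filter_upwards [ae_OGood hP hD] with ω hω
  exact hω.good h0 h1

end Coupling


section words
variable {E : Type*} [MeasurableSpace E] [MeasurableSingletonClass E] (m : Measure E) [IsProbabilityMeasure m]

lemma bern_word (n : ℕ) (j : ℤ) (w : ℕ → E) (H : Set (ℤ → E)) (hH : MeasurableSet H)
    (hdep : ∀ y y' : ℤ → E, (∀ i, j + n ≤ i → y i = y' i) → y ∈ H → y' ∈ H) :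
    bern m ({y | ∀ i : ℕ, i < n → y (j + i) = w i} ∩ H) = (∏ i ∈ Finset.range n, m {w i}) * bern m H := by
  induction n with
  | zero => simp
  | succ n ih =>
    have e : ({y : ℤ → E | ∀ i : ℕ, i < n + 1 → y (j + i) = w i} ∩ H) =
        ({y | ∀ i : ℕ, i < n → y (j + i) = w i} ∩ H) ∩ {y | y (j + n) ∈ ({w n} : Set E)} := by
      ext y
      simp only [Set.mem_inter_iff, Set.mem_ofPred_eq, Set.mem_singleton_iff]
      constructor
      · rintro ⟨h1, h2⟩
        exact ⟨⟨fun i hi => h1 i (by omega), h2⟩, h1 n (by omega)⟩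
      · rintro ⟨⟨h1, h2⟩, h3⟩
        refine ⟨fun i hi => ?_, h2⟩
        rcases Nat.lt_succ_iff_lt_or_eq.1 hi with h | rfl
        · exact h1 i h
        · exact h3
    have hm : MeasurableSet {y : ℤ → E | ∀ i : ℕ, i < n → y (j + i) = w i} := by
      have : {y : ℤ → E | ∀ i : ℕ, i < n → y (j + i) = w i} =
          ⋂ i : ℕ, ⋂ _ : i < n, (fun y : ℤ → E => y (j + i)) ⁻¹' {w i} := by ext; simp
      rw [this]
      exact .iInter fun i => .iInter fun _ => measurable_pi_apply _ (measurableSet_singleton _)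
    rw [e, indep_update m (j + n) _ (hm.inter hH) _ (measurableSet_singleton _), ih, Finset.prod_range_succ]
    · ring
    · intro y y' h
      exact hdep y y' (fun i hi => h i (by push_cast at hi; omega))
    · intro y y' h
      rintro ⟨h1, h2⟩
      refine ⟨fun i hi => ?_, hdep y y' (fun i hi => h i (by push_cast at hi; omega)) h2⟩
      rw [← h _ (by omega)]
      exact h1 i hi
end words

lemma busy_tr {D : ℕ} (y : ℤ → Fin 3) (c i : ℤ) : Busy D (fun j => y (j + c)) i ↔ Busy D y (i + c) := by
  unfold Busy
  have : ∀ n, cnt (fun j => y (j + c)) i n = cnt y (i + c) n := by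
    intro n
    apply cntP_congr
    intro k _
    change y (i + k + c) ≠ 0 ↔ _
    rw [show i + (k : ℤ) + c = i + c + k by ring]
  simp only [this]

lemma idle_pos {P D : ℕ} (hP : 0 < P) (hD : 0 < D) (m : Measure (Fin 3)) [IsProbabilityMeasure m]
    (hg : ∀ᵐ y ∂(bern m), Good P D y) (i : ℤ) : 0 < bern m {y | ¬ Busy D y i} := by
  have h1 : ∃ j : ℤ, bern m {y | ¬ Busy D y j} ≠ 0 := by
    by_contra hc
    push Not at hc
    have : ∀ᵐ y ∂(bern m), ∀ j, Busy D y j := by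
      rw [ae_all_iff]; intro j; rw [ae_iff]; exact hc j
    obtain ⟨y, hy, hy'⟩ := (hg.and this).exists
    obtain ⟨j, _, hj⟩ := hy.idle_above hP hD 0
    exact hj (hy' j)
  obtain ⟨j, hj⟩ := h1
  have h2 := (mp_reindex m (fun k => k + (i - j)) (fun a b h => by simpa using h)).measure_preimage
    (measurable_busy D j).compl.nullMeasurableSet
  have e : (fun (y : ℤ → Fin 3) k => y (k + (i - j))) ⁻¹' {y | Busy D y j}ᶜ = {y | ¬ Busy D y i} := by
    ext y
    simp only [Set.mem_preimage, Set.mem_compl_iff, Set.mem_ofPred_eq, busy_tr]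
    rw [show j + (i - j) = i by ring]
  rw [e] at h2
  rw [h2]
  exact pos_iff_ne_zero.2 hj

namespace BSys
variable {t : ℕ} {A : Fin t → Fin t → Bool} (S : BSys A)

/-- the law -/
noncomputable def Law (ε s : ℝ) : ProbabilityMeasure ↥(SigmaA A) :=
  ⟨Measure.map S.psi (bern (mm ε s)), Measure.isProbabilityMeasure_map S.measurable_psi.aemeasurable⟩

lemma Law_coe (ε s : ℝ) : (S.Law ε s).toMeasure = Measure.map S.psi (bern (mm ε s)) := rfl

lemma mp_Law {ε s : ℝ} (h0 : 0 < ε) (h1 : ε ≤ eps0 S.P S.D) :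
    MeasurePreserving (shiftA A) (S.Law ε s).toMeasure (S.Law ε s).toMeasure := by
  refine ⟨measurable_shiftA A, ?_⟩
  rw [Law_coe, Measure.map_map (measurable_shiftA A) S.measurable_psi]
  have : shiftA A ∘ S.psi =ᵐ[bern (mm ε s)] S.psi ∘ shift := by
    filter_upwards [ae_good S.hP S.hD h0 h1] with y hy
    exact (S.psi_shift hy).symm
  rw [Measure.map_congr this, ← Measure.map_map S.measurable_psi measurable_shift, (mp_shift _).map_eq]

lemma ergodic_Law {ε s : ℝ} (h0 : 0 < ε) (h1 : ε ≤ eps0 S.P S.D) :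
    Ergodic (shiftA A) (S.Law ε s).toMeasure := by
  refine ⟨S.mp_Law h0 h1, ⟨fun {V} hV hinv => ?_⟩⟩
  have hG := ae_good (s := s) S.hP S.hD h0 h1
  have e : shift ⁻¹' (S.psi ⁻¹' V) =ᵐ[bern (mm ε s)] S.psi ⁻¹' V := by
    filter_upwards [hG] with y hy
    have : (S.psi (shift y) ∈ V) = (S.psi y ∈ V) := by
      rw [S.psi_shift hy]
      exact congrFun hinv (S.psi y)
    exact this
  have h2 := (ergodic_bern (mm ε s)).quasiErgodic.ae_empty_or_univ₀ (S.measurable_psi hV).nullMeasurableSet e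
  rw [eventuallyConst_set', Law_coe]
  rcases h2 with h2 | h2
  · left
    rw [ae_eq_empty] at h2 ⊢
    rwa [Measure.map_apply S.measurable_psi hV]
  · right
    rw [ae_eq_univ] at h2 ⊢
    rwa [Measure.map_apply S.measurable_psi hV.compl]

lemma fullSupp_Law {ε s : ℝ} (h0 : 0 < ε) (h1 : ε ≤ eps0 S.P S.D) (hs0 : 0 ≤ s) (hs : s < 1) :
    FullSupp (S.Law ε s) := by
  intro V hV ⟨x, hx⟩
  have hG := ae_good (s := s) S.hP S.hD h0 h1
  have he := eps0_le S.hP S.hD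
  have m0 : mm ε s {0} ≠ 0 := by
    intro h
    have h2 := prob_compl_eq_one_sub (μ := mm ε s) (MeasurableSet.of_discrete (s := {a : Fin 3 | a ≠ 0}))
    rw [mm_ne_zero h0.le (by linarith)] at h2
    rw [show ({a : Fin 3 | a ≠ 0}ᶜ) = {0} by ext; simp, h] at h2
    have : (1 : ℝ≥0∞) ≤ ENNReal.ofReal ε := tsub_eq_zero_iff_le.1 h2.symm
    rw [ENNReal.one_le_ofReal] at this
    linarith
  have m1 : mm ε s {1} ≠ 0 := by
    intro h
    have h2 : mm ε s {a | a ≠ 0} ≤ mm ε s {1} + mm ε s {2} := by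
      refine le_trans (measure_mono ?_) (measure_union_le _ _)
      intro a ha
      have : a ≠ 0 := ha
      revert this; revert a; simp; decide
    rw [mm_ne_zero h0.le (by linarith), h, zero_add, mm_two h0.le (by linarith) hs0 hs.le,
      ENNReal.ofReal_le_ofReal_iff (by positivity)] at h2
    nlinarith
  obtain ⟨N, hN⟩ := nhds_cyl A (hV.mem_nhds hx)
  set u : List (Fin t) := (List.range (2 * N + 1)).map (fun k : ℕ => x.1 ((k : ℤ) - N)) with hu
  have hul : u.length = 2 * N + 1 := by simp [hu]
  have huc : List.IsChain (fun a b => A a b = true) u := by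
    rw [List.isChain_iff_getElem]
    intro i hi
    simp only [hu, List.getElem_map, List.getElem_range]
    have := x.2 ((i : ℤ) - N)
    rwa [show ((i : ℤ) - N) + 1 = ((i + 1 : ℕ) : ℤ) - N by push_cast; ring] at this
  obtain ⟨k, hk1, hk⟩ := S.full u huc
  let w : ℕ → Fin 3 := fun i => if i < k * S.D - k + 1 then 0 else 1
  have hpos : 0 < bern (mm ε s) ({y | ∀ i : ℕ, i < k * S.D + 1 → y (-1 + i) = w i} ∩
      {y | ¬ Busy S.D y ((k * S.D : ℕ) : ℤ)}) := by
    rw [bern_word]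
    · refine ENNReal.mul_pos ?_ (idle_pos S.hP S.hD _ hG _).ne'
      rw [Finset.prod_ne_zero_iff]
      intro i _
      simp only [w]
      split_ifs
      · exact m0
      · exact m1
    · exact (measurable_busy _ _).compl
    · intro y y' h
      have : ∀ n, cnt y ((k * S.D : ℕ) : ℤ) n = cnt y' ((k * S.D : ℕ) : ℤ) n := by
        intro n
        apply cntP_congr
        intro q _
        rw [h _ (by push_cast; omega)]
      simp only [Set.mem_ofPred_eq, Busy, this]
      exact id
  have hmp := S.mp_Law (s := s) h0 h1
  have hcov : 0 < (S.Law ε s).toMeasure (⋃ n : ℕ, (shiftA A)^[n] ⁻¹' V) := by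
    rw [Law_coe, Measure.map_apply S.measurable_psi
      (.iUnion fun n => ((measurable_shiftA A).iterate n) hV.measurableSet)]
    refine lt_of_lt_of_le hpos (measure_mono_ae ?_)
    filter_upwards [hG] with y hy
    rintro ⟨hw, hi⟩
    have hkD : k ≤ k * S.D := Nat.le_mul_of_pos_right _ S.hD
    have hw' : ∀ i : ℕ, i < k * S.D → y i = w (i + 1) := by
      intro i hi
      have := hw (i + 1) (by omega)
      rwa [show (-1 : ℤ) + ((i + 1 : ℕ) : ℤ) = i by push_cast; ring] at this
    have hr : Run S.D y 0 (k * S.D) := by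
      refine run_of_word S.hD hk1 ?_ ?_ ?_ hi
      · have := hw 0 (by omega)
        simpa [w] using this
      · intro i hi
        rw [hw' i (by omega)]; simp only [w]; rw [if_pos (by omega)]
      · intro i hi hi'
        rw [hw' i hi']; simp only [w]; rw [if_neg (by omega)]
    obtain ⟨b, j, hbj⟩ := S.ctx_orb y 0
    obtain ⟨r, hr'⟩ := hk b j (pat y 0 (k * S.D)) (hr.valid S.hD)
    refine Set.mem_iUnion.2 ⟨r + N, ?_⟩
    apply hN
    intro i hi
    rw [abs_le] at hi
    rw [shiftA_iter, S.psi_good hy]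
    obtain ⟨q, hq⟩ : ∃ q : ℕ, (q : ℤ) = i + N := ⟨(i + N).toNat, by omega⟩
    obtain ⟨a1, a2⟩ := hr' q (by omega)
    have a3 := S.psi0_run hr a1
    rw [hbj] at a3
    rw [show i + ((r + N : ℕ) : ℤ) = 0 + ((r + q : ℕ) : ℤ) by push_cast; omega, a3]
    have a4 : u[q]? = some (x.1 ((q : ℤ) - N)) := by
      simp only [hu, List.getElem?_map]
      rw [List.getElem?_range (by omega)]
      rfl
    rw [a4] at a2
    have := Option.some.inj a2
    rw [← this, show (q : ℤ) - N = i by omega]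
  obtain ⟨n, hn⟩ : ∃ n : ℕ, (S.Law ε s).toMeasure ((shiftA A)^[n] ⁻¹' V) ≠ 0 := by
    by_contra hc
    push Not at hc
    rw [measure_iUnion_null hc] at hcov
    exact lt_irrefl _ hcov
  rw [(hmp.iterate n).measure_preimage hV.measurableSet.nullMeasurableSet] at hn
  exact pos_iff_ne_zero.2 hn

lemma exists_linv : ∃ φ : ↥(SigmaA A) → (ℤ → Fin 3), Measurable φ ∧
    ∀ y, Good S.P S.D y → φ (S.psi y) = y := by
  have hG := measurable_good S.P S.D
  have : StandardBorelSpace ↥{y : ℤ → Fin 3 | Good S.P S.D y} := hG.standardBorel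
  have hm : Measurable (fun y : ↥{y : ℤ → Fin 3 | Good S.P S.D y} => S.psi y) :=
    S.measurable_psi.comp measurable_subtype_coe
  have hemb : MeasurableEmbedding (fun y : ↥{y : ℤ → Fin 3 | Good S.P S.D y} => S.psi y) :=
    hm.measurableEmbedding (fun y y' h => Subtype.ext (S.psi_inj y.2 y'.2 h))
  obtain ⟨φ, h1, h2⟩ := hemb.exists_measurable_extend measurable_subtype_coe (fun _ => ⟨fun _ => 0⟩)
  exact ⟨φ, h1, fun y hy => congrFun h2 ⟨y, hy⟩⟩

lemma Law_inj {ε s ε' s' : ℝ} (h0 : 0 < ε) (h1 : ε ≤ eps0 S.P S.D) (hs : 0 ≤ s) (hs1 : s ≤ 1)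
    (h0' : 0 < ε') (h1' : ε' ≤ eps0 S.P S.D) (hs' : 0 ≤ s') (hs1' : s' ≤ 1)
    (h : S.Law ε s = S.Law ε' s') : s = s' := by
  obtain ⟨φ, hφ, hφ'⟩ := S.exists_linv
  have he := eps0_le S.hP S.hD
  have key : ∀ ε s, 0 < ε → ε ≤ eps0 S.P S.D → Measure.map φ (S.Law ε s).toMeasure = bern (mm ε s) := by
    intro ε s h0 h1
    rw [Law_coe, Measure.map_map hφ S.measurable_psi]
    have : φ ∘ S.psi =ᵐ[bern (mm ε s)] id := by
      filter_upwards [ae_good S.hP S.hD h0 h1] with y hy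
      exact hφ' y hy
    rw [Measure.map_congr this, Measure.map_id]
  have e : bern (mm ε s) = bern (mm ε' s') := by rw [← key _ _ h0 h1, ← key _ _ h0' h1', h]
  have e1 : mm ε s {a | a ≠ 0} = mm ε' s' {a | a ≠ 0} := by
    rw [← bern_eval (mm ε s) 0 _ MeasurableSet.of_discrete, e, bern_eval _ 0 _ MeasurableSet.of_discrete]
  have e2 : mm ε s {2} = mm ε' s' {2} := by
    rw [← bern_eval (mm ε s) 0 _ MeasurableSet.of_discrete, e, bern_eval _ 0 _ MeasurableSet.of_discrete]
  rw [mm_ne_zero h0.le (by linarith), mm_ne_zero h0'.le (by linarith),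
    ENNReal.ofReal_eq_ofReal_iff h0.le h0'.le] at e1
  rw [mm_two h0.le (by linarith) hs hs1, mm_two h0'.le (by linarith) hs' hs1',
    ENNReal.ofReal_eq_ofReal_iff (by positivity) (by positivity)] at e2
  subst e1
  exact mul_left_cancel₀ h0.ne' e2

lemma isBernoulli_Law {ε s : ℝ} (h0 : 0 < ε) (h1 : ε ≤ eps0 S.P S.D) :
    IsBernoulli (shiftA A) (S.Law ε s).toMeasure := by
  have hG := ae_good (s := s) S.hP S.hD h0 h1
  let m' : Measure ℕ := Measure.map Fin.val (mm ε s)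
  have hv : Measurable (Fin.val : Fin 3 → ℕ) := measurable_of_finite _
  have : IsProbabilityMeasure m' := Measure.isProbabilityMeasure_map hv.aemeasurable
  let ι : (ℤ → Fin 3) → (ℤ → ℕ) := fun y i => (y i : ℕ)
  let τ : (ℤ → ℕ) → (ℤ → Fin 3) := fun y i => Fin.ofNat 3 (y i)
  have hι : Measurable ι := measurable_pi_lambda _ fun i => hv.comp (measurable_pi_apply i)
  have hτ : Measurable τ := measurable_pi_lambda _ fun i =>
    (measurable_from_nat (f := Fin.ofNat 3)).comp (measurable_pi_apply i)
  have hτι : ∀ y, τ (ι y) = y := by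
    intro y; funext i; simp [τ, ι]
  have hmap : Measure.map ι (bern (mm ε s)) = bern m' := by
    unfold bern
    exact Measure.infinitePi_map_pi (fun _ : ℤ => mm ε s) (fun _ => hv)
  obtain ⟨φ, hφ, hφ'⟩ := S.exists_linv
  refine ⟨fun n => m' {n}, bern m', ?_, inferInstance, ?_, ι ∘ φ, S.psi ∘ τ, hι.comp hφ,
    S.measurable_psi.comp hτ, ?_, ?_, ?_, ?_, ?_⟩
  · have := Measure.tsum_indicator_apply_singleton m' Set.univ MeasurableSet.univ
    simpa using this
  · intro n w j
    have := bern_word m' n j (fun i => if h : i < n then w ⟨i, h⟩ else 0) Set.univ MeasurableSet.univ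
      (fun _ _ _ _ => trivial)
    rw [Set.inter_univ, measure_univ, mul_one, Finset.prod_range] at this
    convert this using 2
    · ext y
      simp only [Set.mem_ofPred_eq]
      constructor
      · intro h i hi; rw [dif_pos hi]; exact h ⟨i, hi⟩
      · intro h i; have := h i i.2; rwa [dif_pos i.2] at this
    · rename_i i _
      simp
  · rw [Law_coe, Measure.map_map (hι.comp hφ) S.measurable_psi, ← hmap]
    apply Measure.map_congr
    filter_upwards [hG] with y hy
    simp [hφ' y hy]
  · rw [← hmap, Measure.map_map (S.measurable_psi.comp hτ) hι, Law_coe]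
    congr 1
    funext y
    simp [hτι]
  · rw [Law_coe]
    refine (ae_map_iff S.measurable_psi.aemeasurable
      (measurableSet_eq_fun ((S.measurable_psi.comp hτ).comp (hι.comp hφ)) measurable_id)).2 ?_
    filter_upwards [hG] with y hy
    simp [hφ' y hy, hτι]
  · rw [← hmap]
    refine (ae_map_iff hι.aemeasurable
      (measurableSet_eq_fun ((hι.comp hφ).comp (S.measurable_psi.comp hτ)) measurable_id)).2 ?_
    filter_upwards [hG] with y hy
    simp [hφ' y hy, hτι]
  · rw [Law_coe]
    refine (ae_map_iff S.measurable_psi.aemeasurable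
      (measurableSet_eq_fun ((hι.comp hφ).comp (measurable_shiftA A)) (measurable_shift.comp (hι.comp hφ)))).2 ?_
    filter_upwards [hG] with y hy
    simp only [Function.comp_apply]
    rw [← S.psi_shift hy, hφ' _ (good_shift hy), hφ' _ hy]
    rfl

end BSys


lemma sum_periodic {P : ℕ} (h : ℕ → ℝ) (hp : ∀ i, h (i + P) = h i) (j : ℕ) :
    ∑ i ∈ Finset.range P, h (i + j) = ∑ i ∈ Finset.range P, h i := by
  induction j with
  | zero => rfl
  | succ j ih =>
    rw [← ih]
    have h1 := Finset.sum_range_succ (fun i => h (i + j)) P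
    have h2 := Finset.sum_range_succ' (fun i => h (i + j)) P
    simp only [zero_add] at h2
    rw [add_comm P j, hp] at h1
    have h3 : ∀ i, h (i + (j + 1)) = h (i + 1 + j) := fun i => by congr 1; ring
    simp only [h3]
    linarith

namespace BSys
variable {t : ℕ} {A : Fin t → Fin t → Bool} (S : BSys A)

lemma integral_Law (ε s : ℝ) (f : BoundedContinuousFunction ↥(SigmaA A) ℝ) :
    ∫ x, f x ∂(S.Law ε s).toMeasure = ∫ ω, f (S.psi (YY ε s ω)) ∂Pr := by
  rw [Law_coe, ← map_YY, Measure.map_map S.measurable_psi (measurable_YY ε s),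
    integral_map (S.measurable_psi.comp (measurable_YY ε s)).aemeasurable f.continuous.aestronglyMeasurable]
  rfl

lemma Law_cont {ε s : ℝ} (h0 : 0 < ε) (h1 : ε ≤ eps0 S.P S.D) (f : BoundedContinuousFunction ↥(SigmaA A) ℝ) :
    Tendsto (fun p : ℝ × ℝ => ∫ x, f x ∂(S.Law p.1 p.2).toMeasure)
      (𝓝[{p | 0 < p.1 ∧ p.1 ≤ eps0 S.P S.D}] (ε, s)) (𝓝 (∫ x, f x ∂(S.Law ε s).toMeasure)) := by
  simp only [integral_Law]
  refine tendsto_integral_filter_of_dominated_convergence (fun _ => ‖f‖) ?_ ?_ (integrable_const _) ?_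
  · filter_upwards with p
    exact (f.continuous.measurable.comp (S.measurable_psi.comp (measurable_YY _ _))).aestronglyMeasurable
  · filter_upwards with p
    filter_upwards with ω
    exact f.norm_coe_le_norm _
  · filter_upwards [ae_OGood S.hP S.hD, ae_all_iff.2 fun i => ae_ne i ε, ae_all_iff.2 fun i => ae_ne i (ε * s)]
      with ω hω hne hne'
    refine (f.continuous.tendsto _).comp ?_
    rw [tendsto_subtype_rng, tendsto_pi_nhds]
    intro i
    apply tendsto_nhds_of_eventually_eq
    have hR : ∀ᶠ p : ℝ × ℝ in 𝓝[{p | 0 < p.1 ∧ p.1 ≤ eps0 S.P S.D}] (ε, s), 0 < p.1 ∧ p.1 ≤ eps0 S.P S.D :=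
      eventually_mem_nhdsWithin
    have hc : ∀ i, ∀ᶠ p : ℝ × ℝ in 𝓝[{p | 0 < p.1 ∧ p.1 ≤ eps0 S.P S.D}] (ε, s), YY p.1 p.2 ω i = YY ε s ω i := by
      intro i
      apply Filter.Eventually.filter_mono nhdsWithin_le_nhds
      have c1 : Tendsto (fun p : ℝ × ℝ => p.1) (𝓝 (ε, s)) (𝓝 ε) := continuous_fst.tendsto _
      have c2 : Tendsto (fun p : ℝ × ℝ => p.1 * p.2) (𝓝 (ε, s)) (𝓝 (ε * s)) :=
        (continuous_fst.mul continuous_snd).tendsto _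
      have d1 : ∀ᶠ p : ℝ × ℝ in 𝓝 (ε, s), (p.1 ≤ (ω i : ℝ) ↔ ε ≤ (ω i : ℝ)) := by
        rcases lt_or_gt_of_ne (hne i) with h | h
        · filter_upwards [c1.eventually (lt_mem_nhds h)] with p hp
          constructor <;> intro <;> linarith
        · filter_upwards [c1.eventually (gt_mem_nhds h)] with p hp
          constructor <;> intro <;> linarith
      have d2 : ∀ᶠ p : ℝ × ℝ in 𝓝 (ε, s), ((ω i : ℝ) < p.1 * p.2 ↔ (ω i : ℝ) < ε * s) := by
        rcases lt_or_gt_of_ne (hne' i) with h | h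
        · filter_upwards [c2.eventually (lt_mem_nhds h)] with p hp
          constructor <;> intro <;> linarith
        · filter_upwards [c2.eventually (gt_mem_nhds h)] with p hp
          constructor <;> intro <;> linarith
      filter_upwards [d1, d2] with p e1 e2
      simp only [YY, col, e1, e2]
    have := S.psi0_tendsto (fun p : ℝ × ℝ => YY p.1 p.2 ω) (YY ε s ω) (YY (eps0 S.P S.D) 1 ω) hω.1
      (by
        filter_upwards [hR] with p hp i
        rw [YY_ne_zero, YY_ne_zero]; intro; linarith)
      (by intro i; rw [YY_ne_zero, YY_ne_zero]; intro; linarith) hc (hω.good h0 h1) i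
    filter_upwards [this, hR] with p hp hp'
    rw [S.psi_good (hω.good hp'.1 hp'.2), S.psi_good (hω.good h0 h1), hp]

lemma z_per (b : Bool) (n : ℤ) : ∀ i, S.z b (i + n * S.P) = S.z b i := by
  induction n using Int.induction_on with
  | zero => intro i; simp
  | succ n ih => intro i; rw [show i + ((n : ℤ) + 1) * S.P = i + n * S.P + S.P by ring, S.hper, ih]
  | pred n ih => intro i; rw [← S.hper, show i + (-(n : ℤ) - 1) * S.P + S.P = i + -(n : ℤ) * S.P by ring, ih]

lemma tr_mod (b : Bool) (q : ℤ) : ∃ j : ℕ, j < S.P ∧ tr q (S.z b) = tr j (S.z b) := by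
  have hP := S.hP
  have h1 := Int.emod_nonneg q (show (S.P : ℤ) ≠ 0 by omega)
  have h2 := Int.emod_lt_of_pos q (show (0 : ℤ) < S.P by omega)
  have h3 := Int.emod_add_mul_ediv q S.P
  refine ⟨(q % S.P).toNat, by omega, ?_⟩
  funext i
  simp only [tr, Int.toNat_of_nonneg h1]
  rw [← S.z_per b (q / S.P) (i + q % S.P)]
  congr 1
  linarith

/-- base points -/
def zp (b : Bool) : ↥(SigmaA A) := ⟨S.z b, S.hz b⟩

/-- orbit averages -/
noncomputable def avg (f : ↥(SigmaA A) → ℝ) (x : ↥(SigmaA A)) : ℝ :=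
  (∑ j ∈ Finset.range S.P, f ((shiftA A)^[j] x)) / S.P

lemma avg_orb (f : ↥(SigmaA A) → ℝ) (b : Bool) (j : ℕ) :
    S.avg f ((shiftA A)^[j] (S.zp b)) = S.avg f (S.zp b) := by
  unfold avg
  congr 1
  have := sum_periodic (P := S.P) (fun i => f ((shiftA A)^[i] (S.zp b))) (by
    intro i
    congr 1
    apply Subtype.ext
    funext k
    rw [shiftA_iter, shiftA_iter]
    simp only [zp]
    rw [← S.hper b (k + i)]
    congr 1; push_cast; ring) j
  rw [← this]
  refine Finset.sum_congr rfl fun i _ => ?_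
  rw [Function.iterate_add_apply]

lemma avg_cont (f : BoundedContinuousFunction ↥(SigmaA A) ℝ) : Continuous (S.avg f) := by
  unfold avg
  refine Continuous.div_const ?_ _
  exact continuous_finsetSum _ fun j _ => f.continuous.comp ((continuous_shiftA A).iterate j)

lemma avg_bdd (f : BoundedContinuousFunction ↥(SigmaA A) ℝ) (x) : |S.avg f x| ≤ ‖f‖ := by
  have hP : (0 : ℝ) < S.P := by exact_mod_cast S.hP
  unfold avg
  rw [abs_div, abs_of_pos hP, div_le_iff₀ hP]
  refine (Finset.abs_sum_le_sum_abs _ _).trans ?_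
  refine (Finset.sum_le_sum (fun j _ => f.norm_coe_le_norm _)).trans ?_
  simp [mul_comm]

lemma integral_avg (f : BoundedContinuousFunction ↥(SigmaA A) ℝ) (ν : Measure ↥(SigmaA A)) [IsProbabilityMeasure ν]
    (hν : MeasurePreserving (shiftA A) ν ν) : ∫ x, S.avg f x ∂ν = ∫ x, f x ∂ν := by
  have hP : (0 : ℝ) < S.P := by exact_mod_cast S.hP
  have h1 : ∀ j : ℕ, ∫ x, f ((shiftA A)^[j] x) ∂ν = ∫ x, f x ∂ν := by
    intro j
    have := integral_map (μ := ν) (hν.iterate j).measurable.aemeasurable (f := f) f.continuous.aestronglyMeasurable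
    rw [(hν.iterate j).map_eq] at this
    exact this.symm
  unfold avg
  rw [integral_div, integral_finsetSum]
  · simp only [h1]
    simp
    field_simp
  · intro j _
    exact (f.compContinuous ⟨_, (continuous_shiftA A).iterate j⟩).integrable ν

/-- idle on a window before zero -/
def Gn (n : ℕ) : Set (ℤ → Fin 3) := {y | ∀ k : ℕ, k ≤ n → ¬ Busy S.D y (-k)}

lemma meas_Gn (n : ℕ) : MeasurableSet (S.Gn n) := by
  have : S.Gn n = ⋂ k : ℕ, ⋂ _ : k ≤ n, {y | Busy S.D y (-k)}ᶜ := by ext; simp [Gn]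
  rw [this]
  exact .iInter fun k => .iInter fun _ => (measurable_busy _ _).compl

/-- last colour is two -/
def Hc (C : Set (Fin 3)) : Set (ℤ → Fin 3) := ⋃ n : ℕ, S.Gn n ∩ {y | y (-1 - n) ∈ C}

lemma meas_Hc (C : Set (Fin 3)) : MeasurableSet (S.Hc C) :=
  .iUnion fun n => (S.meas_Gn n).inter (measurable_pi_apply _ MeasurableSet.of_discrete)

lemma Hc_prob (m : Measure (Fin 3)) [IsProbabilityMeasure m] (C : Set (Fin 3)) (hC : ∀ a ∈ C, a ≠ 0) :
    bern m (S.Hc C) = (∑' n, bern m (S.Gn n)) * m C := by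
  unfold Hc
  rw [measure_iUnion, ← ENNReal.tsum_mul_right]
  · congr 1
    funext n
    rw [indep_update m (-1 - n) (S.Gn n) (S.meas_Gn n) C MeasurableSet.of_discrete]
    intro y y' h hy k hk
    have : ∀ q, cnt y (-k) q = cnt y' (-k) q := by
      intro q
      apply cntP_congr
      intro r _
      rw [h _ (by omega)]
    have h2 := hy k hk
    unfold Busy at h2 ⊢
    simpa only [this] using h2
  · have key : ∀ a b : ℕ, a < b → Disjoint (S.Gn a ∩ {y | y (-1 - a) ∈ C}) (S.Gn b ∩ {y | y (-1 - b) ∈ C}) := by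
      intro a b hab
      rw [Set.disjoint_left]
      rintro y ⟨_, h1⟩ ⟨h2, _⟩
      have h3 := h2 (a + 1) (by omega)
      rw [show (-((a + 1 : ℕ) : ℤ)) = -1 - a by push_cast; ring] at h3
      exact h3 (mark_busy S.hD (hC _ h1))
    intro a b hab
    rcases lt_or_gt_of_ne hab with h | h
    · exact key a b h
    · exact (key b a h).symm
  · exact fun n => (S.meas_Gn n).inter (measurable_pi_apply _ MeasurableSet.of_discrete)

/-- main structural fact for idle windows -/
lemma idle_window {y : ℤ → Fin 3} (hy : Good S.P S.D y) (N : ℕ) (hN : ∀ i : ℤ, |i| ≤ N → ¬ Busy S.D y i) :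
    ∃ q : ℤ, ∃ b : Bool, (b = true ↔ y ∈ S.Hc {2}) ∧ ∀ i : ℤ, |i| ≤ N → S.psi0 y i = tr q (S.z b) i := by
  have hz := hN 0 (by simp)
  obtain ⟨n, h1, h2⟩ := hy.prev_busy S.hD 0
  have hG : ∀ k : ℕ, k ≤ n → ¬ Busy S.D y (-k) := by
    intro k hk
    rcases Nat.eq_zero_or_pos k with rfl | hk0
    · simpa using hz
    · have := h2 (k - 1) (by omega)
      rwa [show (0 : ℤ) - 1 - ((k - 1 : ℕ) : ℤ) = -k by omega] at this
  rw [zero_sub] at h1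
  refine ⟨1 + n, ty (y (-1 - n)), ?_, ?_⟩
  · simp only [ty, decide_eq_true_eq, Hc, Set.mem_iUnion]
    constructor
    · intro h; exact ⟨n, hG, h⟩
    · rintro ⟨m, hm, hm'⟩
      have hm' : y (-1 - m) = 2 := hm'
      have : m = n := by
        rcases lt_trichotomy m n with h | h | h
        · have a := hG (m + 1) (by omega)
          rw [show (-((m + 1 : ℕ) : ℤ)) = -1 - m by push_cast; ring] at a
          exact absurd (mark_busy S.hD (by rw [hm']; decide)) a
        · exact h
        · have a := hm (n + 1) (by omega)
          rw [show (-((n + 1 : ℕ) : ℤ)) = -1 - n by push_cast; ring] at a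
          exact absurd h1 a
      rw [← this]; exact hm'
  · have e0 : S.ctx y 0 = tr (1 + n) (S.z (ty (y (-1 - n)))) := by
      rw [S.ctx_of (n := n) (by simpa using h1) h2]; simp
    have e1 := S.ctx_iter hy (i := -N) N (fun k hk => hN _ (by rw [abs_le]; omega))
    rw [neg_add_cancel, e0] at e1
    intro i hi
    rw [abs_le] at hi
    obtain ⟨q, hq⟩ : ∃ q : ℕ, (q : ℤ) = i + N := ⟨(i + N).toNat, by omega⟩
    have e2 := S.ctx_iter hy (i := -N) q (fun k hk => hN _ (by rw [abs_le]; omega))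
    rw [S.psi0_idle (hN i (by rw [abs_le]; omega)), show i = -(N : ℤ) + q by omega, e2, e1]
    simp only [tr]
    congr 1
    omega

end BSys


namespace BSys
variable {t : ℕ} {A : Fin t → Fin t → Bool} (S : BSys A)

lemma ev_idle {ι : Type*} {l : Filter ι} {ε s : ι → ℝ} (hε : Tendsto ε l (𝓝 0))
    (hr : ∀ᶠ k in l, 0 < ε k ∧ ε k ≤ eps0 S.P S.D) {ω : ℤ → unitInterval} (hω : OGood S.P S.D ω) (i : ℤ) :
    ∀ᶠ k in l, ¬ Busy S.D (YY (ε k) (s k) ω) i := by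
  have := busy_tendsto (l := l) (P := S.P) (D := S.D) S.hP (fun k => YY (ε k) (s k) ω) (fun _ => 0)
    (YY (eps0 S.P S.D) 1 ω) hω.1 (by
      filter_upwards [hr] with k hk i
      rw [YY_ne_zero, YY_ne_zero]; intro; linarith) (by intro i h; exact absurd rfl h) (by
      intro i
      filter_upwards [hε.eventually (gt_mem_nhds (hω.2.2.2.2 i))] with k hk
      by_contra hc
      have := (YY_ne_zero _ _ _ _).1 hc
      linarith) i
  filter_upwards [this] with k hk
  rw [hk]
  rintro ⟨n, hn⟩
  rw [cnt, cntP_empty (by simp)] at hn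
  omega

lemma Hc_law {ε s : ℝ} (h0 : 0 < ε) (h1 : ε ≤ eps0 S.P S.D) (hs0 : 0 ≤ s) (hs : s ≤ 1) :
    Pr.real (YY ε s ⁻¹' S.Hc {2}) = s * (1 - Pr.real {ω | Busy S.D (YY ε s ω) 0}) := by
  have he := eps0_le S.hP S.hD
  have hG := ae_good (s := s) S.hP S.hD h0 h1
  have a1 : bern (mm ε s) (S.Hc {2}) = ENNReal.ofReal s * bern (mm ε s) (S.Hc {a | a ≠ 0}) := by
    rw [S.Hc_prob _ _ (by simp), S.Hc_prob _ {a | a ≠ 0} (fun a h => h), mm_two h0.le (by linarith) hs0 hs,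
      mm_ne_zero h0.le (by linarith), ENNReal.ofReal_mul h0.le]
    ring
  have a2 : bern (mm ε s) (S.Hc {a | a ≠ 0}) = bern (mm ε s) {y | Busy S.D y 0}ᶜ := by
    apply measure_congr
    filter_upwards [hG] with y hy
    apply propext
    change y ∈ S.Hc {a | a ≠ 0} ↔ ¬ Busy S.D y 0
    simp only [Hc, Set.mem_iUnion]
    constructor
    · rintro ⟨n, hn, _⟩
      simpa using hn 0 (by omega)
    · intro hz
      obtain ⟨n, b1, b2⟩ := hy.prev_busy S.hD 0
      have hG : ∀ k : ℕ, k ≤ n → ¬ Busy S.D y (-k) := by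
        intro k hk
        rcases Nat.eq_zero_or_pos k with rfl | hk0
        · simpa using hz
        · have := b2 (k - 1) (by omega)
          rwa [show (0 : ℤ) - 1 - ((k - 1 : ℕ) : ℤ) = -k by omega] at this
      refine ⟨n, hG, ?_⟩
      rw [zero_sub] at b1
      exact last_busy b1 (by rw [show (-1 - (n : ℤ)) + 1 = -n by ring]; exact hG n le_rfl)
  have a3 : ∀ W, MeasurableSet W → Pr.real (YY ε s ⁻¹' W) = (bern (mm ε s)).real W := by
    intro W hW
    rw [measureReal_def, measureReal_def, ← map_YY, Measure.map_apply (measurable_YY _ _) hW]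
  rw [a3 _ (S.meas_Hc _)]
  have a4 : Pr.real {ω | Busy S.D (YY ε s ω) 0} = (bern (mm ε s)).real {y | Busy S.D y 0} :=
    a3 _ (measurable_busy _ _)
  rw [a4, ← probReal_compl_eq_one_sub (measurable_busy _ _), measureReal_def, a1, a2, ENNReal.toReal_mul,
    ENNReal.toReal_ofReal hs0]
  rfl

lemma Law_zero {ι : Type*} {l : Filter ι} [l.IsCountablyGenerated] {ε s : ι → ℝ} (hε : Tendsto ε l (𝓝 0))
    (hr : ∀ᶠ k in l, 0 < ε k ∧ ε k ≤ eps0 S.P S.D) (hs : ∀ k, 0 ≤ s k ∧ s k ≤ 1)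
    (f : BoundedContinuousFunction ↥(SigmaA A) ℝ) :
    Tendsto (fun k => ∫ x, f x ∂(S.Law (ε k) (s k)).toMeasure -
      ((1 - s k) * S.avg f (S.zp false) + s k * S.avg f (S.zp true))) l (𝓝 0) := by
  classical
  let c : Bool → ℝ := fun b => S.avg f (S.zp b)
  let c' : (ℤ → Fin 3) → ℝ := fun y => c false + (S.Hc {2}).indicator (fun _ => c true - c false) y
  have hc'm : Measurable c' := measurable_const.add (measurable_const.indicator (S.meas_Hc _))
  have hcb : ∀ b, |c b| ≤ ‖f‖ := fun b => S.avg_bdd f _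
  have hc'b : ∀ y, |c' y| ≤ ‖f‖ := by
    intro y
    simp only [c', Set.indicator_apply]
    split_ifs
    · simpa using hcb true
    · simpa using hcb false
  have gm : ∀ k, Measurable (fun ω => S.avg f (S.psi (YY (ε k) (s k) ω))) := fun k =>
    (S.avg_cont f).measurable.comp (S.measurable_psi.comp (measurable_YY _ _))
  have cm : ∀ k, Measurable (fun ω => c' (YY (ε k) (s k) ω)) := fun k => hc'm.comp (measurable_YY _ _)
  -- first limit
  have L1 : Tendsto (fun k => ∫ ω, (S.avg f (S.psi (YY (ε k) (s k) ω)) - c' (YY (ε k) (s k) ω)) ∂Pr) l (𝓝 0) := by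
    have : (0 : ℝ) = ∫ ω : ℤ → unitInterval, (0 : ℝ) ∂Pr := by simp
    rw [this]
    refine tendsto_integral_filter_of_dominated_convergence (fun _ => ‖f‖ + ‖f‖) ?_ ?_ (integrable_const _) ?_
    · filter_upwards with k
      exact ((gm k).sub (cm k)).aestronglyMeasurable
    · filter_upwards with k
      filter_upwards with ω
      refine (norm_sub_le _ _).trans (add_le_add (S.avg_bdd f _) (hc'b _))
    · filter_upwards [ae_OGood S.hP S.hD] with ω hω
      rw [Metric.tendsto_nhds]
      intro δ hδ
      have hN : ∀ b : Bool, ∀ j : ℕ, ∃ N : ℕ, ∀ x' : ↥(SigmaA A),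
          (∀ i : ℤ, |i| ≤ N → x'.1 i = ((shiftA A)^[j] (S.zp b)).1 i) → |S.avg f x' - c b| < δ := by
        intro b j
        have h1 : ∀ᶠ x in 𝓝 ((shiftA A)^[j] (S.zp b)), |S.avg f x - c b| < δ := by
          have := (S.avg_cont f).tendsto ((shiftA A)^[j] (S.zp b))
          rw [avg_orb] at this
          have := (Metric.tendsto_nhds.1 this) δ hδ
          simpa [Real.dist_eq] using this
        exact nhds_cyl A h1
      choose N hN using hN
      let M : ℕ := ∑ j ∈ Finset.range S.P, (N true j + N false j)
      have hM : ∀ b j, j < S.P → N b j ≤ M := by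
        intro b j hj
        have : N true j + N false j ≤ M :=
          Finset.single_le_sum (f := fun j => N true j + N false j) (fun _ _ => Nat.zero_le _) (Finset.mem_range.2 hj)
        cases b <;> omega
      have hidle : ∀ᶠ k in l, ∀ i ∈ Finset.Icc (-(M : ℤ)) M, ¬ Busy S.D (YY (ε k) (s k) ω) i := by
        rw [Filter.eventually_all_finset]
        intro i _
        exact S.ev_idle hε hr hω i
      filter_upwards [hidle, hr] with k hk hrk
      have hgood := hω.good (s := s k) hrk.1 hrk.2
      obtain ⟨q, b, hb, hw⟩ := S.idle_window hgood M (fun i hi => hk i (Finset.mem_Icc.2 (abs_le.1 hi)))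
      obtain ⟨j, hj, hqj⟩ := S.tr_mod b q
      have key := hN b j (S.psi (YY (ε k) (s k) ω)) (by
        intro i hi
        rw [S.psi_good hgood, hw i (hi.trans (by exact_mod_cast hM b j hj)), hqj, shiftA_iter]
        rfl)
      have : c' (YY (ε k) (s k) ω) = c b := by
        simp only [c', Set.indicator_apply]
        rw [← hb]
        cases b <;> simp
      rw [this, Real.dist_eq, sub_zero]
      exact key
  -- second limit
  have L2 : Tendsto (fun k => Pr.real {ω | Busy S.D (YY (ε k) (s k) ω) 0}) l (𝓝 0) := by
    have hmb : ∀ k, MeasurableSet {ω | Busy S.D (YY (ε k) (s k) ω) 0} := fun k =>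
      measurable_YY _ _ (measurable_busy S.D 0)
    have e : ∀ k, Pr.real {ω | Busy S.D (YY (ε k) (s k) ω) 0} =
        ∫ ω, ({ω | Busy S.D (YY (ε k) (s k) ω) 0}).indicator (fun _ => (1 : ℝ)) ω ∂Pr := by
      intro k
      rw [integral_indicator_const _ (hmb k)]; simp
    simp only [e]
    have : (0 : ℝ) = ∫ ω : ℤ → unitInterval, (0 : ℝ) ∂Pr := by simp
    rw [this]
    refine tendsto_integral_filter_of_dominated_convergence (fun _ => 1) ?_ ?_ (integrable_const _) ?_
    · filter_upwards with k
      exact (measurable_const.indicator (hmb k)).aestronglyMeasurable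
    · filter_upwards with k
      filter_upwards with ω
      rw [Set.indicator_apply]
      split_ifs <;> simp
    · filter_upwards [ae_OGood S.hP S.hD] with ω hω
      apply tendsto_nhds_of_eventually_eq
      filter_upwards [S.ev_idle (s := s) hε hr hω 0] with k hk
      rw [Set.indicator_of_notMem]
      exact hk
  have L3 : Tendsto (fun k => (c true - c false) * (s k * Pr.real {ω | Busy S.D (YY (ε k) (s k) ω) 0})) l (𝓝 0) := by
    rw [← mul_zero (c true - c false)]
    refine Tendsto.const_mul _ ?_
    refine squeeze_zero (fun k => mul_nonneg (hs k).1 measureReal_nonneg) (fun k => ?_) L2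
    exact mul_le_of_le_one_left measureReal_nonneg (hs k).2
  have L4 := L1.sub L3
  rw [sub_zero] at L4
  refine L4.congr' ?_
  filter_upwards [hr] with k hk
  have i1 : ∫ x, f x ∂(S.Law (ε k) (s k)).toMeasure = ∫ ω, S.avg f (S.psi (YY (ε k) (s k) ω)) ∂Pr := by
    rw [← S.integral_avg f _ (S.mp_Law hk.1 hk.2), Law_coe, ← map_YY,
      Measure.map_map S.measurable_psi (measurable_YY _ _),
      integral_map (S.measurable_psi.comp (measurable_YY _ _)).aemeasurable (S.avg_cont f).aestronglyMeasurable]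
    rfl
  have i2 : ∫ ω, c' (YY (ε k) (s k) ω) ∂Pr = c false + Pr.real (YY (ε k) (s k) ⁻¹' S.Hc {2}) * (c true - c false) := by
    have e : (fun ω => c' (YY (ε k) (s k) ω)) = fun ω => c false +
        (YY (ε k) (s k) ⁻¹' S.Hc {2}).indicator (fun _ => c true - c false) ω := by
      funext ω; rfl
    have hms := measurable_YY (ε k) (s k) (S.meas_Hc {2})
    rw [e, integral_add (integrable_const _) ((integrable_const _).indicator hms),
      integral_indicator_const _ hms]
    simp
  rw [integral_sub, ← i1, i2, S.Hc_law hk.1 hk.2 (hs k).1 (hs k).2]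
  · simp only [c]; ring
  · exact Integrable.of_bound (gm k).aestronglyMeasurable ‖f‖ (Eventually.of_forall fun ω => S.avg_bdd f _)
  · exact Integrable.of_bound (cm k).aestronglyMeasurable ‖f‖ (Eventually.of_forall fun ω => hc'b _)

end BSys


section CO
variable {t : ℕ} {A : Fin t → Fin t → Bool}

/-- orbit average over a period -/
noncomputable def oavg (P : ℕ) (f : ↥(SigmaA A) → ℝ) (x : ↥(SigmaA A)) : ℝ :=
  (∑ j ∈ Finset.range P, f ((shiftA A)^[j] x)) / P

lemma oavg_orb {P : ℕ} (f : ↥(SigmaA A) → ℝ) {x : ↥(SigmaA A)} (hx : (shiftA A)^[P] x = x) (j : ℕ) :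
    oavg P f ((shiftA A)^[j] x) = oavg P f x := by
  unfold oavg
  congr 1
  have := sum_periodic (P := P) (fun i => f ((shiftA A)^[i] x)) (by
    intro i
    rw [Function.iterate_add_apply, hx]) j
  rw [← this]
  refine Finset.sum_congr rfl fun i _ => ?_
  rw [Function.iterate_add_apply]

lemma orbit_closed (x : ↥(SigmaA A)) {P : ℕ} (hP : 0 < P) (hx : (shiftA A)^[P] x = x) :
    IsClosed {y | ∃ k : ℕ, y = (shiftA A)^[k] x} := by
  have : {y | ∃ k : ℕ, y = (shiftA A)^[k] x} = (fun k => (shiftA A)^[k] x) '' (Set.Iio P) := by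
    ext y
    constructor
    · rintro ⟨k, rfl⟩
      refine ⟨k % P, Nat.mod_lt _ hP, ?_⟩
      exact Function.IsPeriodicPt.iterate_mod_apply hx k
    · rintro ⟨k, _, rfl⟩
      exact ⟨k, rfl⟩
  rw [this]
  exact ((Set.finite_Iio P).image _).isClosed

lemma co_ae {μ : ProbabilityMeasure ↥(SigmaA A)} {x : ↥(SigmaA A)} {P : ℕ} (hP : 0 < P)
    (hx : (shiftA A)^[P] x = x) (hs : μ.toMeasure {y | ∃ k : ℕ, y = (shiftA A)^[k] x} = 1) :
    ∀ᵐ y ∂μ.toMeasure, ∃ k : ℕ, y = (shiftA A)^[k] x :=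
  (prob_compl_eq_zero_iff (orbit_closed x hP hx).measurableSet).2 hs

lemma co_int {μ : ProbabilityMeasure ↥(SigmaA A)} (hμ : MeasurePreserving (shiftA A) μ.toMeasure μ.toMeasure)
    {x : ↥(SigmaA A)} {P : ℕ} (hP : 0 < P)
    (hx : (shiftA A)^[P] x = x) (hs : ∀ᵐ y ∂μ.toMeasure, ∃ k : ℕ, y = (shiftA A)^[k] x)
    (f : BoundedContinuousFunction ↥(SigmaA A) ℝ) : ∫ y, f y ∂μ.toMeasure = oavg P f x := by
  have hP' : (0 : ℝ) < P := by exact_mod_cast hP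
  have h1 : ∀ j : ℕ, ∫ x, f ((shiftA A)^[j] x) ∂μ.toMeasure = ∫ x, f x ∂μ.toMeasure := by
    intro j
    have := integral_map (μ := μ.toMeasure) (hμ.iterate j).measurable.aemeasurable (f := f) f.continuous.aestronglyMeasurable
    rw [(hμ.iterate j).map_eq] at this
    exact this.symm
  have h2 : ∫ y, oavg P f y ∂μ.toMeasure = ∫ x, f x ∂μ.toMeasure := by
    unfold oavg
    rw [integral_div, integral_finsetSum]
    · simp only [h1]
      simp
      field_simp
    · intro j _
      exact (f.compContinuous ⟨_, (continuous_shiftA A).iterate j⟩).integrable _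
  have h3 : ∫ y, oavg P f y ∂μ.toMeasure = ∫ y, oavg P f x ∂μ.toMeasure := by
    apply integral_congr_ae
    filter_upwards [hs] with y hy
    obtain ⟨k, rfl⟩ := hy
    exact oavg_orb _ hx k
  rw [← h2, h3]
  simp

lemma pm_ext {μ μ' : ProbabilityMeasure ↥(SigmaA A)}
    (h : ∀ f : BoundedContinuousFunction ↥(SigmaA A) ℝ, ∫ y, f y ∂μ.toMeasure = ∫ y, f y ∂μ'.toMeasure) :
    μ = μ' := by
  apply Subtype.ext
  exact ext_of_forall_integral_eq_of_IsFiniteMeasure (μ := μ.toMeasure) (ν := μ'.toMeasure) h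

lemma per_coord {x : ↥(SigmaA A)} {P : ℕ} (hx : (shiftA A)^[P] x = x) (i : ℤ) : x.1 (i + P) = x.1 i := by
  rw [← shiftA_iter, hx]

lemma per_coord_nat {x : ℤ → Fin t} {P : ℕ} (hx : ∀ i, x (i + P) = x i) (i : ℤ) (n : ℕ) :
    x (i + n * P) = x i := by
  induction n with
  | zero => simp
  | succ n ih =>
    rw [← ih, ← hx (i + n * P)]
    congr 1; push_cast; ring

lemma deviate (hrow : ∀ i : Fin t, ∃ j : Fin t, A i j = true) (hmix : TopMixing A)
    {x y : ↥(SigmaA A)} {P : ℕ} (hP : 0 < P) (hx : (shiftA A)^[P] x = x) (hy : (shiftA A)^[P] y = y)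
    (hne : ¬ ∃ n : ℕ, y = (shiftA A)^[n] x) :
    ∃ (j : ℕ) (β : Fin t), A (((shiftA A)^[j] x).1 0) β = true ∧ β ≠ ((shiftA A)^[j] x).1 1 := by
  by_contra! hc
  apply hne
  obtain ⟨n, hn0, hg⟩ := exists_glue hrow hmix
  have hc' : ∀ (j : ℕ) (β : Fin t), A (x.1 j) β = true → β = x.1 (j + 1) := by
    intro j β h
    have := hc j β (by rw [shiftA_iter]; simpa using h)
    rw [shiftA_iter] at this
    rw [this, add_comm]
  obtain ⟨w, hw, w0, wn⟩ := hg n le_rfl (x.1 0) (y.1 0)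
  have hwk : ∀ k : ℕ, k ≤ n → w k = x.1 k := by
    intro k
    induction k with
    | zero => intro _; simpa using w0
    | succ k ih =>
      intro hk
      have := hw k (by omega)
      rw [ih (by omega)] at this
      rw [hc' k _ this]; push_cast; rfl
  have hyk : ∀ k : ℕ, y.1 k = x.1 (k + n) := by
    intro k
    induction k with
    | zero => have := hwk n le_rfl; rw [wn] at this; simpa using this
    | succ k ih =>
      have := y.2 k
      rw [ih] at this
      have h2 := hc' (k + n) _ (by push_cast; exact this)
      push_cast at h2 ⊢
      rw [h2]; ring_nf
  refine ⟨n, Subtype.ext ?_⟩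
  funext i
  rw [shiftA_iter]
  have e1 := per_coord_nat (fun i => per_coord hy i) i i.natAbs
  have e2 := per_coord_nat (fun i => per_coord hx i) (i + n) i.natAbs
  have hnn : 0 ≤ i + i.natAbs * P := by
    have : (1 : ℤ) ≤ P := by exact_mod_cast hP
    have h4 : (i.natAbs : ℤ) ≤ i.natAbs * P := le_mul_of_one_le_right (by positivity) this
    omega
  obtain ⟨k, hk⟩ := Int.eq_ofNat_of_zero_le hnn
  rw [← e1, ← e2, hk, hyk k]
  rw [← hk]; ring_nf

lemma co_not_full {μ : ProbabilityMeasure ↥(SigmaA A)} {x y : ↥(SigmaA A)} {P : ℕ} (hP : 0 < P)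
    (hx : (shiftA A)^[P] x = x) (hs : ∀ᵐ y ∂μ.toMeasure, ∃ k : ℕ, y = (shiftA A)^[k] x)
    (hne : ¬ ∃ n : ℕ, y = (shiftA A)^[n] x) : ¬ FullSupp μ := by
  intro h
  have := h _ (orbit_closed x hP hx).isOpen_compl ⟨y, hne⟩
  exact this.ne' hs

theorem exists_BSys (hrow : ∀ i : Fin t, ∃ j : Fin t, A i j = true) (hmix : TopMixing A)
    (μ μ' : ProbabilityMeasure ↥(SigmaA A))
    (hCO : IsCOMeas (shiftA A) μ) (hCO' : IsCOMeas (shiftA A) μ') (hne : μ ≠ μ') :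
    ¬ FullSupp μ ∧ ¬ FullSupp μ' ∧ ∃ S : BSys A,
      (∀ f : BoundedContinuousFunction ↥(SigmaA A) ℝ, ∫ y, f y ∂μ.toMeasure = S.avg f (S.zp false)) ∧
      (∀ f : BoundedContinuousFunction ↥(SigmaA A) ℝ, ∫ y, f y ∂μ'.toMeasure = S.avg f (S.zp true)) := by
  obtain ⟨he, x, n, hn, hx, hs⟩ := hCO
  obtain ⟨he', x', n', hn', hx', hs'⟩ := hCO'
  have hP : 0 < n * n' := Nat.mul_pos hn hn'
  have hs := co_ae hn hx hs
  have hs' := co_ae hn' hx' hs'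
  replace hx : (shiftA A)^[n * n'] x = x := Function.IsPeriodicPt.mul_const hx n'
  replace hx' : (shiftA A)^[n * n'] x' = x' := Function.IsPeriodicPt.const_mul hx' n
  set P := n * n'
  have hi := co_int he.toMeasurePreserving hP hx hs
  have hi' := co_int he'.toMeasurePreserving hP hx' hs'
  have d1 : ¬ ∃ n : ℕ, x' = (shiftA A)^[n] x := by
    rintro ⟨k, rfl⟩
    refine hne (pm_ext fun f => ?_)
    rw [hi, hi', oavg_orb _ hx]
  have d2 : ¬ ∃ n : ℕ, x = (shiftA A)^[n] x' := by
    rintro ⟨k, rfl⟩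
    refine hne (pm_ext fun f => ?_)
    rw [hi, hi', oavg_orb _ hx']
  refine ⟨co_not_full hP hx hs d1, co_not_full hP hx' hs' d2, ?_⟩
  obtain ⟨j, β, b1, b2⟩ := deviate hrow hmix hP hx hx' d1
  obtain ⟨j', β', b1', b2'⟩ := deviate hrow hmix hP hx' hx d2
  let Z : Bool → ↥(SigmaA A) := fun b => bif b then (shiftA A)^[j'] x' else (shiftA A)^[j] x
  have hZ : ∀ b, (shiftA A)^[P] (Z b) = Z b := by
    intro b
    cases b
    · simp only [Z, cond_false, ← Function.iterate_add_apply]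
      rw [add_comm, Function.iterate_add_apply, hx]
    · simp only [Z, cond_true, ← Function.iterate_add_apply]
      rw [add_comm, Function.iterate_add_apply, hx']
  obtain ⟨D, hD, Blk, adm, dec, full⟩ := exists_blocks hrow hmix (fun b => (Z b).1) (fun b => (Z b).2) P hP
    (fun b i => per_coord (hZ b) i) (fun b => bif b then β' else β) (by
      intro b; cases b
      · exact b1
      · exact b1') (by
      intro b; cases b
      · exact b2
      · exact b2')
  refine ⟨⟨_, P, D, Blk, fun b => (Z b).2, hP, hD, fun b i => per_coord (hZ b) i, adm, dec, full⟩, ?_, ?_⟩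
  · intro f
    rw [hi, ← oavg_orb _ hx j]
    rfl
  · intro f
    rw [hi', ← oavg_orb _ hx' j']
    rfl

end CO


section Path
variable {t : ℕ} {A : Fin t → Fin t → Bool} (S : BSys A) (μ μ' : ProbabilityMeasure ↥(SigmaA A))

/-- convex combinations of the two given measures -/
noncomputable def mixM (s : unitInterval) : ProbabilityMeasure ↥(SigmaA A) :=
  ⟨ENNReal.ofReal s • μ'.toMeasure + (1 - ENNReal.ofReal s) • μ.toMeasure, ⟨by
    have : ENNReal.ofReal (s : ℝ) ≤ 1 := by simpa using s.2.2
    simp [add_tsub_cancel_of_le this]⟩⟩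

lemma mixM_coe (s : unitInterval) : (mixM μ μ' s).toMeasure =
    ENNReal.ofReal s • μ'.toMeasure + (1 - ENNReal.ofReal s) • μ.toMeasure := rfl

lemma mixM_int (s : unitInterval) (f : BoundedContinuousFunction ↥(SigmaA A) ℝ) :
    ∫ x, f x ∂(mixM μ μ' s).toMeasure =
      (1 - (s : ℝ)) * ∫ x, f x ∂μ.toMeasure + s * ∫ x, f x ∂μ'.toMeasure := by
  have h1 : (1 : ℝ≥0∞) - ENNReal.ofReal s = ENNReal.ofReal (1 - s) := by
    rw [ENNReal.ofReal_sub _ s.2.1, ENNReal.ofReal_one]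
  rw [mixM_coe, h1, integral_add_measure, integral_smul_measure, integral_smul_measure,
    ENNReal.toReal_ofReal s.2.1, ENNReal.toReal_ofReal (by linarith [s.2.2])]
  · simp only [smul_eq_mul]; ring
  · exact (f.integrable _).smul_measure ENNReal.ofReal_ne_top
  · exact (f.integrable _).smul_measure ENNReal.ofReal_ne_top

/-- noise parameter -/
noncomputable def ee (p : unitInterval × unitInterval) : ℝ :=
  eps0 S.P S.D * (p.1 * (p.2 * (1 - p.2)))

lemma ee_nonneg (p : unitInterval × unitInterval) : 0 ≤ ee S p := by
  have h0 := (eps0_pos S.hP S.hD).le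
  have h1 := p.1.2.1
  have h2 := p.2.2.1
  have h3 := p.2.2.2
  have h4 : 0 ≤ 1 - (p.2 : ℝ) := by linarith
  unfold ee; positivity

lemma ee_le (p : unitInterval × unitInterval) : ee S p ≤ eps0 S.P S.D := by
  have h0 := (eps0_pos S.hP S.hD).le
  have h1 := p.1.2.1
  have h1' := p.1.2.2
  have h2 := p.2.2.1
  have h3 := p.2.2.2
  have h4 : 0 ≤ 1 - (p.2 : ℝ) := by linarith
  unfold ee
  refine mul_le_of_le_one_right h0 (mul_le_one₀ h1' (by positivity) (mul_le_one₀ h3 h4 (by linarith)))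

lemma ee_cont : Continuous (ee S) := by unfold ee; fun_prop

open Classical in
/-- the two-parameter family -/
noncomputable def Theta (p : unitInterval × unitInterval) : ProbabilityMeasure ↥(SigmaA A) :=
  if ee S p = 0 then mixM μ μ' p.2 else S.Law (ee S p) p.2

lemma Theta_zero {p : unitInterval × unitInterval} (h : ee S p = 0) :
    Theta S μ μ' p = mixM μ μ' p.2 := if_pos h

lemma Theta_ne {p : unitInterval × unitInterval} (h : ee S p ≠ 0) :
    Theta S μ μ' p = S.Law (ee S p) p.2 := if_neg h

lemma Theta_cont
    (h1 : ∀ f : BoundedContinuousFunction ↥(SigmaA A) ℝ, ∫ y, f y ∂μ.toMeasure = S.avg f (S.zp false))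
    (h2 : ∀ f : BoundedContinuousFunction ↥(SigmaA A) ℝ, ∫ y, f y ∂μ'.toMeasure = S.avg f (S.zp true)) :
    Continuous (Theta S μ μ') := by
  rw [continuous_iff_continuousAt]
  intro p
  refine ProbabilityMeasure.tendsto_iff_forall_integral_tendsto.2 fun f => ?_
  by_cases hp : ee S p = 0
  · have hG : Continuous (fun q : unitInterval × unitInterval =>
        (1 - (q.2 : ℝ)) * S.avg f (S.zp false) + q.2 * S.avg f (S.zp true)) := by fun_prop
    have hG' := hG.tendsto p
    suffices h : Tendsto (fun q : unitInterval × unitInterval => ∫ x, f x ∂(Theta S μ μ' q).toMeasure -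
        ((1 - (q.2 : ℝ)) * S.avg f (S.zp false) + q.2 * S.avg f (S.zp true))) (𝓝 p) (𝓝 0) by
      have h3 := h.add hG'
      simp only [sub_add_cancel, zero_add] at h3
      have e : ∫ x, f x ∂(Theta S μ μ' p).toMeasure =
          (1 - (p.2 : ℝ)) * S.avg f (S.zp false) + p.2 * S.avg f (S.zp true) := by
        rw [Theta_zero _ _ _ hp, mixM_int, h1, h2]
      rw [← e] at h3
      exact h3
    rw [← nhdsWithin_univ p, ← Set.union_compl_self {q | ee S q = 0}, nhdsWithin_union]
    refine Tendsto.sup ?_ ?_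
    · refine tendsto_const_nhds.congr' ?_
      filter_upwards [self_mem_nhdsWithin] with q hq
      rw [Theta_zero _ _ _ hq, mixM_int, h1, h2]
      ring
    · have := S.Law_zero (l := 𝓝[{q | ee S q = 0}ᶜ] p) (ε := ee S) (s := fun q => (q.2 : ℝ))
        (by have := (ee_cont S).tendsto p
            rw [hp] at this
            exact this.mono_left nhdsWithin_le_nhds)
        (by filter_upwards [self_mem_nhdsWithin] with q hq
            exact ⟨lt_of_le_of_ne (ee_nonneg S q) (Ne.symm hq), ee_le S q⟩)
        (fun q => ⟨q.2.2.1, q.2.2.2⟩) f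
      refine this.congr' ?_
      filter_upwards [self_mem_nhdsWithin] with q hq
      rw [Theta_ne _ _ _ hq]
  · have hpos : 0 < ee S p := lt_of_le_of_ne (ee_nonneg S p) (Ne.symm hp)
    have hev : ∀ᶠ q in 𝓝 p, 0 < ee S q := (ee_cont S).continuousAt.eventually (lt_mem_nhds hpos)
    have h3 := S.Law_cont (s := (p.2 : ℝ)) hpos (ee_le S p) f
    have h4 : Tendsto (fun q : unitInterval × unitInterval => (ee S q, (q.2 : ℝ))) (𝓝 p)
        (𝓝[{p | 0 < p.1 ∧ p.1 ≤ eps0 S.P S.D}] (ee S p, (p.2 : ℝ))) := by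
      refine tendsto_nhdsWithin_iff.2 ⟨?_, ?_⟩
      · have : Continuous (fun q : unitInterval × unitInterval => (ee S q, (q.2 : ℝ))) := by
          have := ee_cont S
          fun_prop
        exact this.tendsto p
      · filter_upwards [hev] with q hq
        exact ⟨hq, ee_le S q⟩
    rw [Theta_ne _ _ _ hp]
    refine (h3.comp h4).congr' ?_
    filter_upwards [hev] with q hq
    rw [Theta_ne _ _ _ hq.ne']
    rfl

lemma exists_small {W : Set unitInterval} (hW : IsOpen W) (h0 : (0 : unitInterval) ∈ W) :
    ∃ c ∈ W, (0 : ℝ) < (c : ℝ) := by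
  let u : ℕ → unitInterval := fun n => ⟨1 / ((n : ℝ) + 1), by positivity, by
    rw [div_le_one (by positivity)]; linarith [Nat.cast_nonneg (α := ℝ) n]⟩
  have hu : Tendsto u atTop (𝓝 0) := by
    rw [tendsto_subtype_rng]
    exact tendsto_one_div_add_atTop_nhds_zero_nat
  obtain ⟨n, hn⟩ := (hu.eventually (hW.mem_nhds h0)).exists
  refine ⟨_, hn, ?_⟩
  simp only [u]; positivity

end Path

theorem sigmund_aux (t : ℕ) (A : Fin t → Fin t → Bool)
    (hrow : ∀ i : Fin t, ∃ j : Fin t, A i j = true)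
    (hmix : TopMixing A)
    (μ μ' : ProbabilityMeasure ↥(SigmaA A))
    (hCO : IsCOMeas (shiftA A) μ) (hCO' : IsCOMeas (shiftA A) μ') (hne : μ ≠ μ')
    (U : Set (ProbabilityMeasure ↥(SigmaA A)))
    (hU2 : ∃ V, IsOpen V ∧ U = V ∩ InvMeas (shiftA A))
    (hU3 : ConvexMeasSet U) (hμU : μ ∈ U) (hμ'U : μ' ∈ U) :
    ∃ θ : unitInterval → ProbabilityMeasure ↥(SigmaA A),
      IsEmbedding θ ∧ θ 0 = μ ∧ θ 1 = μ' ∧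
      (∀ s : unitInterval, θ s ∈ U ∧ θ s ∈ ErgMeas (shiftA A)) ∧
      ∀ s : unitInterval, s ≠ 0 → s ≠ 1 →
        FullSupp (θ s) ∧ IsBernoulli (shiftA A) (θ s).toMeasure := by
  obtain ⟨nf, nf', S, h1, h2⟩ := exists_BSys hrow hmix μ μ' hCO hCO' hne
  obtain ⟨V, hV, hUV⟩ := hU2
  have hcont := Theta_cont S μ μ' h1 h2
  have hmem : ∀ s, Theta S μ μ' (0, s) ∈ V := by
    intro s
    rw [Theta_zero _ _ _ (by simp [ee])]
    have : mixM μ μ' s ∈ U := hU3 μ' hμ'U μ hμU (ENNReal.ofReal s) (by simpa using s.2.2) _ rfl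
    rw [hUV] at this
    exact this.1
  obtain ⟨W, W', hW, hW', h0W, hW'u, hsub⟩ := generalized_tube_lemma (isCompact_singleton (x := (0 : unitInterval)))
    (isCompact_univ (X := unitInterval)) (hV.preimage hcont) (by
      rintro ⟨a, s⟩ ⟨ha, _⟩
      rw [Set.mem_singleton_iff] at ha
      change a = 0 at ha
      subst ha
      exact hmem s)
  obtain ⟨c, hcW, hc⟩ := exists_small hW (h0W rfl)
  have heps := eps0_pos S.hP S.hD
  have hpos : ∀ s : unitInterval, s ≠ 0 → s ≠ 1 → 0 < ee S (c, s) := by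
    intro s h h'
    have a1 : 0 < (s : ℝ) := unitInterval.pos_iff_ne_zero.2 h
    have a2 : (s : ℝ) < 1 := unitInterval.lt_one_iff_ne_one.2 h'
    have a3 : 0 < 1 - (s : ℝ) := by linarith
    unfold ee
    positivity
  have t0 : Theta S μ μ' (c, 0) = μ := by
    rw [Theta_zero _ _ _ (by simp [ee])]
    apply Subtype.ext
    change (mixM μ μ' 0).toMeasure = μ.toMeasure
    rw [mixM_coe]; simp
  have t1 : Theta S μ μ' (c, 1) = μ' := by
    rw [Theta_zero _ _ _ (by simp [ee])]
    apply Subtype.ext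
    change (mixM μ μ' 1).toMeasure = μ'.toMeasure
    rw [mixM_coe]; simp
  have ti : ∀ s : unitInterval, s ≠ 0 → s ≠ 1 → Theta S μ μ' (c, s) = S.Law (ee S (c, s)) s :=
    fun s h h' => Theta_ne _ _ _ (hpos s h h').ne'
  have hfull : ∀ s : unitInterval, s ≠ 0 → s ≠ 1 → FullSupp (Theta S μ μ' (c, s)) := by
    intro s h h'
    rw [ti s h h']
    exact S.fullSupp_Law (hpos s h h') (ee_le S _) s.2.1 (unitInterval.lt_one_iff_ne_one.2 h')
  have herg : ∀ s, Theta S μ μ' (c, s) ∈ ErgMeas (shiftA A) := by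
    intro s
    by_cases h : s = 0
    · subst h; rw [t0]; exact hCO.1
    by_cases h' : s = 1
    · subst h'; rw [t1]; exact hCO'.1
    rw [ti s h h']
    exact S.ergodic_Law (hpos s h h') (ee_le S _)
  have hθc : Continuous (fun s => Theta S μ μ' (c, s)) := hcont.comp (by fun_prop)
  have key0 : ∀ s, Theta S μ μ' (c, s) = μ → s = 0 := by
    intro s hs
    by_contra h
    by_cases h' : s = 1
    · subst h'; rw [t1] at hs; exact hne hs.symm
    · exact nf (hs ▸ hfull s h h')
  have key1 : ∀ s, Theta S μ μ' (c, s) = μ' → s = 1 := by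
    intro s hs
    by_contra h'
    by_cases h : s = 0
    · subst h; rw [t0] at hs; exact hne hs
    · exact nf' (hs ▸ hfull s h h')
  have hinj : Function.Injective (fun s => Theta S μ μ' (c, s)) := by
    intro s s' hss
    simp only at hss
    by_cases h : s = 0
    · subst h; rw [t0] at hss; exact (key0 s' hss.symm).symm
    by_cases h' : s = 1
    · subst h'; rw [t1] at hss; exact (key1 s' hss.symm).symm
    by_cases k : s' = 0
    · subst k; rw [t0] at hss; exact key0 s hss
    by_cases k' : s' = 1
    · subst k'; rw [t1] at hss; exact key1 s hss
    rw [ti s h h', ti s' k k'] at hss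
    exact Subtype.ext (S.Law_inj (hpos s h h') (ee_le S _) s.2.1 s.2.2 (hpos s' k k') (ee_le S _)
      s'.2.1 s'.2.2 hss)
  refine ⟨fun s => Theta S μ μ' (c, s), (hθc.isClosedEmbedding hinj).isEmbedding, t0, t1, ?_, ?_⟩
  · intro s
    refine ⟨?_, herg s⟩
    rw [hUV]
    exact ⟨hsub ⟨hcW, hW'u (Set.mem_univ s)⟩, (herg s).toMeasurePreserving⟩
  · intro s h h'
    refine ⟨hfull s h h', ?_⟩
    simp only [ti s h h']
    exact S.isBernoulli_Law (hpos s h h') (ee_le S _)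

/-- Lemma 4.2 (Sigmund): on a topologically mixing SFT, any two distinct `CO`-measures lying
in a convex open subset `U` of `M(Σ_A)` are joined by a homeomorphism onto its image
`t ∈ [0,1] ↦ θ_t ∈ U ∩ M^e(Σ_A)` such that `θ_t` is fully supported and Bernoulli for all
`t ∈ (0,1)`. -/
theorem sigmund_path_SFT (t : ℕ) (A : Fin t → Fin t → Bool)
    (hrow : ∀ i : Fin t, ∃ j : Fin t, A i j = true)
    (hmix : TopMixing A)
    (μ μ' : ProbabilityMeasure ↥(SigmaA A))
    (hCO : IsCOMeas (shiftA A) μ) (hCO' : IsCOMeas (shiftA A) μ') (hne : μ ≠ μ')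
    (U : Set (ProbabilityMeasure ↥(SigmaA A)))
    (hU1 : U ⊆ InvMeas (shiftA A)) (hU2 : ∃ V, IsOpen V ∧ U = V ∩ InvMeas (shiftA A))
    (hU3 : ConvexMeasSet U) (hμU : μ ∈ U) (hμ'U : μ' ∈ U) :
    ∃ θ : unitInterval → ProbabilityMeasure ↥(SigmaA A),
      IsEmbedding θ ∧ θ 0 = μ ∧ θ 1 = μ' ∧
      (∀ s : unitInterval, θ s ∈ U ∧ θ s ∈ ErgMeas (shiftA A)) ∧
      ∀ s : unitInterval, s ≠ 0 → s ≠ 1 →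
        FullSupp (θ s) ∧ IsBernoulli (shiftA A) (θ s).toMeasure := by
  exact sigmund_aux t A hrow hmix μ μ' hCO hCO' hne U hU2 hU3 hμU hμ'U
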